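/- Let u be a smooth solution of (−Δ)^{3/2}u = 2e^{3u} with finite volume, and suppose u is not a spherical solution (i.e. there are no λ > 0, x₀ ∈ ℝ³ with u(x) = log(2λ/(1+λ²|x−x₀|²))). Then the volume satisfies V := ∫_{ℝ³} e^{3u(x)} dx < 2π². -/

import Mathlib

open MeasureTheory Real Filter

noncomputable section

abbrev E3 := EuclideanSpace ℝ (Fin 3)

/-- The Laplacian of `f : ℝ³ → ℝ` as the sum of second partial derivatives. -/
def lap (f : E3 → ℝ) (x : E3) : ℝ :=
  ∑ i, fderiv ℝ (fun y => fderiv ℝ f y (EuclideanSpace.single i 1)) x (EuclideanSpace.single i 1)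

/-- The half Laplacian `(-Δ)^{1/2} φ` of a Schwartz function on ℝ³, defined as a
principal value: `(1/π²) lim_{ε→0⁺} ∫_{|x−y|>ε} (φ(x)−φ(y))/|x−y|⁴ dy`. -/
def halfLap (φ : SchwartzMap E3 ℝ) (x : E3) : ℝ :=
  limUnder (nhdsWithin (0:ℝ) (Set.Ioi 0)) fun ε =>
    (1 / π ^ 2) * ∫ y in {y : E3 | ε < ‖x - y‖}, (φ x - φ y) / ‖x - y‖ ^ 4

/-- `w ∈ L_{1/2}(ℝ³)`. -/
def MemL12 (w : E3 → ℝ) : Prop :=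
  LocallyIntegrable w volume ∧ Integrable (fun x => |w x| / (1 + ‖x‖ ^ 4)) volume

/-- `u` is a smooth solution of `(-Δ)^{3/2} u = 2 e^{3u}` in ℝ³ with finite volume. -/
def IsSolution (u : E3 → ℝ) : Prop :=
  ContDiff ℝ (⊤ : ℕ∞) u ∧ MemL12 (lap u) ∧ Integrable (fun x => exp (3 * u x)) volume ∧
    ∀ φ : SchwartzMap E3 ℝ,
      ∫ x, (-(lap u x)) * halfLap φ x = 2 * ∫ x, exp (3 * u x) * φ x

/-- `u` is a spherical solution. -/
def IsSpherical (u : E3 → ℝ) : Prop :=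
  ∃ lam : ℝ, 0 < lam ∧ ∃ x₀ : E3, ∀ x, u x = log (2 * lam / (1 + lam ^ 2 * ‖x - x₀‖ ^ 2))

/-- `α = (1/π²) ∫ e^{3u}`. -/
def solAlpha (u : E3 → ℝ) : ℝ := (1 / π ^ 2) * ∫ y, exp (3 * u y)

/-- `v(x) = (1/π²) ∫ log(|y|/|x−y|) e^{3u(y)} dy`. -/
def solV (u : E3 → ℝ) (x : E3) : ℝ :=
  (1 / π ^ 2) * ∫ y, log (‖y‖ / ‖x - y‖) * exp (3 * u y)

end

/-- The kernel `|z|⁻²` truncated to the unit ball. -/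
noncomputable def ballKer (z : E3) : ℝ := (Metric.ball (0 : E3) 1).indicator (fun z => (‖z‖ ^ 2)⁻¹) z

lemma ballKer_nonneg (z : E3) : 0 ≤ ballKer z :=
  Set.indicator_nonneg (fun _ _ => by positivity) z

lemma ballKer_of_lt {z : E3} (hz : ‖z‖ < 1) : ballKer z = (‖z‖ ^ 2)⁻¹ :=
  Set.indicator_of_mem (by simpa using hz) _

lemma ballKer_of_le {z : E3} (hz : 1 ≤ ‖z‖) : ballKer z = 0 :=
  Set.indicator_of_notMem (by simpa using hz) _

lemma measurable_ballKer : Measurable ballKer :=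
  Measurable.indicator (by fun_prop) measurableSet_ball

lemma integrable_ballKer : Integrable ballKer := by
  refine (integrable_indicator_iff measurableSet_ball).2 ?_
  refine (integrableOn_fun_norm_addHaar volume (f := fun t : ℝ => (t ^ 2)⁻¹)).2 ?_
  have h : IntegrableOn (fun _ : ℝ => (1 : ℝ)) (Set.Ioo 0 1) := by simp
  refine h.congr_fun (fun t ht => ?_) measurableSet_Ioo
  have := ht.1.ne'
  simp
  field_simp

lemma integrable_ballKer_sub (x : E3) : Integrable (fun y => ballKer (x - y)) :=
  integrable_ballKer.comp_sub_left x

lemma integral_ballKer_nonneg : 0 ≤ ∫ z, ballKer z := integral_nonneg ballKer_nonneg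

lemma inv_norm_le_ballKer {r : ℝ} (hr : 0 < r) (hr1 : r ≤ 1) (z : E3) :
    ‖z‖⁻¹ ≤ r⁻¹ + r * ballKer z := by
  have hb := mul_nonneg hr.le (ballKer_nonneg z)
  rcases lt_or_ge ‖z‖ r with h | h
  · rw [ballKer_of_lt (h.trans_le hr1)]
    rcases (norm_nonneg z).eq_or_lt with h0 | h0
    · rw [← h0]; simp [hr.le]
    · have : ‖z‖⁻¹ ≤ r * (‖z‖ ^ 2)⁻¹ := by
        rw [pow_two, mul_inv, ← mul_assoc]
        have : 1 ≤ r * ‖z‖⁻¹ := by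
          rw [← div_eq_mul_inv, one_le_div h0]; exact h.le
        have h3 : 0 < ‖z‖⁻¹ := by positivity
        nlinarith
      have : 0 < r⁻¹ := by positivity
      linarith
  · have : ‖z‖⁻¹ ≤ r⁻¹ := by gcongr
    linarith

lemma integrable_ballKer_mul {m : E3 → ℝ} (hm : Continuous m) (x : E3) :
    Integrable (fun y => ballKer (x - y) * m y) := by
  obtain ⟨C, hC⟩ := (isCompact_closedBall x 1).exists_bound_of_continuousOn hm.continuousOn
  refine ((integrable_ballKer_sub x).mul_const C).mono' ?_ (ae_of_all _ fun y => ?_)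
  · exact ((measurable_ballKer.comp (measurable_const.sub measurable_id)).mul
      hm.measurable).aestronglyMeasurable
  · rw [norm_mul, norm_eq_abs, abs_of_nonneg (ballKer_nonneg _)]
    rcases lt_or_ge ‖x - y‖ 1 with h | h
    · exact mul_le_mul_of_nonneg_left
        (hC y (by rw [Metric.mem_closedBall, dist_comm, dist_eq_norm]; exact h.le))
        (ballKer_nonneg _)
    · simp [ballKer_of_le h]

lemma integrable_kernel_mul {m k : E3 → ℝ} (hm : Continuous m) (hmi : Integrable m)
    (hk : Measurable k) {A B : ℝ} (hkA : ∀ z, |k z| ≤ A + B * ballKer z) (x : E3) :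
    Integrable (fun y => k (x - y) * m y) := by
  refine ((hmi.norm.const_mul A).add (((integrable_ballKer_mul hm x).norm).const_mul B)).mono'
    ((hk.comp (measurable_const.sub measurable_id)).mul hm.measurable).aestronglyMeasurable
    (ae_of_all _ fun y => ?_)
  have := mul_le_mul_of_nonneg_right (hkA (x - y)) (abs_nonneg (m y))
  simp only [norm_mul, norm_eq_abs, Pi.add_apply, abs_of_nonneg (ballKer_nonneg _)]
  linarith

lemma setIntegral_kernel_mul_le {m k : E3 → ℝ} (hm : Continuous m) (hmi : Integrable m)
    (hm0 : ∀ y, 0 ≤ m y) {G : ℝ} (hG : ∀ y, m y ≤ G)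
    (hk : Measurable k) {A B : ℝ} (hB : 0 ≤ B) (hkA : ∀ z, |k z| ≤ A + B * ballKer z) (x : E3)
    (S : Set E3) :
    ∫ y in S, k (x - y) * m y ≤ A * (∫ y in S, m y) + B * G * ∫ z, ballKer z := by
  have hi := integrable_kernel_mul hm hmi hk hkA x
  have hib := integrable_ballKer_sub x
  calc ∫ y in S, k (x - y) * m y
      ≤ ∫ y in S, (A * m y + B * G * ballKer (x - y)) := by
        refine integral_mono hi.integrableOn
          ((hmi.const_mul A).add (hib.const_mul (B * G))).integrableOn fun y => ?_
        have h1 := mul_le_mul_of_nonneg_right ((le_abs_self _).trans (hkA (x - y))) (hm0 y)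
        have h2 := mul_le_mul_of_nonneg_left (hG y) (mul_nonneg hB (ballKer_nonneg (x - y)))
        simp only
        linarith
    _ = A * (∫ y in S, m y) + B * G * ∫ y in S, ballKer (x - y) := by
        rw [integral_add (hmi.const_mul A).integrableOn (hib.const_mul (B * G)).integrableOn,
          integral_const_mul, integral_const_mul]
    _ ≤ _ := by
        have h3 : ∫ y in S, ballKer (x - y) ≤ ∫ z, ballKer z := by
          rw [← integral_sub_left_eq_self ballKer volume x]
          exact setIntegral_le_integral hib (ae_of_all _ fun y => ballKer_nonneg _)
        have : 0 ≤ G := (hm0 0).trans (hG 0)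
        gcongr

/-- The inversion of `ℝ³` in the sphere of radius `l` around the origin. -/
noncomputable abbrev kelvin (l : ℝ) (x : E3) : E3 := EuclideanGeometry.inversion 0 l x

lemma kelvin_eq (l : ℝ) (x : E3) : kelvin l x = (l / ‖x‖) ^ 2 • x := by
  simp [EuclideanGeometry.inversion]

lemma norm_kelvin (l : ℝ) (x : E3) : ‖kelvin l x‖ = l ^ 2 / ‖x‖ := by
  simpa using EuclideanGeometry.dist_inversion_center (0 : E3) x l

lemma kelvin_kelvin {l : ℝ} (hl : l ≠ 0) (x : E3) : kelvin l (kelvin l x) = x :=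
  EuclideanGeometry.inversion_inversion _ hl x

lemma image_kelvin_exterior {l : ℝ} (hl : 0 < l) :
    kelvin l '' {y | l < ‖y‖} = {y | 0 < ‖y‖ ∧ ‖y‖ < l} := by
  ext y
  constructor
  · rintro ⟨x, hx, rfl⟩
    have hx' : l < ‖x‖ := hx
    have h0 : 0 < ‖x‖ := hl.trans hx'
    simp only [Set.mem_ofPred_eq, norm_kelvin]
    refine ⟨by positivity, ?_⟩
    rw [div_lt_iff₀ h0]
    nlinarith
  · rintro ⟨h0, h1⟩
    refine ⟨kelvin l y, ?_, kelvin_kelvin hl.ne' y⟩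
    simp only [Set.mem_ofPred_eq, norm_kelvin]
    rw [lt_div_iff₀ h0]
    nlinarith

lemma hasFDerivAt_kelvin (l : ℝ) {x : E3} (hx : x ≠ 0) :
    HasFDerivAt (kelvin l)
      ((l / ‖x‖) ^ 2 • ((Submodule.span ℝ {x})ᗮ.reflection : E3 →L[ℝ] E3)) x := by
  simpa using EuclideanGeometry.hasFDerivAt_inversion (c := (0 : E3)) (R := l) hx

lemma abs_det_smul_reflection (c : ℝ) (K : Submodule ℝ E3) :
    |(c • (K.reflection : E3 →L[ℝ] E3)).det| = |c| ^ 3 := by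
  have h : ((c • (K.reflection : E3 →L[ℝ] E3) : E3 →L[ℝ] E3) : E3 →ₗ[ℝ] E3)
      = c • (K.reflection.toLinearEquiv : E3 →ₗ[ℝ] E3) := rfl
  rw [ContinuousLinearMap.det, h, LinearMap.det_smul, abs_mul, abs_pow]
  have h2 := K.det_reflection
  rw [h2]
  simp

lemma ae_ball_eq_punctured (l : ℝ) :
    ({y : E3 | 0 < ‖y‖ ∧ ‖y‖ < l} : Set E3) =ᵐ[volume] {y | ‖y‖ < l} := by
  have : ∀ᵐ y : E3, y ≠ 0 := by
    simp [ae_iff]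
  filter_upwards [this] with y hy
  apply propext
  change (0 < ‖y‖ ∧ ‖y‖ < l) ↔ ‖y‖ < l
  simp [hy]

lemma measurableSet_exterior (l : ℝ) : MeasurableSet {y : E3 | l < ‖y‖} :=
  measurableSet_lt measurable_const measurable_norm

lemma setIntegral_ball_eq_exterior {l : ℝ} (hl : 0 < l) (F : E3 → ℝ) :
    ∫ y in {y | ‖y‖ < l}, F y = ∫ y in {y | l < ‖y‖}, (l / ‖y‖) ^ 6 * F (kelvin l y) := by
  rw [← setIntegral_congr_set (ae_ball_eq_punctured l), ← image_kelvin_exterior hl,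
    integral_image_eq_integral_abs_det_fderiv_smul volume (measurableSet_exterior l)
      (fun x hx => (hasFDerivAt_kelvin l (norm_pos_iff.1 (hl.trans hx))).hasFDerivWithinAt)
      (EuclideanGeometry.inversion_injective _ hl.ne').injOn]
  refine setIntegral_congr_fun (measurableSet_exterior l) fun y _ => ?_
  simp only [abs_det_smul_reflection, smul_eq_mul, abs_pow, abs_div]
  rw [← pow_mul, ← abs_div, ← abs_pow, abs_of_nonneg (by positivity)]

lemma integrableOn_ball_iff_exterior {l : ℝ} (hl : 0 < l) (F : E3 → ℝ) :
    IntegrableOn F {y | ‖y‖ < l} ↔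
      IntegrableOn (fun y => (l / ‖y‖) ^ 6 * F (kelvin l y)) {y | l < ‖y‖} := by
  rw [← integrableOn_congr_set_ae (ae_ball_eq_punctured l), ← image_kelvin_exterior hl,
    integrableOn_image_iff_integrableOn_abs_det_fderiv_smul volume (measurableSet_exterior l)
      (fun x hx => (hasFDerivAt_kelvin l (norm_pos_iff.1 (hl.trans hx))).hasFDerivWithinAt)
      (EuclideanGeometry.inversion_injective _ hl.ne').injOn]
  refine integrableOn_congr_fun (fun y _ => ?_) (measurableSet_exterior l)
  simp only [abs_det_smul_reflection, smul_eq_mul, abs_pow, abs_div]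
  rw [← pow_mul, ← abs_div, ← abs_pow, abs_of_nonneg (by positivity)]

/-- The logarithmic kernel, antisymmetrised with respect to inversion. -/
noncomputable def kelvinKer (l : ℝ) (x y : E3) : ℝ :=
  log (‖kelvin l x - y‖ * ‖x‖ / (l * ‖x - y‖))

lemma kelvin_sub_sq {l : ℝ} {x : E3} (hx : x ≠ 0) (y : E3) :
    (‖kelvin l x - y‖ * ‖x‖) ^ 2
      = l ^ 2 * ‖x - y‖ ^ 2 + (‖x‖ ^ 2 - l ^ 2) * (‖y‖ ^ 2 - l ^ 2) := by
  have h0 : ‖x‖ ≠ 0 := norm_ne_zero_iff.2 hx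
  rw [mul_pow, @norm_sub_sq_real, @norm_sub_sq_real, norm_kelvin, kelvin_eq, inner_smul_left]
  simp only [conj_trivial]
  field_simp
  ring

lemma kelvinKer_sq {l : ℝ} (hl : 0 < l) {x y : E3} (hx : x ≠ 0) (hxy : x ≠ y) :
    (‖kelvin l x - y‖ * ‖x‖ / (l * ‖x - y‖)) ^ 2
      = 1 + (‖x‖ ^ 2 - l ^ 2) * (‖y‖ ^ 2 - l ^ 2) / (l ^ 2 * ‖x - y‖ ^ 2) := by
  have h0 : ‖x - y‖ ≠ 0 := norm_ne_zero_iff.2 (sub_ne_zero.2 hxy)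
  rw [div_pow, kelvin_sub_sq hx]
  field_simp

lemma kelvinKer_pos {l : ℝ} (hl : 0 < l) {x y : E3} (hx : l < ‖x‖) (hy : l < ‖y‖) (hxy : x ≠ y) :
    0 < kelvinKer l x y := by
  have hx0 : x ≠ 0 := norm_pos_iff.1 (hl.trans hx)
  have h0 : 0 < ‖x - y‖ := norm_pos_iff.2 (sub_ne_zero.2 hxy)
  refine log_pos ?_
  rw [← one_lt_sq_iff₀ (by positivity), kelvinKer_sq hl hx0 hxy]
  have h1 : 0 < ‖x‖ ^ 2 - l ^ 2 := by nlinarith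
  have h2 : 0 < ‖y‖ ^ 2 - l ^ 2 := by nlinarith
  have : 0 < (‖x‖ ^ 2 - l ^ 2) * (‖y‖ ^ 2 - l ^ 2) / (l ^ 2 * ‖x - y‖ ^ 2) := by positivity
  linarith

lemma kelvinKer_nonneg {l : ℝ} (hl : 0 < l) {x y : E3} (hx : l < ‖x‖) (hy : l < ‖y‖) :
    0 ≤ kelvinKer l x y := by
  by_cases hxy : x = y
  · simp [kelvinKer, hxy]
  · exact (kelvinKer_pos hl hx hy hxy).le

lemma kelvinKer_le {l : ℝ} (hl : 0 < l) {x y : E3} (hx : l < ‖x‖) (hy : l < ‖y‖) :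
    kelvinKer l x y ≤ 1 / l * (‖y‖ + ‖y‖ ^ 2 / ‖x - y‖) := by
  by_cases hxy : x = y
  · have : 0 < ‖y‖ := hl.trans hy
    simp only [kelvinKer, hxy, sub_self, norm_zero, mul_zero, div_zero, log_zero, add_zero]
    positivity
  have hx0 : x ≠ 0 := norm_pos_iff.1 (hl.trans hx)
  have h0 : 0 < ‖x - y‖ := norm_pos_iff.2 (sub_ne_zero.2 hxy)
  have hy0 : 0 < ‖y‖ := hl.trans hy
  have hpos : 0 < ‖kelvin l x - y‖ * ‖x‖ / (l * ‖x - y‖) := by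
    have := kelvinKer_pos hl hx hy hxy
    by_contra h
    have h' : ‖kelvin l x - y‖ * ‖x‖ / (l * ‖x - y‖) = 0 :=
      le_antisymm (not_lt.1 h) (by positivity)
    simp [kelvinKer, h'] at this
  set X := 1 / l * (‖y‖ + ‖y‖ ^ 2 / ‖x - y‖) with hX
  have hX0 : 0 < X := by positivity
  rw [kelvinKer, log_le_iff_le_exp hpos]
  have h1 : ‖kelvin l x - y‖ * ‖x‖ / (l * ‖x - y‖) ≤ 1 + X := by
    refine le_of_sq_le_sq ?_ (by positivity)
    rw [kelvinKer_sq hl hx0 hxy]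
    have h2 : ‖x‖ * ‖y‖ / (l * ‖x - y‖) ≤ X := by
      rw [hX, div_le_iff₀ (by positivity)]
      have h3 : ‖x‖ ≤ ‖y‖ + ‖x - y‖ := by
        have := norm_add_le y (x - y)
        simpa using this
      have : 1 / l * (‖y‖ + ‖y‖ ^ 2 / ‖x - y‖) * (l * ‖x - y‖) = ‖y‖ * (‖y‖ + ‖x - y‖) := by
        field_simp
        ring
      rw [this]
      nlinarith
    have h4 : (‖x‖ ^ 2 - l ^ 2) * (‖y‖ ^ 2 - l ^ 2) / (l ^ 2 * ‖x - y‖ ^ 2)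
        ≤ (‖x‖ * ‖y‖ / (l * ‖x - y‖)) ^ 2 := by
      rw [div_pow, mul_pow, mul_pow]
      gcongr
      · nlinarith
      · nlinarith
      · nlinarith
    have h5 : (‖x‖ * ‖y‖ / (l * ‖x - y‖)) ^ 2 ≤ X ^ 2 := by gcongr
    nlinarith
  linarith [add_one_le_exp X]

lemma kelvinKer_kelvin {l : ℝ} (hl : 0 < l) {x y : E3} (hx : x ≠ 0) (hy : y ≠ 0) :
    kelvinKer l x (kelvin l y) = -kelvinKer l x y := by
  have h1 : ‖kelvin l x - kelvin l y‖ = l ^ 2 / (‖x‖ * ‖y‖) * ‖x - y‖ := by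
    simpa [dist_eq_norm] using EuclideanGeometry.dist_inversion_inversion (c := (0 : E3)) hx hy l
  have h2 : ‖kelvin l x - y‖ * ‖x‖ = ‖x - kelvin l y‖ * ‖y‖ := by
    simpa [dist_eq_norm] using
      EuclideanGeometry.dist_inversion_mul_dist_center_eq (c := (0 : E3)) (R := l) hx hy
  have hx0 : 0 < ‖x‖ := norm_pos_iff.2 hx
  have hy0 : 0 < ‖y‖ := norm_pos_iff.2 hy
  rw [kelvinKer, kelvinKer, h1, h2, ← log_inv]
  congr 1
  rw [inv_div]
  field_simp

/-- A normalised solution of the conformal integral equation, up to a perturbation `p` which does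
not increase along rays. -/
structure LogRep (u p : E3 → ℝ) : Prop where
  cont : Continuous u
  int : Integrable fun y => exp (3 * u y)
  int_sq : Integrable fun y => ‖y‖ ^ 2 * exp (3 * u y)
  bdd : ∃ G, ∀ y, (1 + ‖y‖ ^ 2) * exp (3 * u y) ≤ G
  int_log : ∀ x, Integrable fun y => log ‖x - y‖ * exp (3 * u y)
  rep : ∀ x, u x = -(1 / π ^ 2) * (∫ y, log ‖x - y‖ * exp (3 * u y)) + p x
  ray : ∀ (x : E3) (t : ℝ), 0 < t → t ≤ 1 → p x ≤ p (t • x)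
  vol : 2 * π ^ 2 ≤ ∫ y, exp (3 * u y)

/-- The difference of `u` and its Kelvin transform. -/
noncomputable def kelvinDiff (u : E3 → ℝ) (l : ℝ) (x : E3) : ℝ :=
  u x - u (kelvin l x) + 2 * log (‖x‖ / l)

lemma measurable_kelvin (l : ℝ) : Measurable (kelvin l) := by
  have : kelvin l = fun x => (l / ‖x‖) ^ 2 • x := funext (kelvin_eq l)
  rw [this]
  fun_prop

lemma log_kelvinKer {l : ℝ} (hl : 0 < l) {x y : E3} (hx : x ≠ 0) (hxy : y ≠ x)
    (hy : y ≠ kelvin l x) :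
    kelvinKer l x y = log ‖kelvin l x - y‖ - log ‖x - y‖ + log (‖x‖ / l) := by
  have h0 : ‖x‖ ≠ 0 := norm_ne_zero_iff.2 hx
  have h1 : ‖x - y‖ ≠ 0 := norm_ne_zero_iff.2 (sub_ne_zero.2 hxy.symm)
  have h2 : ‖kelvin l x - y‖ ≠ 0 := norm_ne_zero_iff.2 (sub_ne_zero.2 hy.symm)
  rw [kelvinKer, log_div (by positivity) (by positivity), log_mul h2 h0, log_mul hl.ne' h1,
    log_div h0 hl.ne']
  ring

lemma ae_ne_point (a : E3) : ∀ᵐ y : E3, y ≠ a := by simp [ae_iff]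

lemma ae_norm_ne (l : ℝ) : ∀ᵐ y : E3, ‖y‖ ≠ l := by
  rw [ae_iff]
  simpa [Metric.sphere, dist_zero_right] using Measure.addHaar_sphere volume (0 : E3) l

lemma exp_kelvin (u : E3 → ℝ) {l : ℝ} (hl : 0 < l) {y : E3} (hy : y ≠ 0) :
    (l / ‖y‖) ^ 6 * exp (3 * u (kelvin l y)) = exp (3 * u y) * exp (-3 * kelvinDiff u l y) := by
  have h0 : 0 < ‖y‖ := norm_pos_iff.2 hy
  have h1 : (l / ‖y‖) ^ 6 = exp (-6 * log (‖y‖ / l)) := by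
    rw [← inv_div, ← exp_log (show 0 < (‖y‖ / l)⁻¹ by positivity), log_inv, ← exp_nat_mul]
    congr 1
    push_cast
    ring
  rw [h1, ← exp_add, ← exp_add, kelvinDiff]
  congr 1
  ring

namespace LogRep

variable {u p : E3 → ℝ}

lemma integrable_weight (h : LogRep u p) : Integrable fun y => (1 + ‖y‖ ^ 2) * exp (3 * u y) := by
  refine (h.int.add h.int_sq).congr (ae_of_all _ fun y => ?_)
  simp only [Pi.add_apply]
  ring

lemma continuous_weight (h : LogRep u p) : Continuous fun y => (1 + ‖y‖ ^ 2) * exp (3 * u y) := by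
  have := h.cont
  fun_prop

lemma integrable_kelvinKer (h : LogRep u p) {l : ℝ} (hl : 0 < l) {x : E3} (hx : x ≠ 0) :
    Integrable fun y => kelvinKer l x y * exp (3 * u y) := by
  have h1 := ((h.int_log (kelvin l x)).sub (h.int_log x)).add (h.int.const_mul (log (‖x‖ / l)))
  refine h1.congr ?_
  filter_upwards [ae_ne_point x, ae_ne_point (kelvin l x)] with y hy1 hy2
  simp only [Pi.add_apply, Pi.sub_apply]
  rw [log_kelvinKer hl hx hy1 hy2]
  ring

lemma kelvinDiff_eq (h : LogRep u p) {l : ℝ} (hl : 0 < l) {x : E3} (hx : x ≠ 0) :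
    kelvinDiff u l x = (1 / π ^ 2) * (∫ y, kelvinKer l x y * exp (3 * u y))
      - ((1 / π ^ 2) * (∫ y, exp (3 * u y)) - 2) * log (‖x‖ / l) + (p x - p (kelvin l x)) := by
  have h1 : ∫ y, kelvinKer l x y * exp (3 * u y)
      = (∫ y, log ‖kelvin l x - y‖ * exp (3 * u y)) - (∫ y, log ‖x - y‖ * exp (3 * u y))
        + log (‖x‖ / l) * ∫ y, exp (3 * u y) := by
    rw [← integral_const_mul, ← integral_sub (h.int_log _) (h.int_log _),
      ← integral_add (by exact (h.int_log _).sub (h.int_log _)) (h.int.const_mul _)]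
    refine integral_congr_ae ?_
    filter_upwards [ae_ne_point x, ae_ne_point (kelvin l x)] with y hy1 hy2
    rw [log_kelvinKer hl hx hy1 hy2]
    ring
  rw [kelvinDiff, h.rep x, h.rep (kelvin l x), h1]
  ring

lemma integrableOn_reflected (h : LogRep u p) {l : ℝ} (hl : 0 < l) {x : E3} (hx : x ≠ 0) :
    IntegrableOn (fun y => kelvinKer l x y * (exp (3 * u y) * exp (-3 * kelvinDiff u l y)))
      {y | l < ‖y‖} := by
  have h1 := (integrableOn_ball_iff_exterior hl _).1
    (h.integrable_kelvinKer hl hx).neg.integrableOn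
  refine h1.congr_fun (fun y hy => ?_) (measurableSet_exterior l)
  have hy0 : y ≠ 0 := norm_pos_iff.1 (hl.trans hy)
  simp only [Pi.neg_apply]
  rw [← exp_kelvin u hl hy0, kelvinKer_kelvin hl hx hy0]
  ring

lemma integral_kelvinKer (h : LogRep u p) {l : ℝ} (hl : 0 < l) {x : E3} (hx : x ≠ 0) :
    ∫ y, kelvinKer l x y * exp (3 * u y) =
      ∫ y in {y | l < ‖y‖},
        kelvinKer l x y * (exp (3 * u y) * (1 - exp (-3 * kelvinDiff u l y))) := by
  have hi := h.integrable_kelvinKer hl hx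
  rw [← integral_add_compl (measurableSet_exterior l) hi]
  have h1 : ∫ y in {y : E3 | l < ‖y‖}ᶜ, kelvinKer l x y * exp (3 * u y)
      = ∫ y in {y : E3 | ‖y‖ < l}, kelvinKer l x y * exp (3 * u y) := by
    refine setIntegral_congr_set ?_
    filter_upwards [ae_norm_ne l] with y hy
    apply propext
    change ¬ (l < ‖y‖) ↔ ‖y‖ < l
    rw [not_lt]
    exact ⟨fun h => lt_of_le_of_ne h hy, le_of_lt⟩
  rw [h1, setIntegral_ball_eq_exterior hl,
    ← integral_add hi.integrableOn]
  · refine setIntegral_congr_fun (measurableSet_exterior l) fun y hy => ?_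
    have hy0 : y ≠ 0 := norm_pos_iff.1 (hl.trans hy)
    have := exp_kelvin u hl hy0
    rw [kelvinKer_kelvin hl hx hy0]
    linear_combination (-kelvinKer l x y) * this
  · exact (integrableOn_ball_iff_exterior hl _).1 hi.integrableOn

lemma excess_nonneg (h : LogRep u p) {l : ℝ} (hl : 0 < l) {x : E3} (hx : l < ‖x‖) :
    0 ≤ ((1 / π ^ 2) * (∫ y, exp (3 * u y)) - 2) * log (‖x‖ / l) ∧ p x - p (kelvin l x) ≤ 0 := by
  have hx0 : 0 < ‖x‖ := hl.trans hx
  constructor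
  · have h1 := h.vol
    have h2 : 0 < π ^ 2 := by positivity
    have h3 : 2 ≤ (1 / π ^ 2) * (∫ y, exp (3 * u y)) := by
      rw [one_div_mul_eq_div, le_div_iff₀ h2]
      exact h1
    exact mul_nonneg (by linarith) (log_nonneg (by rw [le_div_iff₀ hl]; linarith))
  · have := h.ray x ((l / ‖x‖) ^ 2) (by positivity)
      (pow_le_one₀ (by positivity) (by rw [div_le_one hx0]; exact hx.le))
    rw [kelvin_eq]
    linarith

lemma kelvinDiff_le (h : LogRep u p) {l : ℝ} (hl : 0 < l) {x : E3} (hx : l < ‖x‖) :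
    kelvinDiff u l x ≤ (1 / π ^ 2) * ∫ y in {y | l < ‖y‖},
        kelvinKer l x y * (exp (3 * u y) * (1 - exp (-3 * kelvinDiff u l y))) := by
  have hx0 : x ≠ 0 := norm_pos_iff.1 (hl.trans hx)
  have := h.excess_nonneg hl hx
  rw [h.kelvinDiff_eq hl hx0, ← h.integral_kelvinKer hl hx0]
  linarith

lemma integrableOn_diff (h : LogRep u p) {l : ℝ} (hl : 0 < l) {x : E3} (hx : x ≠ 0) :
    IntegrableOn (fun y => kelvinKer l x y * (exp (3 * u y) * (1 - exp (-3 * kelvinDiff u l y))))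
      {y | l < ‖y‖} := by
  refine ((h.integrable_kelvinKer hl hx).integrableOn.sub
    (h.integrableOn_reflected hl hx)).congr_fun (fun y _ => ?_) (measurableSet_exterior l)
  simp only [Pi.sub_apply]
  ring

lemma measurable_kelvinDiff (h : LogRep u p) (l : ℝ) : Measurable (kelvinDiff u l) := by
  have := h.cont.measurable
  have h2 := measurable_kelvin l
  unfold kelvinDiff
  fun_prop

/-- The set where moving spheres fails. -/
def bad (u : E3 → ℝ) (l : ℝ) : Set E3 := {y | l < ‖y‖ ∧ 0 < kelvinDiff u l y}

lemma measurableSet_bad (h : LogRep u p) (l : ℝ) : MeasurableSet (bad u l) :=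
  (measurableSet_exterior l).inter (measurableSet_lt measurable_const (h.measurable_kelvinDiff l))

lemma kelvinKer_bound (h : LogRep u p) : ∃ C, 0 ≤ C ∧ ∀ r, 0 < r → r ≤ 1 → ∀ l, 0 < l →
    ∀ x, l < ‖x‖ → ∀ S, MeasurableSet S → S ⊆ {y | l < ‖y‖} →
      ∫ y in S, kelvinKer l x y * exp (3 * u y)
        ≤ 1 / l * ((1 + r⁻¹) * (∫ y in S, (1 + ‖y‖ ^ 2) * exp (3 * u y)) + r * C) := by
  obtain ⟨G, hG⟩ := h.bdd
  have hG0 : 0 ≤ G := le_trans (by positivity) (hG 0)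
  refine ⟨G * ∫ z, ballKer z, mul_nonneg hG0 integral_ballKer_nonneg,
    fun r hr hr1 l hl x hx S hS hSl => ?_⟩
  have hk : ∀ z : E3, |1 + ‖z‖⁻¹| ≤ (1 + r⁻¹) + r * ballKer z := fun z => by
    rw [abs_of_nonneg (by positivity)]
    linarith [inv_norm_le_ballKer hr hr1 z]
  have hkm : Measurable fun z : E3 => 1 + ‖z‖⁻¹ := by fun_prop
  have h1 := setIntegral_kernel_mul_le h.continuous_weight h.integrable_weight
    (fun y => by positivity) hG hkm hr.le hk x S
  have h2 := integrable_kernel_mul h.continuous_weight h.integrable_weight hkm hk x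
  refine le_trans ?_ (show (∫ y in S, (1 + ‖x - y‖⁻¹) * ((1 + ‖y‖ ^ 2) * exp (3 * u y))) / l ≤ _ from ?_)
  · rw [← integral_div]
    refine setIntegral_mono_on
      (h.integrable_kelvinKer hl (norm_pos_iff.1 (hl.trans hx))).integrableOn
      (h2.div_const l).integrableOn hS fun y hy => ?_
    have h3 := kelvinKer_le hl hx (hSl hy)
    have h4 : ‖y‖ + ‖y‖ ^ 2 / ‖x - y‖ ≤ (1 + ‖x - y‖⁻¹) * (1 + ‖y‖ ^ 2) := by
      rw [div_eq_mul_inv]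
      have : 0 ≤ ‖x - y‖⁻¹ := by positivity
      nlinarith [sq_nonneg (‖y‖ - 1)]
    calc kelvinKer l x y * exp (3 * u y)
        ≤ (1 / l * ((1 + ‖x - y‖⁻¹) * (1 + ‖y‖ ^ 2))) * exp (3 * u y) := by
          gcongr
          exact h3.trans (by gcongr)
      _ = _ := by ring
  · rw [div_eq_mul_one_div, mul_comm]
    gcongr
    linarith

end LogRep

namespace LogRep

variable {u p : E3 → ℝ}

lemma bad_subset (u : E3 → ℝ) (l : ℝ) : bad u l ⊆ {y | l < ‖y‖} := fun _ hy => hy.1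

lemma kelvinDiff_le_bad (h : LogRep u p) {l M : ℝ} (hl : 0 < l)
    (hM : ∀ y, l < ‖y‖ → min 1 (3 * kelvinDiff u l y) ≤ M) {x : E3} (hx : l < ‖x‖) :
    kelvinDiff u l x ≤ (1 / π ^ 2) * (M * ∫ y in bad u l, kelvinKer l x y * exp (3 * u y)) := by
  have hx0 : x ≠ 0 := norm_pos_iff.1 (hl.trans hx)
  refine (h.kelvinDiff_le hl hx).trans ?_
  gcongr
  rw [← integral_const_mul]
  have hi := h.integrableOn_diff hl hx0
  have hk := (h.integrable_kelvinKer hl hx0).const_mul M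
  have hb := h.measurableSet_bad l
  rw [← integral_indicator (measurableSet_exterior l), ← integral_indicator hb]
  refine integral_mono ((integrable_indicator_iff (measurableSet_exterior l)).2 hi)
    ((integrable_indicator_iff hb).2 hk.integrableOn) fun y => ?_
  by_cases hy : l < ‖y‖
  · rw [Set.indicator_of_mem (show y ∈ {y | l < ‖y‖} from hy)]
    have hK : 0 ≤ kelvinKer l x y * exp (3 * u y) :=
      mul_nonneg (kelvinKer_nonneg hl hx hy) (exp_pos _).le
    by_cases hD : 0 < kelvinDiff u l y
    · rw [Set.indicator_of_mem (show y ∈ bad u l from ⟨hy, hD⟩)]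
      have h1 : 1 - exp (-3 * kelvinDiff u l y) ≤ M := by
        refine le_trans (le_min ?_ ?_) (hM y hy)
        · linarith [exp_pos (-3 * kelvinDiff u l y)]
        · linarith [add_one_le_exp (-3 * kelvinDiff u l y)]
      nlinarith
    · rw [Set.indicator_of_notMem (show y ∉ bad u l from fun h => hD h.2)]
      have h1 : 1 - exp (-3 * kelvinDiff u l y) ≤ 0 := by
        have : 1 ≤ exp (-3 * kelvinDiff u l y) := one_le_exp (by linarith)
        linarith
      nlinarith
  · rw [Set.indicator_of_notMem (show y ∉ {y | l < ‖y‖} from hy),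
      Set.indicator_of_notMem (show y ∉ bad u l from fun h => hy h.1)]

lemma kelvinDiff_nonpos_of_small (h : LogRep u p) {l : ℝ} (hl : 0 < l)
    (hs : ∀ x, l < ‖x‖ →
      (1 / π ^ 2) * (∫ y in bad u l, kelvinKer l x y * exp (3 * u y)) ≤ 1 / 6)
    {x : E3} (hx : l < ‖x‖) : kelvinDiff u l x ≤ 0 := by
  have hpos : ∀ x, l < ‖x‖ →
      0 ≤ (1 / π ^ 2) * (∫ y in bad u l, kelvinKer l x y * exp (3 * u y)) := fun x hx =>
    mul_nonneg (by positivity) (setIntegral_nonneg (h.measurableSet_bad l) fun y hy =>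
      mul_nonneg (kelvinKer_nonneg hl hx hy.1) (exp_pos _).le)
  have key : ∀ n : ℕ, ∀ x, l < ‖x‖ → kelvinDiff u l x ≤ 1 / 6 * (1 / 2) ^ n := by
    intro n
    induction n with
    | zero =>
      intro x hx
      have := h.kelvinDiff_le_bad hl (M := 1) (fun y _ => min_le_left _ _) hx
      linarith [hs x hx]
    | succ n ih =>
      intro x hx
      have := h.kelvinDiff_le_bad hl (M := 3 * (1 / 6 * (1 / 2) ^ n))
        (fun y hy => (min_le_right _ _).trans (by linarith [ih y hy])) hx
      have h2 := hs x hx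
      have h3 := hpos x hx
      have h4 : (0 : ℝ) < (1 / 2) ^ n := by positivity
      rw [pow_succ]
      nlinarith
  have ht : Tendsto (fun n : ℕ => (1 / 6 : ℝ) * (1 / 2) ^ n) atTop (nhds (1 / 6 * 0)) :=
    (tendsto_pow_atTop_nhds_zero_of_lt_one (by norm_num) (by norm_num)).const_mul _
  rw [mul_zero] at ht
  exact ge_of_tendsto' ht fun n => key n x hx

lemma eventually_nonpos_of_tendsto (h : LogRep u p) {ι : Type*} {F : Filter ι} {l : ι → ℝ} {l0 : ℝ}
    (hl0 : 0 < l0) (hl : ∀ᶠ i in F, l0 ≤ l i)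
    (hS : Tendsto (fun i => ∫ y in bad u (l i), (1 + ‖y‖ ^ 2) * exp (3 * u y)) F (nhds 0)) :
    ∀ᶠ i in F, ∀ x, l i < ‖x‖ → kelvinDiff u (l i) x ≤ 0 := by
  obtain ⟨C, hC0, hC⟩ := h.kelvinKer_bound
  obtain ⟨r, hr, hr1, hrC⟩ : ∃ r : ℝ, 0 < r ∧ r ≤ 1 ∧ r * C ≤ l0 / 2 := by
    refine ⟨min 1 (l0 / 2 / (C + 1)), by positivity, min_le_left _ _, ?_⟩
    calc min 1 (l0 / 2 / (C + 1)) * C ≤ l0 / 2 / (C + 1) * (C + 1) := by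
          gcongr
          · exact min_le_right _ _
          · linarith
      _ = l0 / 2 := by field_simp
  have h1 : Tendsto (fun i => (1 + r⁻¹) *
      ∫ y in bad u (l i), (1 + ‖y‖ ^ 2) * exp (3 * u y)) F (nhds ((1 + r⁻¹) * 0)) :=
    hS.const_mul _
  rw [mul_zero] at h1
  filter_upwards [hl, h1.eventually_lt_const (half_pos hl0)] with i hi hsmall x hx
  have hli := hl0.trans_le hi
  refine h.kelvinDiff_nonpos_of_small hli (fun x hx => ?_) hx
  have h2 := hC r hr hr1 (l i) hli x hx _ (h.measurableSet_bad _) (bad_subset u _)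
  have h3 : ∫ y in bad u (l i), kelvinKer (l i) x y * exp (3 * u y) ≤ 1 := by
    refine h2.trans ?_
    rw [one_div, inv_mul_le_one₀ hli]
    linarith
  have h4 : 9 ≤ π ^ 2 := by nlinarith [pi_gt_three]
  have h5 : 1 / π ^ 2 ≤ 1 / 9 := by gcongr
  have h6 : 0 < 1 / π ^ 2 := by positivity
  nlinarith

/-- The bound in `kelvinDiff_nonpos_of_small` holds for all large spheres. -/
lemma eventually_nonpos_atTop (h : LogRep u p) :
    ∀ᶠ l in atTop, ∀ x, l < ‖x‖ → kelvinDiff u l x ≤ 0 := by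
  refine h.eventually_nonpos_of_tendsto one_pos (eventually_ge_atTop 1) ?_
  have hw := h.integrable_weight
  have h1 : Tendsto (fun l : ℝ => ∫ y, (bad u l).indicator
      (fun y => (1 + ‖y‖ ^ 2) * exp (3 * u y)) y) atTop (nhds (∫ _ : E3, 0)) := by
    refine tendsto_integral_filter_of_dominated_convergence
      (fun y => (1 + ‖y‖ ^ 2) * exp (3 * u y)) ?_ ?_ hw ?_
    · exact Eventually.of_forall fun l =>
        (h.continuous_weight.measurable.indicator (h.measurableSet_bad l)).aestronglyMeasurable
    · refine Eventually.of_forall fun l => ae_of_all _ fun y => ?_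
      refine (norm_indicator_le_norm_self _ _).trans_eq ?_
      rw [norm_eq_abs, abs_of_nonneg (by positivity)]
    · refine ae_of_all _ fun y => ?_
      refine tendsto_const_nhds.congr' ?_
      filter_upwards [eventually_ge_atTop ‖y‖] with l hl
      rw [Set.indicator_of_notMem fun hy => absurd hy.1 (not_lt.2 hl)]
  rw [integral_zero] at h1
  exact h1.congr fun l => integral_indicator (h.measurableSet_bad l)

lemma continuousAt_kelvinDiff (h : LogRep u p) {l : ℝ} (hl : 0 < l) {x : E3} (hx : x ≠ 0) :
    ContinuousAt (fun q : ℝ × E3 => kelvinDiff u q.1 q.2) (l, x) := by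
  have hx0 : ‖x‖ ≠ 0 := norm_ne_zero_iff.2 hx
  unfold kelvinDiff
  have hu := h.cont
  simp only [kelvin_eq]
  have h1 : ContinuousAt (fun q : ℝ × E3 => (q.1 / ‖q.2‖) ^ 2 • q.2) (l, x) := by
    fun_prop (disch := simpa using hx0)
  have h2 : ContinuousAt (fun q : ℝ × E3 => log (‖q.2‖ / q.1)) (l, x) := by
    refine ContinuousAt.log ?_ ?_
    · fun_prop (disch := simpa using hl.ne')
    · simp [hx0, hl.ne']
  have h3 : ContinuousAt (fun q : ℝ × E3 => u ((q.1 / ‖q.2‖) ^ 2 • q.2)) (l, x) :=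
    ContinuousAt.comp (g := u) hu.continuousAt h1
  have h4 : ContinuousAt (fun q : ℝ × E3 => u q.2) (l, x) :=
    ContinuousAt.comp (g := u) hu.continuousAt continuousAt_snd
  exact (h4.sub h3).add (h2.const_mul 2)

lemma kelvinDiff_neg_or_eq_zero (h : LogRep u p) {l : ℝ} (hl : 0 < l)
    (hle : ∀ x, l < ‖x‖ → kelvinDiff u l x ≤ 0) :
    (∀ x, l < ‖x‖ → kelvinDiff u l x < 0) ∨ ∀ x, l < ‖x‖ → kelvinDiff u l x = 0 := by
  by_contra hcon
  push Not at hcon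
  obtain ⟨⟨x, hx, hx0⟩, z, hz, hz0⟩ := hcon
  have hxz : x ≠ 0 := norm_pos_iff.1 (hl.trans hx)
  have h1 := hx0.trans (h.kelvinDiff_le hl hx)
  set g := fun y => kelvinKer l x y * (exp (3 * u y) * (1 - exp (-3 * kelvinDiff u l y))) with hg
  have hg0 : ∀ y, l < ‖y‖ → g y ≤ 0 := fun y hy => by
    have : 1 ≤ exp (-3 * kelvinDiff u l y) := one_le_exp (by linarith [hle y hy])
    exact mul_nonpos_of_nonneg_of_nonpos (kelvinKer_nonneg hl hx hy)
      (mul_nonpos_of_nonneg_of_nonpos (exp_pos _).le (by linarith))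
  have h2 : 0 ≤ ∫ y in {y | l < ‖y‖}, g y := by
    have : 0 < 1 / π ^ 2 := by positivity
    exact nonneg_of_mul_nonneg_right h1 this
  have h3 : ∫ y in {y | l < ‖y‖}, -g y = 0 := by
    refine le_antisymm ?_ (setIntegral_nonneg (measurableSet_exterior l) fun y hy => ?_)
    · rw [integral_neg]; linarith
    · linarith [hg0 y hy]
  have h4 : ∀ᵐ y : E3, l < ‖y‖ → -g y = 0 := by
    refine (ae_restrict_iff' (measurableSet_exterior l)).1 ?_
    refine (setIntegral_eq_zero_iff_of_nonneg_ae ?_ (h.integrableOn_diff hl hxz).neg).1 h3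
    filter_upwards [ae_restrict_mem (measurableSet_exterior l)] with y hy
    exact neg_nonneg.2 (hg0 y hy)
  have hopen : ∀ᶠ y in nhds z, l < ‖y‖ ∧ kelvinDiff u l y < 0 := by
    have hc : ContinuousAt (kelvinDiff u l) z :=
      ContinuousAt.comp (f := fun y => (l, y)) (g := fun q : ℝ × E3 => kelvinDiff u q.1 q.2)
        (h.continuousAt_kelvinDiff hl (norm_pos_iff.1 (hl.trans hz))) (by fun_prop)
    exact (continuous_norm.continuousAt.eventually_const_lt hz).and
      (hc.eventually_lt_const (lt_of_le_of_ne (hle z hz) hz0))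
  obtain ⟨V, hV, hVo, hzV⟩ := eventually_nhds_iff.1 hopen
  have h5 : ∀ᵐ y : E3, y ∉ V := by
    filter_upwards [h4, ae_ne_point x] with y hy hyx hyV
    obtain ⟨hy1, hy2⟩ := hV y hyV
    have h6 := hy hy1
    have h7 : 1 < exp (-3 * kelvinDiff u l y) := one_lt_exp_iff.2 (by linarith)
    have h8 := kelvinKer_pos hl hx hy1 hyx.symm
    have h9 : g y < 0 := mul_neg_of_pos_of_neg h8 (mul_neg_of_pos_of_neg (exp_pos _) (by linarith))
    linarith
  have h6 : volume V = 0 := by simpa [ae_iff] using h5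
  exact (hVo.measure_pos volume ⟨z, hzV⟩).ne' h6

lemma eventually_nonpos_left (h : LogRep u p) {l : ℝ} (hl : 0 < l)
    (hneg : ∀ x, l < ‖x‖ → kelvinDiff u l x < 0) :
    ∀ᶠ t in nhds l, ∀ x, t < ‖x‖ → kelvinDiff u t x ≤ 0 := by
  refine h.eventually_nonpos_of_tendsto (l := id) (half_pos hl)
    (eventually_ge_nhds (half_lt_self hl)) ?_
  have h1 : Tendsto (fun t : ℝ => ∫ y, (bad u t).indicator
      (fun y => (1 + ‖y‖ ^ 2) * exp (3 * u y)) y) (nhds l) (nhds (∫ _ : E3, 0)) := by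
    refine tendsto_integral_filter_of_dominated_convergence
      (fun y => (1 + ‖y‖ ^ 2) * exp (3 * u y)) ?_ ?_ h.integrable_weight ?_
    · exact Eventually.of_forall fun l =>
        (h.continuous_weight.measurable.indicator (h.measurableSet_bad l)).aestronglyMeasurable
    · refine Eventually.of_forall fun l => ae_of_all _ fun y => ?_
      refine (norm_indicator_le_norm_self _ _).trans_eq ?_
      rw [norm_eq_abs, abs_of_nonneg (by positivity)]
    · filter_upwards [ae_norm_ne l] with y hy
      refine tendsto_const_nhds.congr' ?_
      rcases lt_or_gt_of_ne hy with hy | hy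
      · filter_upwards [eventually_gt_nhds hy] with t ht
        rw [Set.indicator_of_notMem fun hy => absurd hy.1 (not_lt.2 ht.le)]
      · have hc : ContinuousAt (fun t => kelvinDiff u t y) l :=
          ContinuousAt.comp (f := fun t => (t, y)) (g := fun q : ℝ × E3 => kelvinDiff u q.1 q.2)
            (h.continuousAt_kelvinDiff hl (norm_pos_iff.1 (hl.trans hy))) (by fun_prop)
        filter_upwards [hc.eventually_lt_const (hneg y hy)] with t ht
        rw [Set.indicator_of_notMem fun hy => absurd hy.2 (not_lt.2 ht.le)]
  rw [integral_zero] at h1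
  exact h1.congr fun l => integral_indicator (h.measurableSet_bad l)

lemma exists_kelvinDiff_eq_zero (h : LogRep u p) :
    ∃ l, 0 < l ∧ ∀ x, l < ‖x‖ → kelvinDiff u l x = 0 := by
  by_contra! hne
  have hstrict : ∀ l, 0 < l → (∀ x, l < ‖x‖ → kelvinDiff u l x ≤ 0) →
      ∀ x, l < ‖x‖ → kelvinDiff u l x < 0 := fun l hl hle => by
    refine (h.kelvinDiff_neg_or_eq_zero hl hle).resolve_right fun h0 => ?_
    obtain ⟨x, hx, hx0⟩ := hne l hl
    exact hx0 (h0 x hx)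
  set A : Set ℝ := {t | 0 < t ∧ ∀ l, t ≤ l → ∀ x, l < ‖x‖ → kelvinDiff u l x ≤ 0} with hA
  have hAne : A.Nonempty := by
    obtain ⟨t, ht⟩ := eventually_atTop.1 h.eventually_nonpos_atTop
    exact ⟨max t 1, by positivity, fun l hl => ht l ((le_max_left _ _).trans hl)⟩
  have hAbdd : BddBelow A := ⟨0, fun t ht => ht.1.le⟩
  have hgt : ∀ l, sInf A < l → ∀ x, l < ‖x‖ → kelvinDiff u l x ≤ 0 := fun l hl => by
    obtain ⟨t, ht, htl⟩ := exists_lt_of_csInf_lt hAne hl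
    exact ht.2 l htl.le
  have h0 : 0 ≤ sInf A := le_csInf hAne fun t ht => ht.1.le
  rcases h0.eq_or_lt with h0 | h0
  · rw [← h0] at hgt
    obtain ⟨x, hx⟩ : ∃ x : E3, ‖x‖ = 1 := exists_norm_eq E3 zero_le_one
    have hx0 : x ≠ 0 := norm_ne_zero_iff.1 (by rw [hx]; norm_num)
    have ht : Tendsto (fun l : ℝ => u x - u (kelvin l x)) (nhdsWithin 0 (Set.Ioi 0))
        (nhds (u x - u 0)) := by
      have : Continuous fun l : ℝ => u x - u (kelvin l x) := by
        have := h.cont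
        simp only [kelvin_eq, hx]
        fun_prop
      have h2 := this.tendsto 0
      simp only [kelvin_eq, hx, div_one, ne_eq, OfNat.ofNat_ne_zero, not_false_eq_true, zero_pow,
        zero_smul] at h2
      simp only [kelvin_eq, hx, div_one]
      exact h2.mono_left nhdsWithin_le_nhds
    have ht2 : Tendsto (fun l : ℝ => 2 * log (‖x‖ / l)) (nhdsWithin 0 (Set.Ioi 0)) atTop := by
      simp only [hx, one_div, log_inv]
      exact (tendsto_neg_atBot_atTop.comp tendsto_log_nhdsGT_zero).const_mul_atTop two_pos
    have ht3 := ht.add_atTop ht2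
    obtain ⟨l, hl1, hl2, hl3⟩ := ((ht3.eventually_gt_atTop 0).and
      ((eventually_mem_nhdsWithin).and
        (nhdsWithin_le_nhds (eventually_lt_nhds one_pos)))).exists
    exact absurd (hgt l hl2 x (by rw [hx]; exact hl3)) (not_le.2 hl1)
  · have hle : ∀ x, sInf A < ‖x‖ → kelvinDiff u (sInf A) x ≤ 0 := fun x hx => by
      have hc : ContinuousAt (fun t => kelvinDiff u t x) (sInf A) :=
        ContinuousAt.comp (f := fun t => (t, x)) (g := fun q : ℝ × E3 => kelvinDiff u q.1 q.2)
          (h.continuousAt_kelvinDiff h0 (norm_pos_iff.1 (h0.trans hx))) (by fun_prop)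
      refine le_of_tendsto (hc.tendsto.mono_left (nhdsWithin_le_nhds (s := Set.Ioi (sInf A)))) ?_
      filter_upwards [eventually_mem_nhdsWithin,
        nhdsWithin_le_nhds (eventually_lt_nhds hx)] with t ht1 ht2
      exact hgt t ht1 x ht2
    have hev := h.eventually_nonpos_left h0 (hstrict _ h0 hle)
    obtain ⟨e, he, hball⟩ := Metric.eventually_nhds_iff.1 hev
    set t := max (sInf A / 2) (sInf A - e / 2) with ht
    have htlt : t < sInf A := max_lt (by linarith) (by linarith)
    have htA : t ∈ A := by
      refine ⟨lt_max_of_lt_left (by linarith), fun l hl => ?_⟩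
      rcases lt_or_ge (sInf A) l with h1 | h1
      · exact hgt l h1
      · refine hball ?_
        rw [Real.dist_eq, abs_sub_lt_iff]
        have := (le_max_right (sInf A / 2) (sInf A - e / 2)).trans hl
        constructor <;> linarith
    exact absurd (csInf_le hAbdd htA) (not_le.2 htlt)

/-- The moving spheres theorem. -/
theorem exists_kelvin_invariant (h : LogRep u p) :
    ∃ l, 0 < l ∧ (∀ x, x ≠ 0 → u x = u (kelvin l x) - 2 * log (‖x‖ / l)) ∧
      (∀ x, l < ‖x‖ → p x = p (kelvin l x)) ∧ ∫ y, exp (3 * u y) = 2 * π ^ 2 := by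
  obtain ⟨l, hl, h0⟩ := h.exists_kelvinDiff_eq_zero
  have hext : ∀ x, l < ‖x‖ → p x = p (kelvin l x) ∧
      ((1 / π ^ 2) * (∫ y, exp (3 * u y)) - 2) * log (‖x‖ / l) = 0 := fun x hx => by
    have hx0 : x ≠ 0 := norm_pos_iff.1 (hl.trans hx)
    have h1 := h.kelvinDiff_eq hl hx0
    have h2 := h.excess_nonneg hl hx
    have h3 : ∫ y, kelvinKer l x y * exp (3 * u y) = 0 := by
      rw [h.integral_kelvinKer hl hx0]
      refine setIntegral_eq_zero_of_forall_eq_zero fun y hy => ?_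
      rw [h0 y hy]
      simp
    rw [h0 x hx, h3] at h1
    constructor <;> linarith
  refine ⟨l, hl, fun x hx => ?_, fun x hx => (hext x hx).1, ?_⟩
  · have hx0 : 0 < ‖x‖ := norm_pos_iff.2 hx
    rcases lt_trichotomy l ‖x‖ with h1 | h1 | h1
    · have := h0 x h1
      rw [kelvinDiff] at this
      linarith
    · have : kelvin l x = x := by rw [kelvin_eq, h1, div_self hx0.ne']; simp
      rw [this, h1, div_self hx0.ne']
      simp
    · have h2 : l < ‖kelvin l x‖ := by
        rw [norm_kelvin, lt_div_iff₀ hx0]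
        nlinarith
      have := h0 _ h2
      rw [kelvinDiff, kelvin_kelvin hl.ne', norm_kelvin] at this
      have h3 : log (l ^ 2 / ‖x‖ / l) = - log (‖x‖ / l) := by
        rw [← log_inv]
        congr 1
        field_simp
      rw [h3] at this
      linarith
  · obtain ⟨x, hx⟩ : ∃ x : E3, ‖x‖ = 2 * l := exists_norm_eq E3 (by positivity)
    have h1 := (hext x (by linarith)).2
    have h2 : log (‖x‖ / l) ≠ 0 := by
      rw [hx, mul_div_cancel_right₀ _ hl.ne']
      exact (log_pos one_lt_two).ne'
    have h3 := (mul_eq_zero.1 h1).resolve_right h2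
    have : π ^ 2 ≠ 0 := by positivity
    field_simp at h3
    linarith

end LogRep

lemma kelvin_translate_identity {F : E3 → ℝ} {z : E3} {l : ℝ}
    (hinv : ∀ x, x ≠ 0 → F (z + x) = (‖x‖ / l) ^ 2 * F (z + kelvin l x))
    {e : E3} (he : ‖e‖ = 1) {s : ℝ} (hs : 0 < s) :
    s ^ 2 * F (z + s⁻¹ • e) = (1 / l ^ 2) * F (z + (l ^ 2 * s) • e) := by
  have he0 : e ≠ 0 := norm_ne_zero_iff.1 (by rw [he]; exact one_ne_zero)
  rw [hinv _ (smul_ne_zero (inv_ne_zero hs.ne') he0), kelvin_eq, norm_smul, he, smul_smul,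
    norm_eq_abs, abs_of_pos (inv_pos.2 hs)]
  have h1 : (l / (s⁻¹ * 1)) ^ 2 * s⁻¹ = l ^ 2 * s := by field_simp
  rw [h1]
  field_simp

lemma kelvin_origin_identity {F : E3 → ℝ} {l : ℝ}
    (hinv : ∀ x, x ≠ 0 → F x = (‖x‖ / l) ^ 2 * F (kelvin l x))
    {z e : E3} {s : ℝ} (hs : 0 < s) (hne : s • z + e ≠ 0) :
    s ^ 2 * F (z + s⁻¹ • e) = (‖s • z + e‖ ^ 2 / l ^ 2) *
      F ((l ^ 2 * s / ‖s • z + e‖ ^ 2) • (s • z + e)) := by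
  have h1 : z + s⁻¹ • e = s⁻¹ • (s • z + e) := by
    rw [smul_add, smul_smul, inv_mul_cancel₀ hs.ne', one_smul]
  have h0 : ‖s • z + e‖ ≠ 0 := norm_ne_zero_iff.2 hne
  rw [h1, hinv _ (smul_ne_zero (inv_ne_zero hs.ne') hne), kelvin_eq, norm_smul, smul_smul,
    norm_eq_abs, abs_of_pos (inv_pos.2 hs)]
  have h2 : (l / (s⁻¹ * ‖s • z + e‖)) ^ 2 * s⁻¹ = l ^ 2 * s / ‖s • z + e‖ ^ 2 := by field_simp
  rw [h2]
  field_simp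

/-- Comparing two families of conformal invariances at infinity. -/
lemma value_and_deriv_of_kelvin {F : E3 → ℝ} (hF : Differentiable ℝ F) {z : E3} {l l0 : ℝ}
    (hl : l ≠ 0) (hl0 : l0 ≠ 0)
    (hinv : ∀ x, x ≠ 0 → F (z + x) = (‖x‖ / l) ^ 2 * F (z + kelvin l x))
    (hinv0 : ∀ x, x ≠ 0 → F x = (‖x‖ / l0) ^ 2 * F (kelvin l0 x)) {e : E3} (he : ‖e‖ = 1) :
    fderiv ℝ F z e = fderiv ℝ F 0 e + 2 * (F 0 / l0 ^ 2) * inner ℝ z e := by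
  set A : ℝ → ℝ := fun s => (1 / l ^ 2) * F (z + (l ^ 2 * s) • e) with hA
  set N : ℝ → ℝ := fun s => ‖s • z + e‖ ^ 2 with hN
  set B : ℝ → ℝ := fun s => (N s / l0 ^ 2) * F ((l0 ^ 2 * s / N s) • (s • z + e)) with hB
  have hcurve : HasDerivAt (fun s : ℝ => s • z + e) z 0 := by
    simpa using ((hasDerivAt_id (0 : ℝ)).smul_const z).add_const e
  have hN0 : N 0 = 1 := by simp [hN, he]
  have hNd : HasDerivAt N (2 * inner ℝ z e) 0 := by
    have := hcurve.norm_sq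
    simpa [real_inner_comm] using this
  have hAd : HasDerivAt A (fderiv ℝ F z e) 0 := by
    have h1 : HasDerivAt (fun s : ℝ => z + (l ^ 2 * s) • e) (l ^ 2 • e) 0 := by
      simpa using (((hasDerivAt_id (0 : ℝ)).const_mul (l ^ 2)).smul_const e).const_add z
    have h2 : HasFDerivAt F (fderiv ℝ F z) (z + (l ^ 2 * 0) • e) := by
      simpa using (hF z).hasFDerivAt
    have h3 := (h2.comp_hasDerivAt (0 : ℝ) h1).const_mul (1 / l ^ 2)
    refine h3.congr_deriv ?_
    rw [map_smul, smul_eq_mul]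
    field_simp
  have hBd : HasDerivAt B (fderiv ℝ F 0 e + 2 * (F 0 / l0 ^ 2) * inner ℝ z e) 0 := by
    have h1 : HasDerivAt (fun s : ℝ => l0 ^ 2 * s / N s) (l0 ^ 2) 0 := by
      refine (((hasDerivAt_id (0 : ℝ)).const_mul (l0 ^ 2)).div hNd
        (by rw [hN0]; exact one_ne_zero)).congr_deriv ?_
      simp [hN0]
    have h2 : HasDerivAt (fun s : ℝ => (l0 ^ 2 * s / N s) • (s • z + e)) (l0 ^ 2 • e) 0 := by
      refine (h1.smul hcurve).congr_deriv ?_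
      simp
    have h3 : HasFDerivAt F (fderiv ℝ F 0) ((l0 ^ 2 * 0 / N 0) • ((0 : ℝ) • z + e)) := by
      simpa using (hF 0).hasFDerivAt
    have h4 := (hNd.div_const (l0 ^ 2)).mul (h3.comp_hasDerivAt (0 : ℝ) h2)
    refine h4.congr_deriv ?_
    simp only [Function.comp_apply, hN0, mul_zero, zero_div, zero_smul, map_smul, smul_eq_mul]
    field_simp
    ring
  have hNpos : ∀ᶠ s in nhdsWithin (0 : ℝ) (Set.Ioi 0), 0 < N s :=
    nhdsWithin_le_nhds (hNd.continuousAt.eventually_const_lt (by rw [hN0]; exact one_pos))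
  have hAB : A =ᶠ[nhdsWithin (0 : ℝ) (Set.Ioi 0)] B := by
    filter_upwards [hNpos, eventually_mem_nhdsWithin] with s hs hs0
    have hne : s • z + e ≠ 0 := fun h => by simp [hN, h] at hs
    simp only [hA, hB, hN]
    rw [← kelvin_translate_identity hinv he hs0, ← kelvin_origin_identity hinv0 hs0 hne]
  have hAB0 : A 0 = B 0 :=
    tendsto_nhds_unique_of_eventuallyEq
      (hAd.continuousAt.tendsto.mono_left nhdsWithin_le_nhds)
      (hBd.continuousAt.tendsto.mono_left nhdsWithin_le_nhds) hAB
  exact (uniqueDiffWithinAt_Ioi (0 : ℝ)).eq_deriv _ hAd.hasDerivWithinAt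
    (hBd.hasDerivWithinAt.congr_of_eventuallyEq hAB hAB0)

lemma quadratic_of_kelvin {F : E3 → ℝ} (hF : Differentiable ℝ F) (hpos : ∀ x, 0 < F x)
    (hinv : ∀ z, ∃ l, 0 < l ∧ ∀ x, x ≠ 0 → F (z + x) = (‖x‖ / l) ^ 2 * F (z + kelvin l x)) :
    ∃ k d : ℝ, ∃ x₀ : E3, 0 < k ∧ 0 < d ∧ ∀ x, F x = d + k * ‖x - x₀‖ ^ 2 := by
  obtain ⟨l0, hl0, hinv0⟩ := hinv 0
  simp only [zero_add] at hinv0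
  set k := F 0 / l0 ^ 2 with hk
  have hkpos : 0 < k := div_pos (hpos 0) (by positivity)
  set b := (InnerProductSpace.toDual ℝ E3).symm (fderiv ℝ F 0) with hb
  have hfd : ∀ z e, fderiv ℝ F z e = fderiv ℝ F 0 e + 2 * k * inner ℝ z e := fun z e => by
    by_cases he : e = 0
    · simp [he]
    have he0 : ‖e‖ ≠ 0 := norm_ne_zero_iff.2 he
    obtain ⟨l, hl, hl2⟩ := hinv z
    have h1 := value_and_deriv_of_kelvin hF hl.ne' hl0.ne' hl2 hinv0
      (e := ‖e‖⁻¹ • e) (by rw [norm_smul, norm_inv, norm_norm, inv_mul_cancel₀ he0])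
    rw [map_smul, map_smul, inner_smul_right, smul_eq_mul, smul_eq_mul] at h1
    have h2 : ‖e‖⁻¹ * fderiv ℝ F z e
        = ‖e‖⁻¹ * (fderiv ℝ F 0 e + 2 * k * inner ℝ z e) := by rw [h1]; ring
    exact mul_left_cancel₀ (inv_ne_zero he0) h2
  have hquad : ∀ x, F x = F 0 + fderiv ℝ F 0 x + k * ‖x‖ ^ 2 := fun x => by
    set G := fun x => F x - fderiv ℝ F 0 x - k * ‖x‖ ^ 2 with hG
    have hd : ∀ z, HasFDerivAt G (0 : E3 →L[ℝ] ℝ) z := fun z => by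
      have h1 := (((hF z).hasFDerivAt.sub (fderiv ℝ F 0).hasFDerivAt).sub
        ((hasStrictFDerivAt_norm_sq z).hasFDerivAt.const_mul k))
      refine h1.congr_fderiv ?_
      ext e
      simp [hfd z e]
      ring
    have := is_const_of_fderiv_eq_zero (𝕜 := ℝ) (fun z => (hd z).differentiableAt)
      (fun z => (hd z).fderiv) x 0
    simp only [hG, map_zero, norm_zero] at this
    linarith
  have hbx : ∀ x, fderiv ℝ F 0 x = inner ℝ b x := fun x => by
    rw [hb, InnerProductSpace.toDual_symm_apply]
  have hfinal : ∀ x, F x = (F 0 - ‖b‖ ^ 2 / (4 * k)) + k * ‖x - (-(1 / (2 * k)) • b)‖ ^ 2 :=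
    fun x => by
      rw [hquad x, hbx, @norm_sub_sq_real, norm_smul, inner_smul_right, norm_neg,
        norm_of_nonneg (by positivity : 0 ≤ 1 / (2 * k)), real_inner_comm]
      field_simp
      ring
  refine ⟨k, _, _, hkpos, ?_, hfinal⟩
  have := hfinal (-(1 / (2 * k)) • b)
  rw [sub_self, norm_zero] at this
  have := hpos (-(1 / (2 * k)) • b)
  linarith

lemma integral_one_add_sq_inv_cube : ∫ x : E3, ((1 + ‖x‖ ^ 2) ^ 3)⁻¹ = π ^ 2 / 4 := by
  rw [integral_fun_norm_addHaar volume (fun r : ℝ => ((1 + r ^ 2) ^ 3)⁻¹)]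
  have hd : ∀ r : ℝ, HasDerivAt
      (fun r : ℝ => (1 / 8) * (arctan r + (r ^ 3 - r) / (1 + r ^ 2) ^ 2))
      (r ^ 2 * ((1 + r ^ 2) ^ 3)⁻¹) r := fun r => by
    have h0 : 1 + r ^ 2 ≠ 0 := by positivity
    have h1 : HasDerivAt (fun r : ℝ => r ^ 3 - r) (3 * r ^ 2 - 1) r := by
      refine ((hasDerivAt_pow 3 r).sub (hasDerivAt_id r)).congr_deriv ?_
      simp
    have h2 : HasDerivAt (fun r : ℝ => (1 + r ^ 2) ^ 2) (2 * (1 + r ^ 2) * (2 * r)) r := by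
      refine (((hasDerivAt_pow 2 r).const_add 1).pow 2).congr_deriv ?_
      simp
    have h3 := ((hasDerivAt_arctan r).add (h1.div h2 (by positivity))).const_mul (1 / 8)
    refine h3.congr_deriv ?_
    field_simp
    ring
  have ht : Tendsto (fun r : ℝ => (1 / 8) * (arctan r + (r ^ 3 - r) / (1 + r ^ 2) ^ 2)) atTop
      (nhds ((1 / 8) * (π / 2 + 0))) := by
    refine ((tendsto_arctan_atTop.mono_right nhdsWithin_le_nhds).add ?_).const_mul _
    refine squeeze_zero_norm' (a := fun r : ℝ => r⁻¹) ?_ tendsto_inv_atTop_zero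
    filter_upwards [eventually_ge_atTop 1] with r hr
    have hr0 : 0 < r := by linarith
    rw [norm_eq_abs, abs_of_nonneg (div_nonneg (by nlinarith [pow_le_pow_left₀ zero_le_one hr 2]) (by positivity)),
      div_le_iff₀ (by positivity), ← div_eq_inv_mul, le_div_iff₀ hr0]
    nlinarith [sq_nonneg r]
  have hI := integral_Ioi_of_hasDerivAt_of_nonneg' (a := 0) (fun r _ => hd r)
    (fun r _ => by positivity) ht
  have hv : (volume : Measure E3).real (Metric.ball 0 1) = 4 / 3 * π := by
    have := EuclideanSpace.volume_ball_fin_three (0 : E3) 1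
    rw [Measure.real, this, ENNReal.ofReal_one, one_pow, one_mul,
      ENNReal.toReal_ofReal (by positivity)]
    ring
  simp only [finrank_euclideanSpace, Fintype.card_fin, smul_eq_mul, nsmul_eq_mul, hv]
  norm_num at hI ⊢
  rw [hI]
  ring

lemma integral_bubble {k d : ℝ} (hk : 0 < k) (hd : 0 < d) (x₀ : E3) :
    ∫ x : E3, ((d + k * ‖x - x₀‖ ^ 2) ^ 3)⁻¹ = π ^ 2 / 4 / (√(d * k)) ^ 3 := by
  rw [integral_sub_right_eq_self (fun x : E3 => ((d + k * ‖x‖ ^ 2) ^ 3)⁻¹) x₀]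
  set R := √(k / d) with hR
  have hRpos : 0 < R := by positivity
  have hR2 : R ^ 2 = k / d := sq_sqrt (by positivity)
  have h1 : ∀ x : E3, ((d + k * ‖x‖ ^ 2) ^ 3)⁻¹ = (d ^ 3)⁻¹ * ((1 + ‖R • x‖ ^ 2) ^ 3)⁻¹ := fun x => by
    rw [norm_smul, norm_of_nonneg hRpos.le, mul_pow, hR2, ← mul_inv, ← mul_pow]
    congr 2
    field_simp
  simp_rw [h1]
  rw [integral_const_mul, Measure.integral_comp_smul volume (fun x : E3 => ((1 + ‖x‖ ^ 2) ^ 3)⁻¹) R,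
    integral_one_add_sq_inv_cube]
  have h2 : √(d * k) = d * R := by
    rw [hR, sqrt_eq_iff_mul_self_eq (by positivity) (by positivity)]
    have := hR2
    rw [hR] at this
    symm
    calc d * √(k / d) * (d * √(k / d)) = d ^ 2 * √(k / d) ^ 2 := by ring
      _ = d * k := by rw [this]; field_simp
  rw [h2, finrank_euclideanSpace, Fintype.card_fin, abs_of_pos (by positivity), smul_eq_mul]
  field_simp

/-- A logarithmic potential plus a concave quadratic perturbation with volume at least that of the
sphere is spherical. -/
theorem isSpherical_of_logRep {u p : E3 → ℝ} (hu : Differentiable ℝ u)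
    (h : ∀ z : E3, (∀ (x : E3) (t : ℝ), 0 < t → t ≤ 1 → p (z + x) ≤ p (z + t • x)) →
      LogRep (fun x => u (z + x)) (fun x => p (z + x)))
    {z₀ : E3} {Q : E3 → ℝ} (hQ0 : ∀ x, 0 ≤ Q x) (hQ : ∀ (t : ℝ) x, Q (t • x) = t ^ 2 * Q x)
    (hp : ∀ x, p (z₀ + x) = p z₀ - Q x) : IsSpherical u := by
  have h0 := h z₀ fun x t ht ht1 => by
    rw [hp, hp, hQ]
    nlinarith [hQ0 x, mul_le_mul_of_nonneg_right (pow_le_one₀ (n := 2) ht.le ht1) (hQ0 x)]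
  obtain ⟨l, hl, -, hpl, hvol⟩ := h0.exists_kelvin_invariant
  have hQz : ∀ x, Q x = 0 := fun x => by
    by_cases hx : x = 0
    · have := hQ 0 0
      simpa [hx] using this
    have hx0 : 0 < ‖x‖ := norm_pos_iff.2 hx
    set y := (2 * l / ‖x‖) • x with hy
    have hyn : ‖y‖ = 2 * l := by
      rw [hy, norm_smul, norm_of_nonneg (by positivity)]
      field_simp
    have h1 := hpl y (by rw [hyn]; linarith)
    simp only [hp, kelvin_eq, hQ, hyn] at h1
    have h2 : Q y = 0 := by
      have : (l / (2 * l)) ^ 2 = 1 / 4 := by field_simp; norm_num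
      rw [this] at h1
      linarith
    rw [hy, hQ] at h2
    exact (mul_eq_zero.1 h2).resolve_left (by positivity)
  have hpc : ∀ x, p x = p z₀ := fun x => by
    have := hp (x - z₀)
    rw [hQz] at this
    simpa using this
  set F := fun x => exp (-u x) with hF
  obtain ⟨k, d, x₀, hk, hd, hFx⟩ := quadratic_of_kelvin (F := F) (by fun_prop)
    (fun x => exp_pos _) fun z => by
      obtain ⟨l, hl, hinv, -⟩ := (h z fun x t _ _ => by
        rw [hpc, hpc (z + t • x)]).exists_kelvin_invariant
      refine ⟨l, hl, fun x hx => ?_⟩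
      have hx0 : 0 < ‖x‖ := norm_pos_iff.2 hx
      simp only [hF]
      rw [hinv x hx, neg_sub, sub_eq_add_neg, exp_add, ← exp_log (show 0 < ‖x‖ / l by positivity),
        ← exp_nat_mul, log_exp]
      norm_num
  have hux : ∀ x, u x = -log (d + k * ‖x - x₀‖ ^ 2) := fun x => by
    rw [← hFx, log_exp, neg_neg]
  have hvol2 : ∫ x, exp (3 * u x) = 2 * π ^ 2 := by
    rw [← hvol, integral_add_left_eq_self (fun x => exp (3 * u x)) z₀]
  have hvol3 : ∫ x, exp (3 * u x) = π ^ 2 / 4 / (√(d * k)) ^ 3 := by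
    rw [← integral_bubble hk hd x₀]
    congr 1
    ext x
    have : exp (3 * u x) = (F x ^ 3)⁻¹ := by
      simp only [hF]
      rw [← exp_nat_mul, ← exp_neg]
      congr 1
      push_cast
      ring
    rw [this, hFx]
  have hdk : d * k = 1 / 4 := by
    have hs : 0 < √(d * k) := by positivity
    have h1 : √(d * k) ^ 3 = (1 / 2) ^ 3 := by
      rw [hvol3] at hvol2
      field_simp at hvol2
      have : π ^ 2 ≠ 0 := by positivity
      linarith
    have h2 : √(d * k) = 1 / 2 := (pow_left_inj₀ hs.le (by norm_num) (by norm_num)).1 h1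
    have h3 := sq_sqrt (show 0 ≤ d * k by positivity)
    rw [h2] at h3
    linarith
  refine ⟨2 * k, by positivity, x₀, fun x => ?_⟩
  rw [hux, ← log_inv]
  congr 1
  have hd' : d = 1 / (4 * k) := by field_simp; linarith
  have : 0 < d + k * ‖x - x₀‖ ^ 2 := by positivity
  rw [hd'] at this ⊢
  field_simp
  ring

/-- The negative part of the logarithm of the norm. -/
noncomputable def negLog (z : E3) : ℝ := max (-log ‖z‖) 0

lemma negLog_nonneg (z : E3) : 0 ≤ negLog z := le_max_right _ _

lemma measurable_negLog : Measurable negLog := by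
  unfold negLog
  fun_prop

lemma negLog_le_inv (z : E3) : negLog z ≤ ‖z‖⁻¹ := by
  refine max_le ?_ (by positivity)
  rcases (norm_nonneg z).eq_or_lt with h0 | h0
  · simp [← h0]
  · rw [← log_inv]
    exact (log_le_sub_one_of_pos (by positivity)).trans (by linarith)

lemma negLog_of_le {z : E3} (hz : 1 ≤ ‖z‖) : negLog z = 0 :=
  max_eq_right (by linarith [log_nonneg hz])

lemma negLog_sq_le (z : E3) : negLog z ^ 2 ≤ ballKer z := by
  rcases lt_or_ge ‖z‖ 1 with h | h
  · rw [ballKer_of_lt h, ← inv_pow]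
    exact pow_le_pow_left₀ (negLog_nonneg z) (negLog_le_inv z) 2
  · rw [ballKer_of_le h, negLog_of_le h]
    norm_num

lemma inv_le_ballKer {z : E3} (hz : ‖z‖ < 1) : ‖z‖⁻¹ ≤ ballKer z := by
  rw [ballKer_of_lt hz, ← inv_pow]
  rcases (norm_nonneg z).eq_or_lt with h0 | h0
  · simp [← h0]
  · exact le_self_pow₀ ((one_le_inv₀ h0).2 hz.le) two_ne_zero

lemma negLog_le_ballKer (z : E3) : negLog z ≤ ballKer z := by
  rcases lt_or_ge ‖z‖ 1 with h | h
  · exact (negLog_le_inv z).trans (inv_le_ballKer h)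
  · rw [ballKer_of_le h, negLog_of_le h]

lemma neg_log_norm_le (z : E3) : -log ‖z‖ ≤ negLog z := le_max_left _ _

/-- The normalised logarithmic kernel. -/
noncomputable def logKer (x y : E3) : ℝ := log ((1 + ‖y‖) / ‖x - y‖)

lemma measurable_logKer (x : E3) : Measurable (logKer x) := by
  unfold logKer
  fun_prop

lemma logKer_eq {x y : E3} (h : x ≠ y) : logKer x y = log (1 + ‖y‖) - log ‖x - y‖ :=
  log_div (by positivity) (norm_ne_zero_iff.2 (sub_ne_zero.2 h))

lemma neg_log_le_logKer (x y : E3) : -log (1 + ‖x‖) ≤ logKer x y := by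
  by_cases h : x = y
  · have : 0 ≤ log (1 + ‖y‖) := log_nonneg (by linarith [norm_nonneg y])
    simpa [logKer, h] using this
  · have h0 : 0 < ‖x - y‖ := norm_pos_iff.2 (sub_ne_zero.2 h)
    rw [logKer, ← log_inv]
    refine log_le_log (by positivity) ?_
    rw [le_div_iff₀ h0, inv_mul_le_iff₀ (by positivity)]
    nlinarith [norm_sub_le x y, norm_nonneg x, norm_nonneg y]

lemma logKer_le (x y : E3) : logKer x y ≤ log (2 + ‖x‖) + negLog (x - y) := by
  by_cases h : x = y
  · have h1 : 0 ≤ log (2 + ‖y‖) := log_nonneg (by linarith [norm_nonneg y])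
    simpa [logKer, h, negLog] using h1
  have h0 : 0 < ‖x - y‖ := norm_pos_iff.2 (sub_ne_zero.2 h)
  have hy : ‖y‖ ≤ ‖x‖ + ‖x - y‖ := by
    have := norm_sub_le x (x - y)
    simpa using this
  rcases le_or_gt 1 ‖x - y‖ with h1 | h1
  · rw [negLog_of_le h1, add_zero, logKer]
    refine log_le_log (by positivity) ?_
    rw [div_le_iff₀ h0]
    nlinarith [norm_nonneg x]
  · rw [logKer_eq h]
    have : log (1 + ‖y‖) ≤ log (2 + ‖x‖) := log_le_log (by positivity) (by linarith)
    linarith [neg_log_norm_le (x - y)]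

lemma abs_logKer_le (x y : E3) : |logKer x y| ≤ log (2 + ‖x‖) + ballKer (x - y) := by
  have h1 : log (1 + ‖x‖) ≤ log (2 + ‖x‖) := log_le_log (by positivity) (by linarith)
  rw [abs_le]
  constructor
  · linarith [neg_log_le_logKer x y, ballKer_nonneg (x - y)]
  · linarith [logKer_le x y, negLog_le_ballKer (x - y)]

section

variable {m : E3 → ℝ}

lemma integrable_negLog_mul (hm : Continuous m) (hmi : Integrable m) (x : E3) :
    Integrable fun y => negLog (x - y) * m y :=
  integrable_kernel_mul hm hmi measurable_negLog (A := 0) (B := 1) (fun z => by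
    rw [abs_of_nonneg (negLog_nonneg z)]
    linarith [negLog_le_ballKer z]) x

lemma integrable_logKer_mul (hm : Continuous m) (hmi : Integrable m) (x : E3) :
    Integrable fun y => logKer x y * m y := by
  refine ((hmi.norm.const_mul (log (2 + ‖x‖))).add (integrable_ballKer_mul hm x).norm).mono'
    ((measurable_logKer x).mul hm.measurable).aestronglyMeasurable (ae_of_all _ fun y => ?_)
  have := mul_le_mul_of_nonneg_right (abs_logKer_le x y) (abs_nonneg (m y))
  simp only [norm_mul, norm_eq_abs, Pi.add_apply, abs_of_nonneg (ballKer_nonneg _)]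
  linarith

end

lemma integral_logKer_far {m : E3 → ℝ} (hm : Continuous m) (hmi : Integrable m)
    (hm0 : ∀ y, 0 ≤ m y) {R e : ℝ} (hR : 0 ≤ R)
    (htail : ∫ y in (Metric.closedBall (0 : E3) R)ᶜ, m y ≤ e) {x : E3} (hx : 2 * R + 1 ≤ ‖x‖) :
    ∫ y, logKer x y * m y ≤ (log (2 * (1 + R)) * (∫ y, m y) + e * log 3)
      - ((∫ y, m y) - 2 * e) * log ‖x‖ + ∫ y, negLog (x - y) * m y := by
  set B := Metric.closedBall (0 : E3) R with hB
  have hBm : MeasurableSet B := measurableSet_closedBall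
  have hx1 : 1 ≤ ‖x‖ := by linarith
  have hx0 : 0 < ‖x‖ := by linarith
  have hlx : 0 ≤ log ‖x‖ := log_nonneg hx1
  have hin : ∀ y ∈ B, logKer x y ≤ log (2 * (1 + R)) - log ‖x‖ + negLog (x - y) := fun y hy => by
    have hy' : ‖y‖ ≤ R := by simpa [hB] using hy
    have h1 : ‖x‖ - ‖y‖ ≤ ‖x - y‖ := norm_sub_norm_le x y
    have h2 : 0 < ‖x - y‖ := by linarith
    rw [← log_div (by positivity) hx0.ne', logKer]
    have : log ((1 + ‖y‖) / ‖x - y‖) ≤ log (2 * (1 + R) / ‖x‖) := by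
      refine log_le_log (by positivity) ?_
      rw [div_le_div_iff₀ h2 hx0]
      nlinarith [norm_nonneg y]
    linarith [negLog_nonneg (x - y)]
  have hN := integrable_negLog_mul hm hmi x
  have hK := integrable_logKer_mul hm hmi x
  have h1 : ∫ y in B, logKer x y * m y ≤
      (log (2 * (1 + R)) - log ‖x‖) * (∫ y in B, m y) + ∫ y in B, negLog (x - y) * m y := by
    rw [← integral_const_mul, ← integral_add (hmi.const_mul _).integrableOn hN.integrableOn]
    refine setIntegral_mono_on hK.integrableOn
      ((hmi.const_mul _).integrableOn.add hN.integrableOn) hBm fun y hy => ?_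
    have := mul_le_mul_of_nonneg_right (hin y hy) (hm0 y)
    linarith
  have h2 : ∫ y in Bᶜ, logKer x y * m y ≤
      log (2 + ‖x‖) * (∫ y in Bᶜ, m y) + ∫ y in Bᶜ, negLog (x - y) * m y := by
    rw [← integral_const_mul, ← integral_add (hmi.const_mul _).integrableOn hN.integrableOn]
    refine setIntegral_mono_on hK.integrableOn
      ((hmi.const_mul _).integrableOn.add hN.integrableOn) hBm.compl fun y hy => ?_
    have := mul_le_mul_of_nonneg_right (logKer_le x y) (hm0 y)
    linarith
  have h3 := integral_add_compl hBm hK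
  have h4 := integral_add_compl hBm hN
  have h5 := integral_add_compl hBm hmi
  have h6 : 0 ≤ ∫ y in Bᶜ, m y := integral_nonneg hm0
  have h7 : 0 ≤ ∫ y in B, m y := integral_nonneg hm0
  have h8 : log (2 + ‖x‖) ≤ log 3 + log ‖x‖ := by
    rw [← log_mul (by norm_num) hx0.ne']
    exact log_le_log (by positivity) (by linarith)
  have h9 : 0 ≤ log (2 * (1 + R)) := log_nonneg (by linarith)
  have h10 : 0 ≤ log (3 : ℝ) := log_nonneg (by norm_num)
  rw [← h3, ← h4, ← h5]
  have h11 : log (2 + ‖x‖) * (∫ y in Bᶜ, m y) ≤ (log 3 + log ‖x‖) * ∫ y in Bᶜ, m y := by gcongr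
  nlinarith [mul_le_mul_of_nonneg_left htail hlx, mul_le_mul_of_nonneg_left htail h10,
    mul_nonneg h9 h6]

/-- A Jensen type inequality for measures of small mass. -/
lemma exp_potential_le {m : E3 → ℝ} (hm : Continuous m) (hmi : Integrable m)
    (hm0 : ∀ y, 0 ≤ m y) {c : ℝ} (hc : 0 < c) {x : E3}
    (hmass : ∫ y in Metric.ball x 1, m y ≤ c) :
    exp (1 / c * ∫ y, negLog (x - y) * m y)
      ≤ 1 + 1 / c * ∫ y, (Metric.ball (0 : E3) 1).indicator (fun z => ‖z‖⁻¹) (x - y) * m y := by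
  set a := 1 / c * ∫ y, negLog (x - y) * m y with ha
  set k : E3 → ℝ := (Metric.ball (0 : E3) 1).indicator (fun z => ‖z‖⁻¹) with hk
  have hkm : Measurable k := Measurable.indicator (by fun_prop) measurableSet_ball
  have hkb : ∀ z, |k z| ≤ 0 + 1 * ballKer z := fun z => by
    rw [zero_add, one_mul]
    by_cases hz : z ∈ Metric.ball (0 : E3) 1
    · rw [hk, Set.indicator_of_mem hz, abs_of_nonneg (by positivity)]
      exact inv_le_ballKer (by simpa using hz)
    · rw [hk, Set.indicator_of_notMem hz, abs_zero]
      exact ballKer_nonneg z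
  have hki := integrable_kernel_mul hm hmi hkm hkb x
  have hN := integrable_negLog_mul hm hmi x
  have hBm : MeasurableSet (Metric.ball x 1) := measurableSet_ball
  have hind : Integrable ((Metric.ball x 1).indicator m) := hmi.indicator hBm
  have hpt : ∀ᵐ y, exp a * ((1 - a) * (Metric.ball x 1).indicator m y + negLog (x - y) * m y)
      ≤ k (x - y) * m y := by
    have hne : ∀ᵐ y : E3, y ≠ x := by simp [ae_iff]
    filter_upwards [hne] with y hy
    have h0 : 0 < ‖x - y‖ := norm_pos_iff.2 (sub_ne_zero.2 hy.symm)
    by_cases hyB : y ∈ Metric.ball x 1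
    · have hz : ‖x - y‖ < 1 := by
        rwa [Metric.mem_ball, dist_comm, dist_eq_norm] at hyB
      rw [Set.indicator_of_mem hyB, hk, Set.indicator_of_mem (by simpa using hz)]
      have h1 : negLog (x - y) = -log ‖x - y‖ := max_eq_left (by linarith [log_neg h0 hz])
      have h2 : exp (negLog (x - y)) = ‖x - y‖⁻¹ := by rw [h1, exp_neg, exp_log h0]
      have h3 : exp a * (1 - a + negLog (x - y)) ≤ ‖x - y‖⁻¹ := by
        rw [← h2]
        have h4 := add_one_le_exp (negLog (x - y) - a)
        have h5 : exp (negLog (x - y)) = exp a * exp (negLog (x - y) - a) := by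
          rw [← exp_add]; congr 1; ring
        rw [h5]
        exact mul_le_mul_of_nonneg_left (by linarith) (exp_pos a).le
      have := mul_le_mul_of_nonneg_right h3 (hm0 y)
      linarith
    · have hz : 1 ≤ ‖x - y‖ := by
        rwa [Metric.mem_ball, dist_comm, dist_eq_norm, not_lt] at hyB
      rw [Set.indicator_of_notMem hyB, hk, Set.indicator_of_notMem (by simpa using hz),
        negLog_of_le hz]
      simp
  have hint := integral_mono_ae (((hind.const_mul (1 - a)).add hN).const_mul (exp a)) hki hpt
  simp only [Pi.add_apply] at hint
  rw [integral_const_mul, integral_add (hind.const_mul (1 - a)) hN, integral_const_mul,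
    integral_indicator hBm] at hint
  set M := ∫ y in Metric.ball x 1, m y with hM
  have hM0 : 0 ≤ M := integral_nonneg hm0
  have hN' : ∫ y, negLog (x - y) * m y = c * a := by rw [ha]; field_simp
  rw [hN'] at hint
  have h1 : exp a * (1 - a) ≤ 1 := by
    have := add_one_le_exp (-a)
    have h2 : exp a * exp (-a) = 1 := by rw [← exp_add]; simp
    nlinarith [exp_pos a]
  have h2 : exp a * (1 - a) * (c - M) ≤ c := by
    have : exp a * (1 - a) * (c - M) ≤ 1 * (c - M) :=
      mul_le_mul_of_nonneg_right h1 (by linarith)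
    linarith
  rw [one_div_mul_eq_div, ← sub_le_iff_le_add', le_div_iff₀ hc]
  nlinarith

/-- A function represented by a logarithmic potential plus a function `p`. -/
structure PotRep (u p : E3 → ℝ) : Prop where
  cont : Continuous u
  int : Integrable fun y => exp (3 * u y)
  rep : ∀ x, u x = (1 / π ^ 2) * (∫ y, logKer x y * exp (3 * u y)) + p x
  bdd : ∃ P, ∀ x, p x ≤ P
  vol : 2 * π ^ 2 ≤ ∫ y, exp (3 * u y)

lemma exists_tail_le {m : E3 → ℝ} (hmi : Integrable m) {e : ℝ} (he : 0 < e) :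
    ∃ R, 0 ≤ R ∧ ∫ y in (Metric.closedBall (0 : E3) R)ᶜ, m y ≤ e := by
  have h1 : Tendsto (fun R : ℝ => ∫ y, (Metric.closedBall (0 : E3) R)ᶜ.indicator m y) atTop
      (nhds (∫ _ : E3, 0)) := by
    refine tendsto_integral_filter_of_dominated_convergence (fun y => ‖m y‖) ?_ ?_ hmi.norm ?_
    · exact Eventually.of_forall fun R =>
        (hmi.indicator measurableSet_closedBall.compl).aestronglyMeasurable
    · exact Eventually.of_forall fun R => ae_of_all _ fun y => norm_indicator_le_norm_self _ _
    · refine ae_of_all _ fun y => tendsto_const_nhds.congr' ?_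
      filter_upwards [eventually_ge_atTop ‖y‖] with R hR
      rw [Set.indicator_of_notMem (by simpa using hR)]
  rw [integral_zero] at h1
  obtain ⟨R, hR1, hR0⟩ := ((h1.eventually_lt_const he).and (eventually_ge_atTop 0)).exists
  rw [integral_indicator measurableSet_closedBall.compl] at hR1
  exact ⟨R, hR0, hR1.le⟩

lemma integrable_potential {m : E3 → ℝ} (hmi : Integrable m) {k : E3 → ℝ} (hk : Integrable k) :
    Integrable fun y => ∫ z, k (y - z) * m z := by
  have := hmi.integrable_convolution (ContinuousLinearMap.mul ℝ ℝ) hk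
  refine this.congr (ae_of_all _ fun y => ?_)
  simp only [convolution, ContinuousLinearMap.mul_apply', mul_comm]

namespace PotRep

variable {u p : E3 → ℝ}

/-- Solutions of large volume decay at infinity. -/
theorem decay (h : PotRep u p) : ∃ C, ∀ x, 3 * u x ≤ C - 23 / 4 * log (1 + ‖x‖) := by
  set m : E3 → ℝ := fun y => exp (3 * u y) with hm
  have hmc : Continuous m := by
    have := h.cont
    fun_prop
  have hmi : Integrable m := h.int
  have hm0 : ∀ y, 0 ≤ m y := fun y => (exp_pos _).le
  have hpi : 0 < π ^ 2 := by positivity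
  obtain ⟨P, hP⟩ := h.bdd
  obtain ⟨R, hR, htail⟩ := exists_tail_le hmi (show 0 < π ^ 2 / 24 by positivity)
  set A := log (2 * (1 + R)) * (∫ y, m y) + π ^ 2 / 24 * log 3 with hA
  set C1 := (1 / π ^ 2) * A + P with hC1
  set L : E3 → ℝ := fun x => ∫ y, negLog (x - y) * m y with hL
  have hfar : ∀ x : E3, 2 * R + 2 ≤ ‖x‖ →
      u x ≤ C1 - 23 / 12 * log ‖x‖ + (1 / π ^ 2) * L x := fun x hx => by
    have h1 := integral_logKer_far hmc hmi hm0 hR htail (x := x) (by linarith)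
    have h2 : 0 ≤ log ‖x‖ := log_nonneg (by linarith)
    have h3 : 23 / 12 * π ^ 2 * log ‖x‖ ≤ ((∫ y, m y) - 2 * (π ^ 2 / 24)) * log ‖x‖ := by
      gcongr
      linarith [h.vol]
    have h4 : ∫ y, logKer x y * m y ≤ A - 23 / 12 * π ^ 2 * log ‖x‖ + L x := by
      rw [hA, hL]; simp only; linarith
    have h5 : (1 / π ^ 2) * (∫ y, logKer x y * m y)
        ≤ (1 / π ^ 2) * (A - 23 / 12 * π ^ 2 * log ‖x‖ + L x) := by gcongr
    have h6 : (1 / π ^ 2) * (A - 23 / 12 * π ^ 2 * log ‖x‖ + L x)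
        = (1 / π ^ 2) * A - 23 / 12 * log ‖x‖ + (1 / π ^ 2) * L x := by field_simp
    rw [h.rep x]
    linarith [hP x]
  set k : E3 → ℝ := (Metric.ball (0 : E3) 1).indicator (fun z => ‖z‖⁻¹) with hk
  have hk0 : ∀ z, 0 ≤ k z := Set.indicator_nonneg fun _ _ => by positivity
  have hki : Integrable k := by
    refine integrable_ballKer.mono' (Measurable.indicator (by fun_prop)
      measurableSet_ball).aestronglyMeasurable (ae_of_all _ fun z => ?_)
    rw [norm_eq_abs, abs_of_nonneg (hk0 z)]
    by_cases hz : z ∈ Metric.ball (0 : E3) 1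
    · rw [hk, Set.indicator_of_mem hz]
      exact inv_le_ballKer (by simpa using hz)
    · rw [hk, Set.indicator_of_notMem hz]
      exact ballKer_nonneg z
  set g : E3 → ℝ := fun y => ∫ z, k (y - z) * m z with hg
  have hgi : Integrable g := integrable_potential hmi hki
  have hg0 : ∀ y, 0 ≤ g y := fun y => integral_nonneg fun z => mul_nonneg (hk0 _) (hm0 z)
  have hsq : ∀ y : E3, 2 * R + 2 ≤ ‖y‖ → m y ^ 2 ≤ exp (6 * C1) * (1 + 6 / π ^ 2 * g y) :=
    fun y hy => by
      have hmass : ∫ z in Metric.ball y 1, m z ≤ π ^ 2 / 6 := by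
        have : ∫ z in Metric.ball y 1, m z ≤ ∫ z in (Metric.closedBall (0 : E3) R)ᶜ, m z := by
          refine setIntegral_mono_set hmi.integrableOn (ae_of_all _ hm0)
            (LE.le.eventuallyLE fun z hz => ?_)
          have hz' : ‖y - z‖ < 1 := by rwa [Metric.mem_ball, dist_comm, dist_eq_norm] at hz
          have := norm_sub_norm_le y z
          simp only [Set.mem_compl_iff, Metric.mem_closedBall, dist_zero_right, not_le]
          linarith
        linarith
      have h1 := exp_potential_le hmc hmi hm0 (show 0 < π ^ 2 / 6 by positivity) hmass
      have h2 : m y ^ 2 = exp (6 * u y) := by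
        rw [hm, ← exp_nat_mul]; congr 1; push_cast; ring
      have h3 : 0 ≤ log ‖y‖ := log_nonneg (by linarith)
      have h4 : 6 * u y ≤ 6 * C1 + 1 / (π ^ 2 / 6) * L y := by
        have : 1 / (π ^ 2 / 6) * L y = 6 * ((1 / π ^ 2) * L y) := by field_simp
        rw [this]
        linarith [hfar y hy]
      rw [h2]
      calc exp (6 * u y) ≤ exp (6 * C1) * exp (1 / (π ^ 2 / 6) * L y) := by
            rw [← exp_add]; exact exp_le_exp.2 h4
        _ ≤ exp (6 * C1) * (1 + 6 / π ^ 2 * g y) := by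
            refine mul_le_mul_of_nonneg_left (h1.trans_eq ?_) (exp_pos _).le
            rw [one_div_div]
  set C2 := exp (6 * C1) * ((volume : Measure E3).real (Metric.ball 0 1) + 6 / π ^ 2 * ∫ y, g y)
    with hC2
  have hloc : ∀ x : E3, IntegrableOn (fun y => m y ^ 2) (Metric.ball x 1) := fun x =>
    ((hmc.pow 2).continuousOn.integrableOn_compact (isCompact_closedBall x 1)).mono_set
      Metric.ball_subset_closedBall
  have hball : ∀ x : E3, 2 * R + 3 ≤ ‖x‖ → ∫ y in Metric.ball x 1, m y ^ 2 ≤ C2 := fun x hx => by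
    have hone : IntegrableOn (fun _ : E3 => (1 : ℝ)) (Metric.ball x 1) := by
      simp
    calc ∫ y in Metric.ball x 1, m y ^ 2
        ≤ ∫ y in Metric.ball x 1, exp (6 * C1) * (1 + 6 / π ^ 2 * g y) := by
          refine setIntegral_mono_on (hloc x)
            ((hone.add (hgi.integrableOn.const_mul _)).const_mul _) measurableSet_ball
            fun y hy => hsq y ?_
          have hy' : ‖x - y‖ < 1 := by rwa [Metric.mem_ball, dist_comm, dist_eq_norm] at hy
          linarith [norm_sub_norm_le x y]
      _ = exp (6 * C1) * ((volume : Measure E3).real (Metric.ball x 1)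
            + 6 / π ^ 2 * ∫ y in Metric.ball x 1, g y) := by
          rw [integral_const_mul, integral_add hone (hgi.integrableOn.const_mul _),
            integral_const_mul]
          simp
      _ ≤ C2 := by
          rw [hC2, Measure.addHaar_real_ball_center]
          exact mul_le_mul_of_nonneg_left (add_le_add le_rfl (mul_le_mul_of_nonneg_left
            (setIntegral_le_integral hgi (ae_of_all _ hg0)) (by positivity))) (exp_pos _).le
  have hLb : ∀ x : E3, 2 * R + 3 ≤ ‖x‖ → L x ≤ (∫ z, ballKer z) + C2 := fun x hx => by
    have hi : Integrable ((Metric.ball x 1).indicator fun y => m y ^ 2) :=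
      (integrable_indicator_iff measurableSet_ball).2 (hloc x)
    calc L x ≤ ∫ y, (ballKer (x - y) + (Metric.ball x 1).indicator (fun y => m y ^ 2) y) := by
          refine integral_mono (integrable_negLog_mul hmc hmi x)
            ((integrable_ballKer_sub x).add hi) fun y => ?_
          by_cases hy : y ∈ Metric.ball x 1
          · simp only [Set.indicator_of_mem hy]
            nlinarith [negLog_sq_le (x - y), sq_nonneg (negLog (x - y) - m y),
              ballKer_nonneg (x - y), sq_nonneg (m y), sq_nonneg (negLog (x - y))]
          · have hz : 1 ≤ ‖x - y‖ := by
              rwa [Metric.mem_ball, dist_comm, dist_eq_norm, not_lt] at hy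
            simp only [Set.indicator_of_notMem hy, negLog_of_le hz]
            linarith [ballKer_nonneg (x - y)]
      _ = (∫ z, ballKer z) + ∫ y in Metric.ball x 1, m y ^ 2 := by
          rw [integral_add (integrable_ballKer_sub x) hi, integral_indicator measurableSet_ball,
            integral_sub_left_eq_self ballKer volume x]
      _ ≤ _ := by linarith [hball x hx]
  set C3 := 3 * C1 + 3 / π ^ 2 * ((∫ z, ballKer z) + C2) + 23 / 4 * log 2 with hC3
  have hcont : Continuous fun x => 3 * u x + 23 / 4 * log (1 + ‖x‖) := by
    have := h.cont
    have h2 : ∀ x : E3, 1 + ‖x‖ ≠ 0 := fun x => by positivity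
    fun_prop (disch := assumption)
  obtain ⟨C4, hC4⟩ := (isCompact_closedBall (0 : E3) (2 * R + 3)).exists_bound_of_continuousOn
    hcont.continuousOn
  refine ⟨max C3 C4, fun x => ?_⟩
  rcases le_total (2 * R + 3) ‖x‖ with hx | hx
  · have h1 := hfar x (by linarith)
    have h2 : (1 / π ^ 2) * L x ≤ (1 / π ^ 2) * ((∫ z, ballKer z) + C2) :=
      mul_le_mul_of_nonneg_left (hLb x hx) (by positivity)
    have h3 : log (1 + ‖x‖) ≤ log 2 + log ‖x‖ := by
      rw [← log_mul (by norm_num) (by linarith)]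
      exact log_le_log (by positivity) (by linarith)
    have h4 : 3 / π ^ 2 * ((∫ z, ballKer z) + C2)
        = 3 * ((1 / π ^ 2) * ((∫ z, ballKer z) + C2)) := by ring
    have := le_max_left C3 C4
    linarith
  · have h1 := (le_abs_self _).trans (hC4 x (by simpa using hx))
    have := le_max_right C3 C4
    linarith

end PotRep

lemma abs_log_norm_le (z : E3) : |log ‖z‖| ≤ ‖z‖ + ballKer z := by
  rw [abs_le]
  constructor
  · linarith [neg_log_norm_le z, negLog_le_ballKer z, norm_nonneg z]
  · rcases (norm_nonneg z).eq_or_lt with h | h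
    · simp [← h, ballKer_nonneg z]
    · linarith [log_le_sub_one_of_pos h, ballKer_nonneg z]

namespace PotRep

variable {u p : E3 → ℝ}

theorem exp_le_rpow (h : PotRep u p) :
    ∃ C, 0 ≤ C ∧ ∀ x, exp (3 * u x) ≤ C * (1 + ‖x‖) ^ (-(23 / 4 : ℝ)) := by
  obtain ⟨C, hC⟩ := h.decay
  refine ⟨exp C, (exp_pos _).le, fun x => ?_⟩
  rw [rpow_def_of_pos (by positivity), ← exp_add]
  exact exp_le_exp.2 (by linarith [hC x])

theorem exp_sq_le_rpow (h : PotRep u p) (z : E3) :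
    ∃ C, 0 ≤ C ∧ ∀ x, (1 + ‖x‖ ^ 2) * exp (3 * u (z + x)) ≤ C * (1 + ‖z + x‖) ^ (-(15 / 4 : ℝ)) := by
  obtain ⟨C, hC0, hC⟩ := h.exp_le_rpow
  refine ⟨(1 + ‖z‖) ^ 2 * C, by positivity, fun x => ?_⟩
  have h1 : 1 + ‖x‖ ^ 2 ≤ (1 + ‖z‖) ^ 2 * (1 + ‖z + x‖) ^ 2 := by
    have : ‖x‖ ≤ ‖z‖ + ‖z + x‖ := by simpa [add_comm] using norm_sub_le (z + x) z
    have h2 := norm_nonneg x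
    have h3 := norm_nonneg z
    have h4 := norm_nonneg (z + x)
    have h5 : 1 + ‖x‖ ≤ (1 + ‖z‖) * (1 + ‖z + x‖) := by nlinarith [mul_nonneg h3 h4]
    rw [← mul_pow]
    nlinarith
  have h2 : (1 + ‖z + x‖) ^ (-(15 / 4 : ℝ))
      = (1 + ‖z + x‖) ^ 2 * (1 + ‖z + x‖) ^ (-(23 / 4 : ℝ)) := by
    rw [← rpow_natCast, ← rpow_add (by positivity)]
    norm_num
  calc (1 + ‖x‖ ^ 2) * exp (3 * u (z + x))
      ≤ ((1 + ‖z‖) ^ 2 * (1 + ‖z + x‖) ^ 2) * (C * (1 + ‖z + x‖) ^ (-(23 / 4 : ℝ))) := by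
        gcongr
        exact hC _
    _ = _ := by rw [h2]; ring

/-- A potential representation yields a logarithmic representation of all translates. -/
theorem logRep (h : PotRep u p) :
    ∃ c : ℝ, ∀ z, (∀ (x : E3) (t : ℝ), 0 < t → t ≤ 1 → p (z + x) + c ≤ p (z + t • x) + c) →
      LogRep (fun x => u (z + x)) (fun x => p (z + x) + c) := by
  have hmc : Continuous fun y => exp (3 * u y) := by
    have := h.cont
    fun_prop
  have hsq : ∀ z : E3, Integrable fun x => (1 + ‖x‖ ^ 2) * exp (3 * u (z + x)) := fun z => by
    obtain ⟨C, hC0, hC⟩ := h.exp_sq_le_rpow z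
    have h1 : Integrable fun x : E3 => (1 + ‖x‖) ^ (-(15 / 4 : ℝ)) :=
      integrable_one_add_norm (by simp; norm_num)
    refine ((h1.comp_add_left z).const_mul C).mono' ?_ (ae_of_all _ fun x => ?_)
    · have := hmc.comp (continuous_const.add continuous_id : Continuous fun x : E3 => z + x)
      exact Continuous.aestronglyMeasurable (by fun_prop)
    · rw [norm_of_nonneg (by positivity)]
      exact hC x
  have hi0 : Integrable fun x => (1 + ‖x‖ ^ 2) * exp (3 * u x) := by simpa using hsq 0
  have hlog : ∀ x : E3, Integrable fun y => log ‖x - y‖ * exp (3 * u y) := fun x => by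
    refine ((hi0.const_mul (‖x‖ + 1)).add (integrable_ballKer_mul hmc x)).mono' ?_
      (ae_of_all _ fun y => ?_)
    · exact (Measurable.mul (by fun_prop) hmc.measurable).aestronglyMeasurable
    · rw [norm_mul, norm_eq_abs, norm_of_nonneg (exp_pos _).le]
      have h1 := mul_le_mul_of_nonneg_right (abs_log_norm_le (x - y)) (exp_pos (3 * u y)).le
      have h2 : ‖x - y‖ ≤ (‖x‖ + 1) * (1 + ‖y‖ ^ 2) := by
        nlinarith [norm_sub_le x y, norm_nonneg x, norm_nonneg y,
          mul_nonneg (norm_nonneg x) (sq_nonneg ‖y‖), sq_nonneg (‖y‖ - 1)]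
      have h3 := mul_le_mul_of_nonneg_right h2 (exp_pos (3 * u y)).le
      simp only [Pi.add_apply]
      linarith
  have hlog1 : Integrable fun y => log (1 + ‖y‖) * exp (3 * u y) := by
    refine hi0.mono' (Measurable.mul (by fun_prop) hmc.measurable).aestronglyMeasurable
      (ae_of_all _ fun y => ?_)
    have h0 := norm_nonneg y
    have h1 : 0 ≤ log (1 + ‖y‖) := log_nonneg (by linarith)
    rw [norm_of_nonneg (by positivity)]
    refine mul_le_mul_of_nonneg_right ?_ (exp_pos _).le
    have := log_le_sub_one_of_pos (show 0 < 1 + ‖y‖ by positivity)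
    nlinarith [sq_nonneg (‖y‖ - 1)]
  refine ⟨(1 / π ^ 2) * ∫ y, log (1 + ‖y‖) * exp (3 * u y), fun z hz => ?_⟩
  refine ⟨?_, h.int.comp_add_left z, ?_, ?_, fun x => ?_, fun x => ?_, hz, ?_⟩
  · have := h.cont
    fun_prop
  · refine (hsq z).mono' ?_ (ae_of_all _ fun x => ?_)
    · have := hmc.comp (continuous_const.add continuous_id : Continuous fun x : E3 => z + x)
      exact Continuous.aestronglyMeasurable (by fun_prop)
    · rw [norm_of_nonneg (by positivity)]
      gcongr
      linarith
  · obtain ⟨C, hC0, hC⟩ := h.exp_sq_le_rpow z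
    refine ⟨C, fun y => (hC y).trans ?_⟩
    refine mul_le_of_le_one_right hC0 (rpow_le_one_of_one_le_of_nonpos ?_ (by norm_num))
    linarith [norm_nonneg (z + y)]
  · have := (hlog (z + x)).comp_add_left z
    simpa using this
  · have h1 : ∫ y, log ‖x - y‖ * exp (3 * u (z + y)) = ∫ y, log ‖z + x - y‖ * exp (3 * u y) := by
      rw [← integral_add_left_eq_self (fun y => log ‖z + x - y‖ * exp (3 * u y)) z]
      simp
    have h2 : ∫ y, logKer (z + x) y * exp (3 * u y)
        = (∫ y, log (1 + ‖y‖) * exp (3 * u y)) - ∫ y, log ‖z + x - y‖ * exp (3 * u y) := by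
      rw [← integral_sub hlog1 (hlog _)]
      refine integral_congr_ae ?_
      filter_upwards [ae_ne_point (z + x)] with y hy
      rw [logKer_eq (Ne.symm hy)]
      ring
    rw [h1, h.rep, h2]
    ring
  · rw [integral_add_left_eq_self (fun y => exp (3 * u y)) z]
    exact h.vol

/-- Functions represented by a logarithmic potential plus a concave quadratic form, of volume at
least `2π²`, are spherical. -/
theorem isSpherical (h : PotRep u p) (hu : Differentiable ℝ u) {z₀ : E3} {Q : E3 → ℝ}
    (hQ0 : ∀ x, 0 ≤ Q x) (hQ : ∀ (t : ℝ) x, Q (t • x) = t ^ 2 * Q x)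
    (hp : ∀ x, p (z₀ + x) = p z₀ - Q x) : IsSpherical u := by
  obtain ⟨c, hc⟩ := h.logRep
  exact isSpherical_of_logRep (p := fun x => p x + c) (z₀ := z₀) hu hc hQ0 hQ fun x => by
    rw [hp x]; ring

end PotRep

lemma hasFDerivAt_radial {h h' : ℝ → ℝ} (hh : ∀ t, 0 ≤ t → HasDerivAt h (h' t) t) (c x : E3) :
    HasFDerivAt (fun y => h (‖y - c‖ ^ 2))
      (h' (‖x - c‖ ^ 2) • (2 • innerSL ℝ (x - c))) x := by
  have h1 : HasFDerivAt (fun y : E3 => ‖y - c‖ ^ 2) (2 • innerSL ℝ (x - c)) x := by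
    have := ((hasFDerivAt_id x).sub_const c).norm_sq
    simpa using this
  exact (hh _ (by positivity)).comp_hasFDerivAt x h1

/-- The Laplacian of a radial function about `c`. -/
lemma lap_radial {h h' h'' : ℝ → ℝ} (hh : ∀ t, 0 ≤ t → HasDerivAt h (h' t) t)
    (hh' : ∀ t, 0 ≤ t → HasDerivAt h' (h'' t) t) (c x : E3) :
    lap (fun y => h (‖y - c‖ ^ 2)) x
      = 6 * h' (‖x - c‖ ^ 2) + 4 * ‖x - c‖ ^ 2 * h'' (‖x - c‖ ^ 2) := by
  have h1 : ∀ i : Fin 3, (fun y => fderiv ℝ (fun y => h (‖y - c‖ ^ 2)) y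
      (EuclideanSpace.single i 1)) = fun y => h' (‖y - c‖ ^ 2) * (2 * (y i - c i)) := fun i => by
    funext y
    rw [(hasFDerivAt_radial hh c y).fderiv]
    simp [EuclideanSpace.inner_single_right]
  have h2 : ∀ i : Fin 3, fderiv ℝ (fun y => h' (‖y - c‖ ^ 2) * (2 * (y i - c i))) x
      (EuclideanSpace.single i 1)
      = h' (‖x - c‖ ^ 2) * 2 + (x i - c i) ^ 2 * (4 * h'' (‖x - c‖ ^ 2)) := fun i => by
    have h3 : HasFDerivAt (fun y : E3 => 2 * (y i - c i))
        ((2 : ℝ) • (EuclideanSpace.proj i : E3 →L[ℝ] ℝ)) x :=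
      (((EuclideanSpace.proj i : E3 →L[ℝ] ℝ).hasFDerivAt.sub_const (c i)).const_mul 2)
    rw [((hasFDerivAt_radial hh' c x).fun_mul h3).fderiv]
    simp [EuclideanSpace.inner_single_right]
    ring
  have h4 : ‖x - c‖ ^ 2 = ∑ i, (x i - c i) ^ 2 := by
    simp [EuclideanSpace.norm_sq_eq]
  rw [lap]
  simp_rw [h1, h2]
  rw [Finset.sum_add_distrib, Finset.sum_const, ← Finset.sum_mul, ← h4]
  simp
  ring

section

variable {f g : E3 → ℝ}

lemma contDiff_fderiv_apply {n : ℕ} (hf : ContDiff ℝ (n + 1) f) (v : E3) :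
    ContDiff ℝ n fun y => fderiv ℝ f y v :=
  (hf.fderiv_right le_rfl).clm_apply contDiff_const

lemma continuous_lap (hf : ContDiff ℝ 2 f) : Continuous (lap f) := by
  unfold lap
  refine continuous_finsetSum _ fun i _ => ?_
  have h1 : ContDiff ℝ 1 fun y => fderiv ℝ f y (EuclideanSpace.single i 1) :=
    contDiff_fderiv_apply (n := 1) (by exact_mod_cast hf) _
  exact (h1.continuous_fderiv one_ne_zero).clm_apply continuous_const

lemma hasCompactSupport_fderiv_apply (hg : HasCompactSupport g) (v : E3) :
    HasCompactSupport fun y => fderiv ℝ g y v :=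
  hg.fderiv_apply ℝ v

lemma hasCompactSupport_lap (hg : HasCompactSupport g) : HasCompactSupport (lap g) := by
  refine HasCompactSupport.intro hg fun x hx => ?_
  refine Finset.sum_eq_zero fun i _ => ?_
  have h := image_eq_zero_of_notMem_tsupport (f := fun y => fderiv ℝ
    (fun z => fderiv ℝ g z (EuclideanSpace.single i 1)) y (EuclideanSpace.single i 1)) (x := x)
  refine h fun h' => hx ?_
  exact tsupport_fderiv_apply_subset ℝ _ (tsupport_fderiv_apply_subset ℝ _ h')

/-- Integration by parts for a directional derivative. -/
lemma integral_mul_fderiv_of_hasCompactSupport (hf : ContDiff ℝ 1 f) (hg : ContDiff ℝ 1 g)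
    (hc : HasCompactSupport f ∨ HasCompactSupport g) (v : E3) :
    ∫ x, f x * fderiv ℝ g x v = -∫ x, fderiv ℝ f x v * g x := by
  have hf' : Continuous fun x => fderiv ℝ f x v :=
    (hf.continuous_fderiv one_ne_zero).clm_apply continuous_const
  have hg' : Continuous fun x => fderiv ℝ g x v :=
    (hg.continuous_fderiv one_ne_zero).clm_apply continuous_const
  refine integral_mul_fderiv_eq_neg_fderiv_mul_of_integrable
    ((hf'.mul hg.continuous).integrable_of_hasCompactSupport ?_)
    ((hf.continuous.mul hg').integrable_of_hasCompactSupport ?_)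
    ((hf.continuous.mul hg.continuous).integrable_of_hasCompactSupport ?_)
    (fun x _ => hf.differentiable one_ne_zero x) (fun x _ => hg.differentiable one_ne_zero x)
  · exact hc.elim (fun h => (hasCompactSupport_fderiv_apply h v).mul_right) fun h => h.mul_left
  · exact hc.elim (fun h => h.mul_right) fun h => (hasCompactSupport_fderiv_apply h v).mul_left
  · exact hc.elim (fun h => h.mul_right) fun h => h.mul_left

/-- Green's identity against a compactly supported function. -/
lemma integral_mul_lap (hf : ContDiff ℝ 2 f) (hg : ContDiff ℝ 2 g) (hc : HasCompactSupport g) :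
    ∫ x, f x * lap g x = ∫ x, lap f x * g x := by
  have e : ((1 : ℕ) + 1 : WithTop ℕ∞) = 2 := by norm_num
  have hf1 := fun v => contDiff_fderiv_apply (n := 1) (by rwa [e]) v (f := f)
  have hg1 := fun v => contDiff_fderiv_apply (n := 1) (by rwa [e]) v (f := g)
  have hf2 : ContDiff ℝ 1 f := hf.of_le one_le_two
  have hg2 : ContDiff ℝ 1 g := hg.of_le one_le_two
  have hfc : ∀ v w : E3, Continuous fun x => fderiv ℝ (fun y => fderiv ℝ f y v) x w :=
    fun v w => ((hf1 v).continuous_fderiv one_ne_zero).clm_apply continuous_const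
  have hgc : ∀ v w : E3, Continuous fun x => fderiv ℝ (fun y => fderiv ℝ g y v) x w :=
    fun v w => ((hg1 v).continuous_fderiv one_ne_zero).clm_apply continuous_const
  unfold lap
  simp_rw [Finset.mul_sum, Finset.sum_mul]
  rw [integral_finsetSum, integral_finsetSum]
  · refine Finset.sum_congr rfl fun i _ => ?_
    rw [integral_mul_fderiv_of_hasCompactSupport hf2 (hg1 _)
      (Or.inr (hasCompactSupport_fderiv_apply hc _)),
      integral_mul_fderiv_of_hasCompactSupport (hf1 _) hg2 (Or.inr hc), neg_neg]
  · exact fun i _ => ((hfc _ _).mul hg.continuous).integrable_of_hasCompactSupport hc.mul_left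
  · exact fun i _ => (hf.continuous.mul (hgc _ _)).integrable_of_hasCompactSupport
      (hasCompactSupport_fderiv_apply (hasCompactSupport_fderiv_apply hc _) _).mul_left

end

lemma hasDerivAt_expNegInvGlue (t : ℝ) :
    HasDerivAt expNegInvGlue ((t⁻¹) ^ 2 * expNegInvGlue t) t := by
  simpa using expNegInvGlue.hasDerivAt_polynomial_eval_inv_mul 1 t

/-- The derivative of `expNegInvGlue`, reflected about `1/2`. -/
noncomputable def bumpKer (t : ℝ) : ℝ := deriv expNegInvGlue (1 - t)

lemma bumpKer_eq (t : ℝ) : bumpKer t = ((1 - t)⁻¹) ^ 2 * expNegInvGlue (1 - t) :=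
  (hasDerivAt_expNegInvGlue _).deriv

lemma contDiff_bumpKer {n : ℕ} : ContDiff ℝ n bumpKer := by
  have h : ContDiff ℝ (n + 1 : ℕ) expNegInvGlue := expNegInvGlue.contDiff (n := ((n + 1 : ℕ) : ℕ∞))
  have h1 : ContDiff ℝ n (deriv expNegInvGlue) := by
    refine ((contDiff_succ_iff_deriv (n := n)).1 (by exact_mod_cast h)).2.2
  exact h1.comp (contDiff_const.sub contDiff_id)

lemma bumpKer_nonneg (t : ℝ) : 0 ≤ bumpKer t := by
  rw [bumpKer_eq]
  exact mul_nonneg (by positivity) (expNegInvGlue.nonneg _)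

lemma bumpKer_pos {t : ℝ} (ht : t < 1) : 0 < bumpKer t := by
  rw [bumpKer_eq]
  have := expNegInvGlue.pos_of_pos (show 0 < 1 - t by linarith)
  have : 0 < 1 - t := by linarith
  positivity

lemma bumpKer_of_le {t : ℝ} (ht : 1 ≤ t) : bumpKer t = 0 := by
  rw [bumpKer_eq, expNegInvGlue.zero_of_nonpos (by linarith), mul_zero]

/-- A radial averaging kernel supported on the unit ball. -/
noncomputable def meanKer (z : E3) : ℝ := bumpKer (‖z‖ ^ 2)

lemma meanKer_nonneg (z : E3) : 0 ≤ meanKer z := bumpKer_nonneg _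

lemma contDiff_meanKer {n : ℕ} : ContDiff ℝ n meanKer :=
  contDiff_bumpKer.comp (contDiff_norm_sq ℝ)

lemma continuous_meanKer : Continuous meanKer := (contDiff_meanKer (n := 0)).continuous

lemma meanKer_of_le {z : E3} (hz : 1 ≤ ‖z‖) : meanKer z = 0 :=
  bumpKer_of_le (one_le_pow₀ hz)

lemma meanKer_neg (z : E3) : meanKer (-z) = meanKer z := by simp [meanKer]

lemma hasCompactSupport_meanKer : HasCompactSupport meanKer :=
  HasCompactSupport.intro (isCompact_closedBall 0 1) fun z hz =>
    meanKer_of_le (by simpa using (not_le.1 fun h => hz (by simpa using h)).le)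

lemma integrable_mul_meanKer {f : E3 → ℝ} (hf : Continuous f) :
    Integrable fun z => f z * meanKer z :=
  (hf.mul continuous_meanKer).integrable_of_hasCompactSupport hasCompactSupport_meanKer.mul_left

lemma integrable_meanKer : Integrable meanKer :=
  continuous_meanKer.integrable_of_hasCompactSupport hasCompactSupport_meanKer

lemma integral_meanKer_pos : 0 < ∫ z, meanKer z := by
  refine continuous_meanKer.integral_pos_of_hasCompactSupport_nonneg_nonzero
    hasCompactSupport_meanKer meanKer_nonneg (x := 0) ?_
  exact (bumpKer_pos (by simp)).ne'

lemma exists_meanKer_le : ∃ C, 0 < C ∧ ∀ z, meanKer z ≤ C := by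
  obtain ⟨C, hC⟩ := hasCompactSupport_meanKer.exists_bound_of_continuous continuous_meanKer
  exact ⟨max C 1, by positivity, fun z => (le_abs_self _).trans ((hC z).trans (le_max_left _ _))⟩

lemma exists_le_meanKer : ∃ c, 0 < c ∧ ∀ z : E3, ‖z‖ ≤ 1 / 2 → c ≤ meanKer z := by
  obtain ⟨z, hz, hz'⟩ := (isCompact_closedBall (0 : E3) (1 / 2)).exists_isMinOn
    ⟨0, by simp⟩ continuous_meanKer.continuousOn
  refine ⟨meanKer z, bumpKer_pos ?_, fun w hw => hz' (by simpa using hw)⟩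
  have : ‖z‖ ≤ 1 / 2 := by simpa using hz
  nlinarith [norm_nonneg z]

/-- A continuous, weakly harmonic function. -/
structure WeakHarmonic (q : E3 → ℝ) : Prop where
  cont : Continuous q
  weak : ∀ η : E3 → ℝ, ContDiff ℝ 2 η → HasCompactSupport η → ∫ x, q x * lap η x = 0

/-- The defining property of the averaging kernel: its scale derivative is a Laplacian. -/
lemma exists_scaled_test (c : E3) {R : ℝ} (hR : 0 < R) :
    ∃ η : E3 → ℝ, ContDiff ℝ 2 η ∧ HasCompactSupport η ∧
      (∀ y, lap η y = (R ^ 2)⁻¹ * (-6 * bumpKer (‖y - c‖ ^ 2 / R ^ 2)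
        - 4 * (‖y - c‖ ^ 2 / R ^ 2) * deriv bumpKer (‖y - c‖ ^ 2 / R ^ 2))) := by
  refine ⟨fun y => (fun t => expNegInvGlue (1 - t / R ^ 2)) (‖y - c‖ ^ 2), ?_, ?_, fun y => ?_⟩
  · have h : ContDiff ℝ 2 expNegInvGlue := expNegInvGlue.contDiff (n := (2 : ℕ∞))
    have h2 : ContDiff ℝ 2 fun y : E3 => ‖y - c‖ ^ 2 :=
      (contDiff_id.sub contDiff_const).norm_sq ℝ
    exact h.comp (contDiff_const.sub (h2.div_const _))
  · refine HasCompactSupport.intro (isCompact_closedBall c R) fun y hy => ?_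
    refine expNegInvGlue.zero_of_nonpos ?_
    have h1 : R < ‖y - c‖ := by simpa [dist_eq_norm] using hy
    have h2 : 1 ≤ ‖y - c‖ ^ 2 / R ^ 2 := by
      rw [one_le_div (by positivity)]
      gcongr
    linarith
  · have h0 : ∀ t, HasDerivAt (fun t : ℝ => t / R ^ 2) (R ^ 2)⁻¹ t := fun t => by
      simpa using (hasDerivAt_id t).div_const (R ^ 2)
    have h1 : ∀ t, 0 ≤ t → HasDerivAt (fun t => expNegInvGlue (1 - t / R ^ 2))
        (-(R ^ 2)⁻¹ * bumpKer (t / R ^ 2)) t := fun t _ => by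
      have h := (hasDerivAt_expNegInvGlue (1 - t / R ^ 2)).comp t ((h0 t).const_sub 1)
      refine h.congr_deriv ?_
      rw [bumpKer_eq]
      ring
    have h2 : ∀ t, 0 ≤ t → HasDerivAt (fun t => -(R ^ 2)⁻¹ * bumpKer (t / R ^ 2))
        (-(R ^ 2)⁻¹ * (deriv bumpKer (t / R ^ 2) * (R ^ 2)⁻¹)) t := fun t _ =>
      (((contDiff_bumpKer (n := 1)).differentiable one_ne_zero _).hasDerivAt.comp t
        (h0 t)).const_mul _
    rw [lap_radial h1 h2]
    field_simp
    ring

namespace WeakHarmonic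

variable {q : E3 → ℝ}

lemma hasDerivAt_mean (h : WeakHarmonic q) (c : E3) {R : ℝ} (hR : 0 < R) :
    HasDerivAt (fun r => ∫ y, (r ^ 3)⁻¹ * bumpKer (‖y - c‖ ^ 2 / r ^ 2) * q y) 0 R := by
  set F' : ℝ → E3 → ℝ := fun r y => ((r ^ 4)⁻¹ * (-3 * bumpKer (‖y - c‖ ^ 2 / r ^ 2)
        - 2 * (‖y - c‖ ^ 2 / r ^ 2) * deriv bumpKer (‖y - c‖ ^ 2 / r ^ 2))) * q y with hF'
  have hb : Continuous bumpKer := (contDiff_bumpKer (n := 0)).continuous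
  have hb' : Continuous (deriv bumpKer) := (contDiff_bumpKer (n := 1)).continuous_deriv le_rfl
  have hq := h.cont
  have hsupp : ∀ r y, 0 < r → r < ‖y - c‖ → bumpKer (‖y - c‖ ^ 2 / r ^ 2) = 0 ∧
      deriv bumpKer (‖y - c‖ ^ 2 / r ^ 2) = 0 := fun r y hr hy => by
    have h1 : 1 < ‖y - c‖ ^ 2 / r ^ 2 := by
      rw [one_lt_div (by positivity)]
      gcongr
    refine ⟨bumpKer_of_le h1.le, ?_⟩
    have : bumpKer =ᶠ[nhds (‖y - c‖ ^ 2 / r ^ 2)] fun _ => 0 := by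
      filter_upwards [eventually_gt_nhds h1] with t ht using bumpKer_of_le ht.le
    rw [this.deriv_eq, deriv_const]
  have hcont : ∀ r, 0 < r → Continuous fun y => (r ^ 3)⁻¹ * bumpKer (‖y - c‖ ^ 2 / r ^ 2) * q y :=
    fun r _ => by fun_prop
  have hcont' : ∀ r, 0 < r → Continuous (F' r) := fun r _ => by
    rw [hF']; fun_prop
  have hFon : ContinuousOn (Function.uncurry F')
      (Set.Icc (R / 2) (2 * R) ×ˢ Metric.closedBall c (2 * R)) := by
    have h0 : ∀ z ∈ Set.Icc (R / 2) (2 * R) ×ˢ Metric.closedBall c (2 * R), z.1 ≠ 0 :=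
      fun z hz => by have := hz.1.1; intro h0; rw [h0] at this; linarith
    have h4 : ∀ z ∈ Set.Icc (R / 2) (2 * R) ×ˢ Metric.closedBall c (2 * R), z.1 ^ 4 ≠ 0 :=
      fun z hz => pow_ne_zero _ (h0 z hz)
    have h2 : ∀ z ∈ Set.Icc (R / 2) (2 * R) ×ˢ Metric.closedBall c (2 * R), z.1 ^ 2 ≠ 0 :=
      fun z hz => pow_ne_zero _ (h0 z hz)
    have h5 : ContinuousOn (fun z : ℝ × E3 => ‖z.2 - c‖ ^ 2 / z.1 ^ 2)
        (Set.Icc (R / 2) (2 * R) ×ˢ Metric.closedBall c (2 * R)) :=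
      ContinuousOn.div (by fun_prop) (by fun_prop) h2
    refine ContinuousOn.mul (ContinuousOn.mul (ContinuousOn.inv₀ (by fun_prop) h4) ?_)
      (by fun_prop)
    exact ((hb.comp_continuousOn h5).const_mul _).sub
      (ContinuousOn.mul (h5.const_mul _) (hb'.comp_continuousOn h5))
  obtain ⟨C, hC⟩ := (isCompact_Icc.prod (isCompact_closedBall c (2 * R))).exists_bound_of_continuousOn
    hFon
  have key := hasDerivAt_integral_of_dominated_loc_of_deriv_le (μ := volume) (x₀ := R)
    (s := Set.Ioo (R / 2) (2 * R))
    (F := fun r y => (r ^ 3)⁻¹ * bumpKer (‖y - c‖ ^ 2 / r ^ 2) * q y) (F' := F')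
    (bound := (Metric.closedBall c (2 * R)).indicator fun _ => C)
    (Ioo_mem_nhds (by linarith) (by linarith)) ?_ ?_ (hcont' R hR).aestronglyMeasurable ?_ ?_ ?_
  · refine key.2.congr_deriv ?_
    obtain ⟨η, h1, h2, h3⟩ := exists_scaled_test c hR
    rw [← mul_zero (R ^ 2)⁻¹, ← mul_zero (1 / 2 : ℝ), ← h.weak η h1 h2, ← integral_const_mul,
      ← integral_const_mul]
    refine integral_congr_ae (ae_of_all _ fun y => ?_)
    simp only [hF', h3]
    field_simp
    ring
  · filter_upwards [eventually_gt_nhds hR] with r hr using (hcont r hr).aestronglyMeasurable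
  · refine (hcont R hR).integrable_of_hasCompactSupport
      (HasCompactSupport.intro (isCompact_closedBall c R) fun y hy => ?_)
    have h1 : R < ‖y - c‖ := by simpa [dist_eq_norm] using hy
    simp [(hsupp R y hR h1).1]
  · refine ae_of_all _ fun y r hr => ?_
    have hr0 : 0 < r := by linarith [hr.1]
    by_cases hy : y ∈ Metric.closedBall c (2 * R)
    · rw [Set.indicator_of_mem hy]
      exact hC (r, y) ⟨⟨hr.1.le, hr.2.le⟩, hy⟩
    · rw [Set.indicator_of_notMem hy]
      have h1 : 2 * R < ‖y - c‖ := by simpa [dist_eq_norm] using hy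
      have h2 := hsupp r y hr0 (by linarith [hr.2])
      simp [hF', h2.1, h2.2]
  · exact (integrable_indicator_iff measurableSet_closedBall).2
      ((continuous_const).continuousOn.integrableOn_compact (isCompact_closedBall _ _))
  · refine ae_of_all _ fun y r hr => HasDerivAt.mul_const ?_ _
    have hr0 : r ≠ 0 := by linarith [hr.1]
    have d1 : HasDerivAt (fun r : ℝ => (r ^ 3)⁻¹) (-(3 * r ^ 2) / (r ^ 3) ^ 2) r := by
      simpa using (hasDerivAt_pow 3 r).fun_inv (pow_ne_zero _ hr0)
    have d2 : HasDerivAt (fun r : ℝ => ‖y - c‖ ^ 2 / r ^ 2)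
        (‖y - c‖ ^ 2 * (-(2 * r) / (r ^ 2) ^ 2)) r := by
      have := ((hasDerivAt_pow 2 r).fun_inv (pow_ne_zero _ hr0)).const_mul (‖y - c‖ ^ 2)
      simpa [div_eq_mul_inv] using this
    have d3 := ((contDiff_bumpKer (n := 1)).differentiable one_ne_zero
      (‖y - c‖ ^ 2 / r ^ 2)).hasDerivAt.comp r d2
    refine (d1.mul d3).congr_deriv ?_
    simp only [Function.comp]
    field_simp
    ring

lemma integral_scaled (f : E3 → ℝ) (c : E3) {R : ℝ} (hR : 0 < R) :
    ∫ y, (R ^ 3)⁻¹ * bumpKer (‖y - c‖ ^ 2 / R ^ 2) * f y = ∫ z, f (c + R • z) * meanKer z := by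
  have h1 := Measure.integral_comp_smul volume (fun y : E3 => f (c + y) * bumpKer (‖y‖ ^ 2 / R ^ 2)) R
  have h2 := integral_add_right_eq_self (fun y : E3 =>
    (R ^ 3)⁻¹ * bumpKer (‖y - c‖ ^ 2 / R ^ 2) * f y) c (μ := volume)
  rw [← h2]
  have h3 : ∀ z : E3, f (c + R • z) * meanKer z
      = f (c + R • z) * bumpKer (‖R • z‖ ^ 2 / R ^ 2) := fun z => by
    rw [meanKer, norm_smul, mul_pow, norm_eq_abs, sq_abs, mul_div_cancel_left₀ _ (by positivity)]
  simp_rw [h3]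
  rw [h1, finrank_euclideanSpace_fin, abs_of_pos (by positivity), smul_eq_mul,
    ← integral_const_mul]
  simp only [add_sub_cancel_right, add_comm c]
  congr 1
  ext y
  ring

/-- The mean value property. -/
theorem mean_value (h : WeakHarmonic q) (c : E3) {R : ℝ} (hR : 0 < R) :
    ∫ z, q (c + R • z) * meanKer z = q c * ∫ z, meanKer z := by
  set M : ℝ → ℝ := fun r => ∫ z, q (c + r • z) * meanKer z with hM
  have hconst : ∀ r ∈ Set.Ioi (0 : ℝ), M r = M R := fun r hr => by
    have h1 : ∀ s ∈ Set.Ioi (0 : ℝ), HasDerivWithinAt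
        (fun r => ∫ y, (r ^ 3)⁻¹ * bumpKer (‖y - c‖ ^ 2 / r ^ 2) * q y) 0 (Set.Ioi 0) s :=
      fun s hs => (h.hasDerivAt_mean c hs).hasDerivWithinAt
    have := (convex_Ioi (0 : ℝ)).is_const_of_fderivWithin_eq_zero (𝕜 := ℝ)
      (fun s hs => (h1 s hs).differentiableWithinAt) (fun s hs => by
        rw [(h1 s hs).hasFDerivWithinAt.fderivWithin (uniqueDiffOn_Ioi 0 s hs)]
        ext; simp) hr (show R ∈ Set.Ioi 0 from hR)
    simpa only [hM, integral_scaled q c hr, integral_scaled q c hR] using this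
  have hlim : Tendsto M (nhdsWithin 0 (Set.Ioi 0)) (nhds (∫ z, q c * meanKer z)) := by
    obtain ⟨C, hC⟩ := (isCompact_closedBall c 1).exists_bound_of_continuousOn h.cont.continuousOn
    have hq := h.cont
    have hk := continuous_meanKer
    have hev : ∀ᶠ r in nhdsWithin (0 : ℝ) (Set.Ioi 0), r ∈ Set.Ioo (0 : ℝ) 1 :=
      Ioo_mem_nhdsGT one_pos
    refine tendsto_integral_filter_of_dominated_convergence (fun z => C * meanKer z) ?_ ?_
      (integrable_meanKer.const_mul C) (ae_of_all _ fun z => ?_)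
    · exact Eventually.of_forall fun r => Continuous.aestronglyMeasurable (by fun_prop)
    · filter_upwards [hev] with r hr
      refine ae_of_all _ fun z => ?_
      rw [norm_mul, norm_of_nonneg (meanKer_nonneg z)]
      rcases le_total 1 ‖z‖ with hz | hz
      · simp [meanKer_of_le hz]
      · refine mul_le_mul_of_nonneg_right (hC _ ?_) (meanKer_nonneg z)
        rw [mem_closedBall_iff_norm, add_sub_cancel_left, norm_smul, norm_of_nonneg hr.1.le]
        exact mul_le_one₀ hr.2.le (norm_nonneg _) hz
    · refine Tendsto.mul_const _ ?_
      have : Continuous fun r : ℝ => q (c + r • z) := by fun_prop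
      have := this.tendsto 0
      simp only [zero_smul, add_zero] at this
      exact this.mono_left nhdsWithin_le_nhds
  rw [integral_const_mul] at hlim
  refine tendsto_nhds_unique (tendsto_const_nhds.congr' ?_) hlim
  filter_upwards [self_mem_nhdsWithin] with r hr using (hconst r hr).symm

end WeakHarmonic

/-- Continuous functions with the mean value property for `meanKer`. -/
structure MeanValue (q : E3 → ℝ) : Prop where
  cont : Continuous q
  mean : ∀ (c : E3) (R : ℝ), 0 < R →
    ∫ z, q (c + R • z) * meanKer z = q c * ∫ z, meanKer z

lemma WeakHarmonic.meanValue {q : E3 → ℝ} (h : WeakHarmonic q) : MeanValue q :=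
  ⟨h.cont, fun c _ hR => h.mean_value c hR⟩

namespace MeanValue

variable {q : E3 → ℝ}

lemma integrable (h : MeanValue q) (c : E3) (R : ℝ) :
    Integrable fun z => q (c + R • z) * meanKer z :=
  integrable_mul_meanKer (h.cont.comp (by fun_prop))

lemma diff (h : MeanValue q) (v : E3) : MeanValue fun x => q (x + v) - q x := by
  have hq := h.cont
  refine ⟨by fun_prop, fun c R hR => ?_⟩
  have h1 : ∀ z, (q (c + R • z + v) - q (c + R • z)) * meanKer z
      = q (c + v + R • z) * meanKer z - q (c + R • z) * meanKer z := fun z => by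
    rw [add_right_comm]; ring
  simp_rw [h1]
  rw [integral_sub (h.integrable _ _) (h.integrable _ _), h.mean _ _ hR, h.mean _ _ hR]
  ring

/-- A one-sided quadratic bound is two-sided. -/
theorem abs_le_of_le (h : MeanValue q) {C : ℝ} (hC : 0 ≤ C)
    (hq : ∀ x, q x ≤ C * (1 + ‖x‖) ^ 2) : ∃ C', ∀ x, |q x| ≤ C' * (1 + ‖x‖) ^ 2 := by
  obtain ⟨S, hS, hkS⟩ := exists_meanKer_le
  obtain ⟨s, hs, hks⟩ := exists_le_meanKer
  set K := ∫ z, meanKer z with hK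
  have hK0 : 0 < K := integral_meanKer_pos
  set D := 64 * S / s with hD
  have hD0 : 0 < D := by positivity
  have hqc := h.cont
  have low : ∀ x, -q x ≤ D * (25 * C * (1 + ‖x‖) ^ 2 + |q 0|) := fun x => by
    set r := 1 + ‖x‖ with hr
    have hr1 : 1 ≤ r := by linarith [norm_nonneg x]
    set M := 25 * C * r ^ 2 with hM
    have hbd : ∀ y : E3, ‖y‖ ≤ 4 * r → q y ≤ M := fun y hy => by
      calc q y ≤ C * (1 + ‖y‖) ^ 2 := hq y
        _ ≤ C * (5 * r) ^ 2 := by gcongr; linarith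
        _ = M := by rw [hM]; ring
    have e1 : (M - q x) * K = ∫ z, (M - q (x + r • z)) * meanKer z := by
      simp_rw [sub_mul]
      rw [integral_sub (integrable_meanKer.const_mul M) (h.integrable _ _),
        integral_const_mul, h.mean x r (by linarith)]
    have e2 : (M - q 0) * K = ∫ z, (M - q ((4 * r) • z)) * meanKer z := by
      simp_rw [sub_mul]
      have h3 := h.mean 0 (4 * r) (by linarith)
      have h4 := h.integrable 0 (4 * r)
      simp only [zero_add] at h3 h4
      rw [integral_sub (integrable_meanKer.const_mul M) h4, integral_const_mul, h3]
    have e3 : ∫ z, (M - q ((4 * r) • (z + (4 * r)⁻¹ • x))) * meanKer ((4 : ℝ) • z)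
        = (64 : ℝ)⁻¹ * ∫ z, (M - q (x + r • z)) * meanKer z := by
      have hpt : ∀ z : E3, (4 * r) • (z + (4 * r)⁻¹ • x) = x + r • (4 : ℝ) • z := fun z => by
        rw [smul_add, smul_smul (4 * r), mul_inv_cancel₀ (by positivity), one_smul, smul_smul,
          mul_comm r, add_comm]
      simp_rw [hpt]
      have := Measure.integral_comp_smul volume (fun z => (M - q (x + r • z)) * meanKer z) 4
      rw [finrank_euclideanSpace_fin, abs_of_pos (by norm_num), smul_eq_mul] at this
      rw [this]
      norm_num
    have e4 : ∫ z, (M - q ((4 * r) • (z + (4 * r)⁻¹ • x))) * meanKer ((4 : ℝ) • z)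
        = ∫ z, (M - q ((4 * r) • z)) * meanKer ((4 : ℝ) • (z - (4 * r)⁻¹ • x)) := by
      rw [← integral_sub_right_eq_self _ ((4 * r)⁻¹ • x)]
      simp
    have hint : Integrable fun z => (M - q ((4 * r) • z)) * meanKer z :=
      integrable_mul_meanKer (by fun_prop)
    have e5 : ∫ z, (M - q ((4 * r) • z)) * meanKer ((4 : ℝ) • (z - (4 * r)⁻¹ • x))
        ≤ ∫ z, S / s * ((M - q ((4 * r) • z)) * meanKer z) := by
      have hcase : ∀ z : E3, ‖(4 : ℝ) • (z - (4 * r)⁻¹ • x)‖ < 1 → ‖z‖ ≤ 1 / 2 := fun z hz => by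
        rw [norm_smul, norm_of_nonneg (by norm_num : (0 : ℝ) ≤ 4)] at hz
        have h6 := norm_sub_norm_le z ((4 * r)⁻¹ • x)
        have h7 : ‖(4 * r)⁻¹ • x‖ ≤ 1 / 4 := by
          rw [norm_smul, norm_of_nonneg (by positivity), inv_mul_le_iff₀ (by positivity)]
          linarith
        linarith
      have hpos : ∀ z : E3, ‖z‖ ≤ 1 → 0 ≤ M - q ((4 * r) • z) := fun z hz => by
        refine sub_nonneg.2 (hbd _ ?_)
        rw [norm_smul, norm_of_nonneg (by positivity)]
        exact mul_le_of_le_one_right (by positivity) hz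
      refine integral_mono_of_nonneg (ae_of_all _ fun z => ?_) (hint.const_mul _)
        (ae_of_all _ fun z => ?_)
      · rcases le_or_gt 1 ‖(4 : ℝ) • (z - (4 * r)⁻¹ • x)‖ with hz | hz
        · simp only [meanKer_of_le hz, mul_zero, Pi.zero_apply, le_refl]
        · exact mul_nonneg (hpos z (by linarith [hcase z hz])) (meanKer_nonneg _)
      · rcases le_or_gt 1 ‖(4 : ℝ) • (z - (4 * r)⁻¹ • x)‖ with hz | hz
        · simp only [meanKer_of_le hz, mul_zero]
          refine mul_nonneg (by positivity) ?_
          rcases le_or_gt 1 ‖z‖ with hz' | hz'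
          · simp [meanKer_of_le hz']
          · exact mul_nonneg (hpos z hz'.le) (meanKer_nonneg _)
        · have h6 := hpos z (by linarith [hcase z hz])
          have h7 : meanKer ((4 : ℝ) • (z - (4 * r)⁻¹ • x)) ≤ S / s * meanKer z := by
            calc _ ≤ S := hkS _
              _ = S / s * s := by field_simp
              _ ≤ _ := by
                gcongr
                exact hks z (hcase z hz)
          calc _ ≤ (M - q ((4 * r) • z)) * (S / s * meanKer z) :=
                mul_le_mul_of_nonneg_left h7 h6
            _ = _ := by ring
    have hkey : (M - q x) * K ≤ D * ((M - q 0) * K) := by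
      rw [e1, e2, hD]
      rw [← e4, e3, integral_const_mul] at e5
      have : 64 * S / s = 64 * (S / s) := by ring
      rw [this]
      linarith
    have h5 : M - q x ≤ D * (M - q 0) := by
      rw [← mul_assoc] at hkey
      exact le_of_mul_le_mul_right hkey hK0
    have hM0 : 0 ≤ M := by positivity
    have : D * (M - q 0) ≤ D * (M + |q 0|) := by
      gcongr
      linarith [neg_abs_le (q 0)]
    linarith
  refine ⟨max C (D * (25 * C + |q 0|)), fun x => abs_le.2 ⟨?_, ?_⟩⟩
  · have h1 : (1 : ℝ) ≤ (1 + ‖x‖) ^ 2 := one_le_pow₀ (by linarith [norm_nonneg x])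
    have h2 : D * (25 * C * (1 + ‖x‖) ^ 2 + |q 0|) ≤ D * (25 * C + |q 0|) * (1 + ‖x‖) ^ 2 := by
      rw [mul_assoc D]
      refine mul_le_mul_of_nonneg_left ?_ hD0.le
      nlinarith [abs_nonneg (q 0)]
    have h3 : D * (25 * C + |q 0|) * (1 + ‖x‖) ^ 2
        ≤ max C (D * (25 * C + |q 0|)) * (1 + ‖x‖) ^ 2 := by
      gcongr
      exact le_max_right _ _
    linarith [low x]
  · refine (hq x).trans ?_
    gcongr
    exact le_max_left _ _

/-- Differences grow one order slower. -/
theorem abs_diff_le (h : MeanValue q) {C : ℝ} {m : ℕ} (hq : ∀ x, |q x| ≤ C * (1 + ‖x‖) ^ m)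
    (v : E3) : ∃ C', 0 ≤ C' ∧ ∀ (R : ℝ) (x : E3), 1 + ‖x‖ + ‖v‖ ≤ R →
      |q (x + v) - q x| ≤ C' * R ^ m / R := by
  have hC : 0 ≤ C := by simpa using (abs_nonneg _).trans (hq 0)
  set K := ∫ z, meanKer z with hK
  have hK0 : 0 < K := integral_meanKer_pos
  obtain ⟨L, hL⟩ := (contDiff_meanKer (n := 1)).lipschitzWith_of_hasCompactSupport
    hasCompactSupport_meanKer one_ne_zero
  set V := (volume : Measure E3).real (Metric.closedBall 0 2) with hV
  refine ⟨C * 3 ^ m * L * ‖v‖ * V / K, by positivity, fun R x hR => ?_⟩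
  have hR0 : 0 < R := by linarith [norm_nonneg x, norm_nonneg v]
  have hqc := h.cont
  have hkc := continuous_meanKer
  have e1 : ∫ z, q (x + v + R • z) * meanKer z
      = ∫ z, q (x + R • z) * meanKer (z - R⁻¹ • v) := by
    rw [← integral_sub_right_eq_self _ (R⁻¹ • v)]
    refine integral_congr_ae (ae_of_all _ fun z => ?_)
    simp only
    congr 2
    rw [smul_sub, smul_smul, mul_inv_cancel₀ hR0.ne', one_smul]
    abel
  have hi : Integrable fun z => q (x + R • z) * meanKer (z - R⁻¹ • v) := by
    have := (h.integrable (x + v) R).comp_sub_right (R⁻¹ • v)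
    refine this.congr (ae_of_all _ fun z => ?_)
    simp only
    congr 2
    rw [smul_sub, smul_smul, mul_inv_cancel₀ hR0.ne', one_smul]
    abel
  have e2 : (q (x + v) - q x) * K
      = ∫ z, (q (x + R • z) * meanKer (z - R⁻¹ • v) - q (x + R • z) * meanKer z) := by
    rw [integral_sub hi (h.integrable _ _), ← e1, h.mean _ _ hR0, h.mean _ _ hR0, sub_mul]
  have hvR : ‖R⁻¹ • v‖ = ‖v‖ / R := by
    rw [norm_smul, norm_inv, norm_of_nonneg hR0.le]; ring
  have hvR1 : ‖R⁻¹ • v‖ ≤ 1 := by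
    rw [hvR, div_le_one hR0]; linarith [norm_nonneg x]
  have e3 : ‖∫ z, (q (x + R • z) * meanKer (z - R⁻¹ • v) - q (x + R • z) * meanKer z)‖
      ≤ ∫ z, (Metric.closedBall (0 : E3) 2).indicator
          (fun _ => C * (3 * R) ^ m * (L * (‖v‖ / R))) z := by
    refine norm_integral_le_of_norm_le ((integrable_indicator_iff measurableSet_closedBall).2
      (continuous_const.continuousOn.integrableOn_compact (isCompact_closedBall _ _)))
      (ae_of_all _ fun z => ?_)
    by_cases hz : z ∈ Metric.closedBall (0 : E3) 2
    · rw [Set.indicator_of_mem hz, ← mul_sub, norm_mul]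
      have hz' : ‖z‖ ≤ 2 := by simpa using hz
      refine mul_le_mul ((hq _).trans ?_) ?_ (norm_nonneg _) (by positivity)
      · gcongr
        have := norm_add_le x (R • z)
        rw [norm_smul, norm_of_nonneg hR0.le] at this
        nlinarith [norm_nonneg v]
      · have := hL.norm_sub_le (z - R⁻¹ • v) z
        rwa [sub_sub_cancel_left, norm_neg, hvR] at this
    · rw [Set.indicator_of_notMem hz]
      have hz' : 2 < ‖z‖ := by simpa using hz
      rw [meanKer_of_le (z := z) (by linarith), meanKer_of_le (z := z - R⁻¹ • v)
        (by linarith [norm_sub_norm_le z (R⁻¹ • v)])]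
      simp
  rw [← e2, integral_indicator measurableSet_closedBall, setIntegral_const, smul_eq_mul,
    norm_mul, norm_of_nonneg hK0.le, ← hV, ← le_div_iff₀ hK0] at e3
  refine e3.trans_eq ?_
  rw [mul_pow]
  field_simp

/-- Third differences of quadratically bounded functions with the mean value property vanish. -/
theorem third_diff (h : MeanValue q) {C : ℝ} (hq : ∀ x, |q x| ≤ C * (1 + ‖x‖) ^ 2)
    (a b c : E3) :
    q (a + b + c) - q (a + b) - q (a + c) - q (b + c) + q a + q b + q c - q 0 = 0 := by
  have step : ∀ {q : E3 → ℝ} {C : ℝ} {m : ℕ}, MeanValue q →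
      (∀ x, |q x| ≤ C * (1 + ‖x‖) ^ (m + 1)) → ∀ v : E3,
      ∃ C', ∀ x, |q (x + v) - q x| ≤ C' * (1 + ‖x‖) ^ m := by
    intro q C m h hq v
    obtain ⟨C', hC', h'⟩ := h.abs_diff_le hq v
    refine ⟨C' * (1 + ‖v‖) ^ m, fun x => ?_⟩
    have hp : 0 < 1 + ‖x‖ + ‖v‖ := by positivity
    have h1 := h' _ x le_rfl
    rw [pow_succ, ← mul_assoc, mul_div_assoc, div_self hp.ne', mul_one] at h1
    refine h1.trans ?_
    rw [mul_assoc, ← mul_pow]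
    gcongr
    nlinarith [norm_nonneg x, norm_nonneg v, mul_nonneg (norm_nonneg x) (norm_nonneg v)]
  obtain ⟨C1, h1⟩ := step (m := 1) h hq a
  obtain ⟨C2, h2⟩ := step (m := 0) (h.diff a) h1 b
  obtain ⟨C3, hC3, h3⟩ := ((h.diff a).diff b).abs_diff_le h2 c
  have h4 : ∀ᶠ R : ℝ in atTop,
      |q (0 + c + b + a) - q (0 + c + b) - (q (0 + c + a) - q (0 + c))
        - (q (0 + b + a) - q (0 + b) - (q (0 + a) - q 0))| ≤ C3 * R⁻¹ := by
    filter_upwards [eventually_ge_atTop (1 + ‖(0 : E3)‖ + ‖c‖)] with R hR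
    simpa [div_eq_mul_inv] using h3 R 0 hR
  have h5 : Tendsto (fun R : ℝ => C3 * R⁻¹) atTop (nhds 0) := by
    simpa using tendsto_inv_atTop_zero.const_mul C3
  have h6 := abs_nonpos_iff.1 (ge_of_tendsto h5 h4)
  simp only [zero_add] at h6
  rw [add_comm a b, add_comm (b + a) c, ← add_assoc, add_comm a c, add_comm (b : E3) c]
  linarith

/-- Liouville's theorem: quadratic growth forces a quadratic polynomial. -/
theorem quadratic (h : MeanValue q) {C : ℝ} (hq : ∀ x, |q x| ≤ C * (1 + ‖x‖) ^ 2) :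
    ∃ (l : E3 →ₗ[ℝ] ℝ) (B : E3 →ₗ[ℝ] E3 →ₗ[ℝ] ℝ), (∀ x y, B x y = B y x) ∧
      ∀ x, q x = q 0 + l x + B x x := by
  have hqc := h.cont
  set b : E3 → E3 → ℝ := fun x y => (q (x + y) - q x - q y + q 0) / 2 with hb
  have hsymm : ∀ x y, b x y = b y x := fun x y => by simp only [hb, add_comm x y]; ring
  have hadd : ∀ x x' y, b (x + x') y = b x y + b x' y := fun x x' y => by
    have := h.third_diff hq x x' y
    simp only [hb]; linarith
  have hsmul : ∀ (t : ℝ) x y, b (t • x) y = t • b x y := fun t x y =>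
    map_real_smul (AddMonoidHom.mk' (fun x => b x y) fun x x' => hadd x x' y)
      (by simp only [hb, AddMonoidHom.mk'_apply]; fun_prop) t x
  set B : E3 →ₗ[ℝ] E3 →ₗ[ℝ] ℝ := LinearMap.mk₂ ℝ b hadd hsmul
    (fun x y y' => by rw [hsymm x, hadd, hsymm y, hsymm y'])
    (fun t x y => by rw [hsymm x, hsmul, hsymm y]) with hB
  have hBb : ∀ x y, B x y = b x y := fun x y => rfl
  have hladd : ∀ x y, q (x + y) - q 0 - b (x + y) (x + y)
      = (q x - q 0 - b x x) + (q y - q 0 - b y y) := fun x y => by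
    have h1 : b (x + y) (x + y) = b x x + b y y + 2 * b x y := by
      rw [hadd, hsymm x, hsymm y, hadd, hadd, hsymm y x]; ring
    have h2 : b x y = (q (x + y) - q x - q y + q 0) / 2 := rfl
    rw [h1]; linarith
  set l : E3 →ₗ[ℝ] ℝ := (AddMonoidHom.toRealLinearMap (AddMonoidHom.mk'
    (fun x => q x - q 0 - b x x) hladd)
    (by simp only [hb, AddMonoidHom.mk'_apply]; fun_prop)).toLinearMap with hl
  refine ⟨l, B, fun x y => hsymm x y, fun x => ?_⟩
  have h1 : l x = q x - q 0 - b x x := rfl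
  rw [h1, hBb]; ring

end MeanValue

lemma nonpos_of_sq_le_affine {g A B : ℝ} (h : ∀ t : ℝ, 0 ≤ t → g * t ^ 2 ≤ A + B * t) : g ≤ 0 := by
  by_contra! hg
  have hA := abs_nonneg A
  have hB := abs_nonneg B
  set t := (|A| + |B|) / g + 1 with ht
  have ht1 : 1 ≤ t := by
    have : 0 ≤ (|A| + |B|) / g := by positivity
    linarith
  have h1 : g * t = |A| + |B| + g := by rw [ht]; field_simp
  have h2 : g * t ^ 2 = (|A| + |B| + g) * t := by rw [← h1]; ring
  have h3 := h t (by linarith)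
  have h4 : B * t ≤ |B| * t := by gcongr; exact le_abs_self B
  have h5 : |A| ≤ |A| * t := le_mul_of_one_le_right hA ht1
  have h6 : 0 < g * t := by positivity
  nlinarith [le_abs_self A]

/-- A quadratic polynomial growing at most logarithmically is a concave quadratic form about a
suitable centre. -/
theorem exists_center {p : E3 → ℝ} {p0 A α : ℝ} (l : E3 →ₗ[ℝ] ℝ) (B : E3 →ₗ[ℝ] E3 →ₗ[ℝ] ℝ)
    (hB : ∀ x y, B x y = B y x) (hα : 0 ≤ α) (hp : ∀ x, p x = p0 + l x - B x x)
    (hle : ∀ x, p x ≤ A + α * log (2 + ‖x‖)) :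
    (∀ x, 0 ≤ B x x) ∧ ∃ z₀, ∀ x, p (z₀ + x) = p z₀ - B x x := by
  have hpos : ∀ x, 0 ≤ B x x := fun x => by
    suffices -B x x ≤ 0 by linarith
    refine nonpos_of_sq_le_affine (A := A + α - p0) (B := α * ‖x‖ - l x) fun t ht => ?_
    have h1 := hle (t • x)
    rw [hp] at h1
    simp only [map_smul, smul_eq_mul, LinearMap.smul_apply, norm_smul, norm_of_nonneg ht] at h1
    have h2 : α * log (2 + t * ‖x‖) ≤ α * (1 + t * ‖x‖) := by
      gcongr
      linarith [log_le_sub_one_of_pos (show 0 < 2 + t * ‖x‖ by positivity)]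
    linarith
  have hker : ∀ x, B x x = 0 → l x ≤ 0 := fun x hx => by
    refine nonpos_of_sq_le_affine (A := A - p0 + 2 * α) (B := 2 * α * (1 + ‖x‖)) fun t ht => ?_
    have h1 := hle (t ^ 2 • x)
    rw [hp] at h1
    simp only [map_smul, smul_eq_mul, LinearMap.smul_apply, norm_smul, hx,
      norm_of_nonneg (sq_nonneg t)] at h1
    have h2 : log (2 + t ^ 2 * ‖x‖) ≤ 2 * (1 + t * (1 + ‖x‖)) := by
      calc log (2 + t ^ 2 * ‖x‖) ≤ log ((2 + t * (1 + ‖x‖)) ^ 2) := by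
            refine log_le_log (by positivity) ?_
            have := norm_nonneg x
            have h3 : 0 ≤ t * (1 + ‖x‖) := by positivity
            nlinarith [mul_nonneg (sq_nonneg t) this, mul_nonneg (sq_nonneg t) (sq_nonneg ‖x‖),
              sq_nonneg t]
        _ = 2 * log (2 + t * (1 + ‖x‖)) := by rw [log_pow]; norm_num
        _ ≤ _ := by
            linarith [log_le_sub_one_of_pos (show 0 < 2 + t * (1 + ‖x‖) by positivity)]
    have h4 := mul_le_mul_of_nonneg_left h2 hα
    linarith
  refine ⟨hpos, ?_⟩
  have hmem : l ∈ (LinearMap.ker B).dualAnnihilator := by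
    rw [Submodule.mem_dualAnnihilator]
    intro x hx
    have hx0 : B x = 0 := hx
    have h1 := hker x (by rw [hx0]; rfl)
    have h2 := hker (-x) (by simp [hx0])
    rw [map_neg] at h2
    linarith
  rw [← LinearMap.range_dualMap_eq_dualAnnihilator_ker] at hmem
  obtain ⟨φ, hφ⟩ := hmem
  obtain ⟨z, rfl⟩ := (Module.evalEquiv ℝ E3).surjective φ
  have hz : ∀ x, l x = B x z := fun x => by rw [← hφ]; rfl
  refine ⟨(1 / 2 : ℝ) • z, fun x => ?_⟩
  rw [hp, hp]
  simp only [map_add, map_smul, LinearMap.add_apply, LinearMap.smul_apply, smul_eq_mul, hz]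
  rw [hB z x]
  ring

/-- The logarithmic potential of a density. -/
noncomputable def logPot (m : E3 → ℝ) (x : E3) : ℝ := ∫ y, logKer x y * m y

/-- The Riesz potential of a density. -/
noncomputable def rieszPot (m : E3 → ℝ) (x : E3) : ℝ := ∫ y, (‖x - y‖ ^ 2)⁻¹ * m y

lemma ballKer_neg (z : E3) : ballKer (-z) = ballKer z := by
  rcases lt_or_ge ‖z‖ 1 with h | h
  · rw [ballKer_of_lt h, ballKer_of_lt (by simpa using h), norm_neg]
  · rw [ballKer_of_le h, ballKer_of_le (by simpa using h)]

lemma ballKer_sub_comm (x y : E3) : ballKer (x - y) = ballKer (y - x) := by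
  rw [← ballKer_neg, neg_sub]

lemma inv_sq_le_ballKer (z : E3) : (‖z‖ ^ 2)⁻¹ ≤ 1 + ballKer z := by
  rcases lt_or_ge ‖z‖ 1 with h | h
  · rw [ballKer_of_lt h]; linarith
  · rw [ballKer_of_le h, add_zero]
    exact inv_le_one_of_one_le₀ (one_le_pow₀ h)

section

variable {m : E3 → ℝ}

lemma neg_log_le_logPot (hm : Continuous m) (hmi : Integrable m) (hm0 : ∀ y, 0 ≤ m y) (x : E3) :
    -((∫ y, m y) * log (1 + ‖x‖)) ≤ logPot m x := by
  rw [← neg_mul, ← integral_neg, ← integral_mul_const]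
  refine integral_mono (by exact (hmi.neg.mul_const _)) (integrable_logKer_mul hm hmi x) fun y => ?_
  have := mul_le_mul_of_nonneg_right (neg_log_le_logKer x y) (hm0 y)
  simp only
  linarith

lemma continuous_logPot (hm : Continuous m) (hmi : Integrable m) : Continuous (logPot m) := by
  set F : E3 → E3 → ℝ := fun x y => log (1 + ‖y‖) - max (log ‖x - y‖) 0 with hF
  have hFb : ∀ x y, |F x y| ≤ log (2 + ‖x‖) := fun x y => by
    have h0 : 0 ≤ log (2 + ‖x‖) := log_nonneg (by linarith [norm_nonneg x])
    have h1 : 0 ≤ log (1 + ‖y‖) := log_nonneg (by linarith [norm_nonneg y])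
    have hxy : ‖x - y‖ ≤ ‖x‖ + ‖y‖ := norm_sub_le x y
    have hy : ‖y‖ ≤ ‖x‖ + ‖x - y‖ := by simpa using norm_sub_le x (x - y)
    rcases le_total ‖x - y‖ 1 with h | h
    · rw [hF]
      simp only [max_eq_right (log_nonpos (norm_nonneg _) h), sub_zero]
      rw [abs_of_nonneg h1]
      exact log_le_log (by positivity) (by linarith)
    · have hp : 0 < ‖x - y‖ := by linarith
      rw [hF]
      simp only [max_eq_left (log_nonneg h)]
      rw [abs_le, neg_le_sub_iff_le_add, sub_le_iff_le_add, ← log_mul (by positivity) (by positivity),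
        ← log_mul (by positivity) (by positivity)]
      constructor
      · refine log_le_log hp ?_
        nlinarith [norm_nonneg x, norm_nonneg y, mul_nonneg (norm_nonneg x) (norm_nonneg y)]
      · refine log_le_log (by positivity) (by nlinarith [norm_nonneg x])
  have hFm : ∀ x, Measurable (F x) := fun x => by rw [hF]; fun_prop
  have hFi : ∀ x, Integrable fun y => F x y * m y := fun x =>
    (hmi.norm.const_mul (log (2 + ‖x‖))).mono' ((hFm x).mul hm.measurable).aestronglyMeasurable
      (ae_of_all _ fun y => by
        rw [norm_mul]
        exact mul_le_mul_of_nonneg_right (hFb x y) (norm_nonneg _))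
  have hdec : logPot m = fun x => (∫ y, F x y * m y) + ∫ z, negLog z * m (x - z) := by
    funext x
    rw [← integral_sub_left_eq_self (fun z => negLog z * m (x - z)) volume x]
    simp only [sub_sub_cancel]
    rw [← integral_add (hFi x) (integrable_negLog_mul hm hmi x)]
    refine integral_congr_ae ?_
    have hne : ∀ᵐ y : E3, y ≠ x := by simp [ae_iff]
    filter_upwards [hne] with y hy
    rw [logKer_eq (Ne.symm hy), hF, negLog]
    simp only
    rw [← add_mul]
    congr 1
    rcases le_total (log ‖x - y‖) 0 with h | h
    · rw [max_eq_right h, max_eq_left (by linarith)]; ring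
    · rw [max_eq_left h, max_eq_right (by linarith)]; ring
  rw [hdec]
  refine Continuous.add ?_ ?_
  · refine continuous_iff_continuousAt.2 fun x₀ => ?_
    have hlc : ∀ᶠ x in nhds x₀, ‖x‖ < ‖x₀‖ + 1 :=
      (continuous_norm.tendsto x₀).eventually_lt_const (by linarith)
    refine continuousAt_of_dominated (bound := fun y => log (3 + ‖x₀‖) * ‖m y‖)
      (Eventually.of_forall fun x => (hFi x).aestronglyMeasurable) ?_ (hmi.norm.const_mul _) ?_
    · filter_upwards [hlc] with x hx
      refine ae_of_all _ fun y => ?_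
      rw [norm_mul]
      refine mul_le_mul_of_nonneg_right ((hFb x y).trans ?_) (norm_nonneg _)
      exact log_le_log (by positivity) (by linarith)
    · have hne : ∀ᵐ y : E3, y ≠ x₀ := by simp [ae_iff]
      filter_upwards [hne] with y hy
      have : ‖x₀ - y‖ ≠ 0 := norm_ne_zero_iff.2 (sub_ne_zero.2 (Ne.symm hy))
      have h2 : ContinuousAt (fun x => log ‖x - y‖) x₀ :=
        ContinuousAt.log (by fun_prop) this
      exact (continuousAt_const.sub (h2.max continuousAt_const)).mul continuousAt_const
  · refine continuous_iff_continuousAt.2 fun x₀ => ?_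
    obtain ⟨C, hC⟩ := (isCompact_closedBall x₀ 2).exists_bound_of_continuousOn hm.continuousOn
    have hlc : ∀ᶠ x in nhds x₀, x ∈ Metric.ball x₀ 1 := Metric.ball_mem_nhds _ one_pos
    refine continuousAt_of_dominated (bound := fun z => C * ballKer z)
      (Eventually.of_forall fun x => (measurable_negLog.mul
        (by fun_prop)).aestronglyMeasurable) ?_ (integrable_ballKer.const_mul _)
      (ae_of_all _ fun z => by fun_prop)
    filter_upwards [hlc] with x hx
    refine ae_of_all _ fun z => ?_
    rw [norm_mul, norm_of_nonneg (negLog_nonneg z), mul_comm]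
    rcases le_total 1 ‖z‖ with hz | hz
    · rw [negLog_of_le hz, ballKer_of_le hz]; simp
    · refine mul_le_mul (hC _ ?_) (negLog_le_ballKer z) (negLog_nonneg z)
        ((norm_nonneg _).trans (hC x₀ (by simp)))
      rw [mem_closedBall_iff_norm, sub_right_comm]
      rw [mem_ball_iff_norm] at hx
      linarith [norm_sub_le (x - x₀) z]

lemma integrable_prod_kernel (hmi : Integrable m) {K : E3 → E3 → ℝ}
    (hK : Measurable (Function.uncurry K)) {A : E3 → ℝ} (hA : Continuous A)
    (hKA : ∀ x y, |K x y| ≤ A x + ballKer (x - y)) {g : E3 → ℝ} (hg : Continuous g)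
    (hgc : HasCompactSupport g) :
    Integrable (fun z : E3 × E3 => K z.1 z.2 * m z.2 * g z.1) (volume.prod volume) := by
  obtain ⟨C, hC⟩ := hgc.exists_bound_of_continuous hg
  have h1 : Integrable (fun z : E3 × E3 => ‖A z.1 * g z.1‖ * ‖m z.2‖) (volume.prod volume) :=
    ((hA.mul hg).integrable_of_hasCompactSupport hgc.mul_left).norm.mul_prod hmi.norm
  have h2 : Integrable (fun z : E3 × E3 => ‖m z.2‖ * ballKer (z.1 - z.2)) (volume.prod volume) :=
    Integrable.convolution_integrand (ContinuousLinearMap.mul ℝ ℝ) hmi.norm integrable_ballKer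
  refine (h1.add (h2.const_mul C)).mono' ?_ (ae_of_all _ fun z => ?_)
  · exact ((hK.aestronglyMeasurable).mul hmi.aestronglyMeasurable.comp_snd).mul
      (hg.comp continuous_fst).aestronglyMeasurable
  · rw [norm_mul, norm_mul]
    have e := hKA z.1 z.2
    have e1 := hC z.1
    simp only [Pi.add_apply]
    rw [norm_mul (A z.1), norm_eq_abs (A z.1)]
    have e2 : ‖K z.1 z.2‖ ≤ |A z.1| + ballKer (z.1 - z.2) :=
      e.trans (by linarith [le_abs_self (A z.1)])
    calc ‖K z.1 z.2‖ * ‖m z.2‖ * ‖g z.1‖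
        ≤ (|A z.1| + ballKer (z.1 - z.2)) * ‖m z.2‖ * ‖g z.1‖ := by gcongr
      _ = |A z.1| * ‖g z.1‖ * ‖m z.2‖ + ‖g z.1‖ * (‖m z.2‖ * ballKer (z.1 - z.2)) := by ring
      _ ≤ _ := by
        gcongr
        exact mul_nonneg (norm_nonneg _) (ballKer_nonneg _)

end

/-- `log |x - y|` is a distributional potential of `|x - y|⁻²`. -/
lemma integral_log_mul_lap {η : E3 → ℝ} (hη : ContDiff ℝ 2 η) (hc : HasCompactSupport η) (y : E3) :
    ∫ x, log ‖x - y‖ * lap η x = ∫ x, (‖x - y‖ ^ 2)⁻¹ * η x := by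
  set f : ℝ → E3 → ℝ := fun e x => 1 / 2 * log (e ^ 2 + ‖x - y‖ ^ 2) with hf
  set g : ℝ → E3 → ℝ := fun e x =>
    (‖x - y‖ ^ 2 + 3 * e ^ 2) / (e ^ 2 + ‖x - y‖ ^ 2) ^ 2 with hg
  have hlap := continuous_lap hη
  have hlapc := hasCompactSupport_lap hc
  have hfe : ∀ e : ℝ, 0 < e → ∫ x, f e x * lap η x = ∫ x, g e x * η x := fun e he => by
    have hpos : ∀ x : E3, e ^ 2 + ‖x - y‖ ^ 2 ≠ 0 := fun x => by positivity
    have hfd : ContDiff ℝ 2 (f e) :=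
      contDiff_const.mul ((contDiff_const.add
        ((contDiff_id.sub contDiff_const).norm_sq ℝ)).log hpos)
    rw [integral_mul_lap hfd hη hc]
    refine integral_congr_ae (ae_of_all _ fun x => ?_)
    have h1 : ∀ t : ℝ, 0 ≤ t → HasDerivAt (fun t => 1 / 2 * log (e ^ 2 + t))
        (1 / 2 * (e ^ 2 + t)⁻¹) t := fun t ht => by
      have := (((hasDerivAt_id t).const_add (e ^ 2)).log (by simp; positivity)).const_mul (1 / 2)
      simpa using this
    have h2 : ∀ t : ℝ, 0 ≤ t → HasDerivAt (fun t => 1 / 2 * (e ^ 2 + t)⁻¹)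
        (1 / 2 * (-1 / (e ^ 2 + t) ^ 2)) t := fun t ht => by
      have := (((hasDerivAt_id t).const_add (e ^ 2)).fun_inv (by simp; positivity)).const_mul (1 / 2)
      simpa using this
    have h3 := lap_radial h1 h2 y x
    simp only [hf, hg, h3]
    congr 1
    field_simp
    ring
  have hIoo : ∀ᶠ e in nhdsWithin (0 : ℝ) (Set.Ioi 0), e ∈ Set.Ioo (0 : ℝ) 1 := Ioo_mem_nhdsGT one_pos
  have hne : ∀ᵐ x : E3, x ≠ y := ae_ne_point y
  have hb : ∀ {h : E3 → ℝ}, Continuous h → Integrable fun x => ballKer (x - y) * ‖h x‖ := fun hh => by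
    simp_rw [ballKer_sub_comm _ y]
    exact integrable_ballKer_mul hh.norm y
  have hlim1 : Tendsto (fun e => ∫ x, f e x * lap η x) (nhdsWithin 0 (Set.Ioi 0))
      (nhds (∫ x, log ‖x - y‖ * lap η x)) := by
    refine tendsto_integral_filter_of_dominated_convergence
      (fun x => 2 * ‖x - y‖ * ‖lap η x‖ + ballKer (x - y) * ‖lap η x‖) ?_ ?_ ?_ ?_
    · refine Eventually.of_forall fun e => ?_
      exact (Measurable.mul (by simp only [hf]; fun_prop) hlap.measurable).aestronglyMeasurable
    · filter_upwards [hIoo] with e he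
      filter_upwards [hne] with x hx
      have hr : 0 < ‖x - y‖ := norm_pos_iff.2 (sub_ne_zero.2 hx)
      rw [norm_mul, ← add_mul]
      refine mul_le_mul_of_nonneg_right ?_ (norm_nonneg _)
      have h1 : log ‖x - y‖ ≤ f e x := by
        have h2 : log ‖x - y‖ = 1 / 2 * log (‖x - y‖ ^ 2) := by rw [log_pow]; push_cast; ring
        rw [h2]
        simp only [hf]
        gcongr
        nlinarith [he.1]
      have h3 : f e x ≤ ‖x - y‖ := by
        have h4 : log (e ^ 2 + ‖x - y‖ ^ 2) ≤ log ((1 + ‖x - y‖) ^ 2) :=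
          log_le_log (by positivity) (by nlinarith [he.1, he.2])
        have h5 := log_le_sub_one_of_pos (show 0 < 1 + ‖x - y‖ by positivity)
        rw [log_pow] at h4
        push_cast at h4
        simp only [hf]
        linarith
      have h6 := abs_log_norm_le (x - y)
      have h7 := neg_abs_le (log ‖x - y‖)
      rw [norm_eq_abs, abs_le]
      constructor <;> linarith [ballKer_nonneg (x - y)]
    · refine Integrable.add ?_ (hb hlap)
      exact Continuous.integrable_of_hasCompactSupport (by fun_prop) hlapc.norm.mul_left
    · filter_upwards [hne] with x hx
      have hr : 0 < ‖x - y‖ := norm_pos_iff.2 (sub_ne_zero.2 hx)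
      refine Tendsto.mul_const _ ?_
      have : ContinuousAt (fun e : ℝ => f e x) 0 := by
        simp only [hf]
        refine continuousAt_const.mul (ContinuousAt.log (by fun_prop) (by positivity))
      have h2 : f 0 x = log ‖x - y‖ := by
        simp only [hf]
        rw [zero_pow two_ne_zero, zero_add, log_pow]
        push_cast; ring
      rw [← h2]
      exact this.tendsto.mono_left nhdsWithin_le_nhds
  have hlim2 : Tendsto (fun e => ∫ x, g e x * η x) (nhdsWithin 0 (Set.Ioi 0))
      (nhds (∫ x, (‖x - y‖ ^ 2)⁻¹ * η x)) := by
    refine tendsto_integral_filter_of_dominated_convergence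
      (fun x => 3 * ‖η x‖ + 3 * (ballKer (x - y) * ‖η x‖)) ?_ ?_ ?_ ?_
    · refine Eventually.of_forall fun e => ?_
      exact (Measurable.mul (by simp only [hg]; fun_prop)
        hη.continuous.measurable).aestronglyMeasurable
    · filter_upwards [hIoo] with e he
      filter_upwards [hne] with x hx
      have hr : 0 < ‖x - y‖ := norm_pos_iff.2 (sub_ne_zero.2 hx)
      rw [norm_mul, ← mul_assoc, ← add_mul]
      refine mul_le_mul_of_nonneg_right ?_ (norm_nonneg _)
      have h1 := inv_sq_le_ballKer (x - y)
      have h2 : g e x ≤ 3 * (‖x - y‖ ^ 2)⁻¹ := by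
        have he0 := he.1
        simp only [hg]
        rw [← div_eq_mul_inv, div_le_div_iff₀ (by positivity) (by positivity)]
        nlinarith [sq_nonneg (‖x - y‖), sq_nonneg e, mul_nonneg (sq_nonneg e) (sq_nonneg ‖x - y‖),
          sq_nonneg (e ^ 2), sq_nonneg (‖x - y‖ ^ 2)]
      rw [norm_of_nonneg (by positivity)]
      linarith
    · refine Integrable.add ?_ ((hb hη.continuous).const_mul 3)
      exact (hη.continuous.integrable_of_hasCompactSupport hc).norm.const_mul 3
    · filter_upwards [hne] with x hx
      have hr : 0 < ‖x - y‖ := norm_pos_iff.2 (sub_ne_zero.2 hx)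
      refine Tendsto.mul_const _ ?_
      have : ContinuousAt (fun e : ℝ => g e x) 0 := by
        simp only [hg]
        exact ContinuousAt.div (by fun_prop) (by fun_prop) (by positivity)
      have h2 : g 0 x = (‖x - y‖ ^ 2)⁻¹ := by
        simp only [hg]
        field_simp
        ring
      rw [← h2]
      exact this.tendsto.mono_left nhdsWithin_le_nhds
  refine tendsto_nhds_unique hlim1 (hlim2.congr' ?_)
  filter_upwards [self_mem_nhdsWithin] with e he using (hfe e he).symm

/-- The logarithmic potential is a distributional potential of the Riesz potential. -/
lemma integral_logPot_mul_lap {m : E3 → ℝ} (hmi : Integrable m)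
    {η : E3 → ℝ} (hη : ContDiff ℝ 2 η) (hc : HasCompactSupport η) :
    Integrable (fun x => rieszPot m x * η x) ∧
      ∫ x, logPot m x * lap η x = -∫ x, rieszPot m x * η x := by
  have hlap := continuous_lap hη
  have hlapc := hasCompactSupport_lap hc
  have hA : Continuous fun x : E3 => log (2 + ‖x‖) := by
    have : ∀ x : E3, 2 + ‖x‖ ≠ 0 := fun x => by positivity
    fun_prop (disch := assumption)
  have hi1 := integrable_prod_kernel hmi (K := logKer) (by unfold logKer; fun_prop) hA abs_logKer_le
    hlap hlapc
  have hi2 := integrable_prod_kernel hmi (K := fun x y => (‖x - y‖ ^ 2)⁻¹) (by fun_prop)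
    (A := fun _ => 1) continuous_const (fun x y => by
      rw [abs_of_nonneg (by positivity)]; exact inv_sq_le_ballKer _) hη.continuous hc
  have hne : ∀ y : E3, ∀ᵐ x : E3, x ≠ y := ae_ne_point
  have hl0 : ∫ x, lap η x = 0 := by
    have := integral_mul_lap (f := fun _ => 1) contDiff_const hη hc
    simpa [lap] using this
  have e1 : ∫ x, logPot m x * lap η x = ∫ x, ∫ y, logKer x y * m y * lap η x := by
    simp_rw [integral_mul_const]; rfl
  have e2 : ∫ x, rieszPot m x * η x = ∫ x, ∫ y, (‖x - y‖ ^ 2)⁻¹ * m y * η x := by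
    simp_rw [integral_mul_const]; rfl
  have hi3 := hi2.integral_prod_left
  simp only [integral_mul_const] at hi3
  refine ⟨hi3, ?_⟩
  have s1 : ∫ x, ∫ y, logKer x y * m y * lap η x = ∫ y, ∫ x, logKer x y * m y * lap η x :=
    integral_integral_swap hi1
  have s2 : ∫ x, ∫ y, (‖x - y‖ ^ 2)⁻¹ * m y * η x = ∫ y, ∫ x, (‖x - y‖ ^ 2)⁻¹ * m y * η x :=
    integral_integral_swap hi2
  rw [e1, e2, s1, s2, ← integral_neg]
  refine integral_congr_ae (ae_of_all _ fun y => ?_)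
  have hlogi : Integrable fun x => log ‖x - y‖ * lap η x := by
    have h1 : Integrable fun x => ballKer (x - y) * ‖lap η x‖ := by
      simp_rw [ballKer_sub_comm _ y]
      exact integrable_ballKer_mul hlap.norm y
    have h2 : Integrable fun x => ‖x - y‖ * ‖lap η x‖ :=
      Continuous.integrable_of_hasCompactSupport (by fun_prop) hlapc.norm.mul_left
    refine (h2.add h1).mono' (Measurable.mul (by fun_prop) hlap.measurable).aestronglyMeasurable
      (ae_of_all _ fun x => ?_)
    rw [norm_mul, Pi.add_apply, ← add_mul]
    exact mul_le_mul_of_nonneg_right (abs_log_norm_le _) (norm_nonneg _)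
  calc ∫ x, logKer x y * m y * lap η x
      = ∫ x, m y * (log (1 + ‖y‖) * lap η x - log ‖x - y‖ * lap η x) := by
        refine integral_congr_ae ?_
        filter_upwards [hne y] with x hx
        rw [logKer_eq hx]
        ring
    _ = m y * -∫ x, (‖x - y‖ ^ 2)⁻¹ * η x := by
        rw [integral_const_mul, integral_sub
          ((hlap.integrable_of_hasCompactSupport hlapc).const_mul _) hlogi, integral_const_mul, hl0,
          integral_log_mul_lap hη hc]
        ring
    _ = -∫ x, (‖x - y‖ ^ 2)⁻¹ * m y * η x := by
        rw [mul_neg, ← integral_const_mul]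
        congr 2
        ext x
        ring

section

variable {u : E3 → ℝ} {a : ℝ}

lemma weakHarmonic_of_lap_eq (hu : ContDiff ℝ 2 u) (hui : Integrable fun y => exp (3 * u y))
    (hw : ∀ x, -lap u x = a + 1 / π ^ 2 * rieszPot (fun y => exp (3 * u y)) x) :
    WeakHarmonic fun x => u x - 1 / π ^ 2 * logPot (fun y => exp (3 * u y)) x
      + a / 6 * ‖x‖ ^ 2 := by
  have huc := hu.continuous
  have hlc := continuous_logPot (m := fun y => exp (3 * u y)) (by fun_prop) hui
  refine ⟨by fun_prop, fun η hη hc => ?_⟩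
  have hlap := continuous_lap hη
  have hlapc := hasCompactSupport_lap hc
  have hint : ∀ {f : E3 → ℝ}, Continuous f → Integrable fun x => f x * lap η x := fun hf =>
    (hf.mul hlap).integrable_of_hasCompactSupport hlapc.mul_left
  have hint' : ∀ {f : E3 → ℝ}, Continuous f → Integrable fun x => f x * η x := fun hf =>
    (hf.mul hη.continuous).integrable_of_hasCompactSupport hc.mul_left
  obtain ⟨hR, hlog⟩ := integral_logPot_mul_lap hui hη hc
  have hsq : ∫ x, ‖x‖ ^ 2 * lap η x = ∫ x, 6 * η x := by
    rw [integral_mul_lap (contDiff_norm_sq ℝ) hη hc]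
    refine integral_congr_ae (ae_of_all _ fun x => ?_)
    have := lap_radial (h := fun t => t) (h' := fun _ => 1) (h'' := fun _ => 0)
      (fun t _ => hasDerivAt_id t) (fun t _ => hasDerivAt_const t 1) 0 x
    simp only [sub_zero] at this
    simp only [this]
    ring
  calc ∫ x, (u x - 1 / π ^ 2 * logPot (fun y => exp (3 * u y)) x + a / 6 * ‖x‖ ^ 2) * lap η x
      = ∫ x, (u x * lap η x - 1 / π ^ 2 * (logPot (fun y => exp (3 * u y)) x * lap η x)
          + a / 6 * (‖x‖ ^ 2 * lap η x)) := by congr 1; ext x; ring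
    _ = (∫ x, lap u x * η x) + 1 / π ^ 2 * (∫ x, rieszPot (fun y => exp (3 * u y)) x * η x)
          + a * ∫ x, η x := by
        rw [integral_add (by exact (hint huc).sub ((hint hlc).const_mul _))
          ((hint (by fun_prop)).const_mul _), integral_sub (hint huc) ((hint hlc).const_mul _),
          integral_const_mul, integral_const_mul, hsq, hlog, integral_mul_lap hu hη hc,
          integral_const_mul]
        ring
    _ = ∫ x, (lap u x * η x + 1 / π ^ 2 * (rieszPot (fun y => exp (3 * u y)) x * η x)
          + a * η x) := by
        have hη' : Integrable η := hη.continuous.integrable_of_hasCompactSupport hc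
        have h1 : Integrable fun x => lap u x * η x := hint' (continuous_lap hu)
        rw [integral_add (by exact h1.add (hR.const_mul _)) (hη'.const_mul _),
          integral_add h1 (hR.const_mul _), integral_const_mul, integral_const_mul]
    _ = 0 := by
        rw [← integral_zero E3 ℝ]
        congr 1
        ext x
        linear_combination (-η x) * hw x

lemma exists_integral_meanKer_le (huc : Continuous u) (hui : Integrable fun y => exp (3 * u y)) :
    ∃ A, 0 ≤ A ∧ ∀ x, ∫ z, (u (x + z) - 1 / π ^ 2 * logPot (fun y => exp (3 * u y)) (x + z))
        * meanKer z
      ≤ A + (1 / π ^ 2 * ∫ y, exp (3 * u y)) * log (2 + ‖x‖) * ∫ z, meanKer z := by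
  obtain ⟨S, hS, hkS⟩ := exists_meanKer_le
  set V := ∫ y, exp (3 * u y) with hV
  have hV0 : 0 ≤ V := integral_nonneg fun y => (exp_pos _).le
  have hlc := continuous_logPot (m := fun y => exp (3 * u y)) (by fun_prop) hui
  refine ⟨S * V, by positivity, fun x => ?_⟩
  have hshift : ∫ z, exp (3 * u (x + z)) = V :=
    integral_add_left_eq_self (fun y => exp (3 * u y)) x
  have hi : Integrable fun z => exp (3 * u (x + z)) :=
    hui.comp_add_left x
  calc _ ≤ ∫ z, (S * exp (3 * u (x + z)) + 1 / π ^ 2 * V * log (2 + ‖x‖) * meanKer z) := by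
        refine integral_mono (integrable_mul_meanKer (by fun_prop))
          ((hi.const_mul _).add (integrable_meanKer.const_mul _)) fun z => ?_
        have hk := meanKer_nonneg z
        rcases le_or_gt 1 ‖z‖ with hz | hz
        · simp only [meanKer_of_le hz, mul_zero, add_zero]
          positivity
        have h1 : u (x + z) ≤ exp (3 * u (x + z)) := by
          rcases le_or_gt 0 (u (x + z)) with h | h
          · linarith [add_one_le_exp (3 * u (x + z))]
          · exact h.le.trans (exp_pos _).le
        have h2 := neg_log_le_logPot (m := fun y => exp (3 * u y)) (by fun_prop) hui
          (fun y => (exp_pos _).le) (x + z)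
        have h3 : log (1 + ‖x + z‖) ≤ log (2 + ‖x‖) :=
          log_le_log (by positivity) (by linarith [norm_add_le x z])
        have h4 : -(1 / π ^ 2 * logPot (fun y => exp (3 * u y)) (x + z))
            ≤ 1 / π ^ 2 * V * log (2 + ‖x‖) := by
          rw [mul_assoc, ← mul_neg]
          refine mul_le_mul_of_nonneg_left ?_ (by positivity)
          have := mul_le_mul_of_nonneg_left h3 hV0
          linarith
        have h5 : exp (3 * u (x + z)) * meanKer z ≤ S * exp (3 * u (x + z)) := by
          rw [mul_comm]
          exact mul_le_mul_of_nonneg_right (hkS z) (exp_pos _).le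
        have h6 := mul_le_mul_of_nonneg_right (add_le_add h1 h4) hk
        simp only
        linarith
    _ = _ := by
        rw [integral_add (hi.const_mul _) (integrable_meanKer.const_mul _), integral_const_mul,
          integral_const_mul, hshift]

lemma integral_norm_add_sq_mul_meanKer (x : E3) :
    ∫ z, ‖x + z‖ ^ 2 * meanKer z = ‖x‖ ^ 2 * (∫ z, meanKer z) + ∫ z, ‖z‖ ^ 2 * meanKer z := by
  have h0 : ∫ z, inner ℝ x z * meanKer z = 0 := by
    have := integral_neg_eq_self (fun z : E3 => inner ℝ x z * meanKer z) volume
    simp only [meanKer_neg, inner_neg_right, neg_mul, integral_neg] at this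
    linarith
  calc ∫ z, ‖x + z‖ ^ 2 * meanKer z
      = ∫ z, (‖x‖ ^ 2 * meanKer z + 2 * (inner ℝ x z * meanKer z) + ‖z‖ ^ 2 * meanKer z) := by
        congr 1; ext z; rw [norm_add_sq_real]; ring
    _ = _ := by
        have h1 := integrable_meanKer.const_mul (‖x‖ ^ 2)
        have h2 : Integrable fun z => 2 * (inner ℝ x z * meanKer z) :=
          (integrable_mul_meanKer (by fun_prop)).const_mul 2
        rw [integral_add (by exact h1.add h2) (integrable_mul_meanKer (by fun_prop)),
          integral_add h1 h2, integral_const_mul, integral_const_mul, h0]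
        ring

/-- A solution of the integrated equation with volume at least `2π²` is spherical. -/
theorem isSpherical_of_lap_eq (hu : ContDiff ℝ 2 u) (hui : Integrable fun y => exp (3 * u y))
    (hw : ∀ x, -lap u x = a + 1 / π ^ 2 * rieszPot (fun y => exp (3 * u y)) x)
    (hV : 2 * π ^ 2 ≤ ∫ y, exp (3 * u y)) : IsSpherical u := by
  have huc := hu.continuous
  have hlc := continuous_logPot (m := fun y => exp (3 * u y)) (by fun_prop) hui
  have hq := (weakHarmonic_of_lap_eq hu hui hw).meanValue
  obtain ⟨A, hA0, hA⟩ := exists_integral_meanKer_le huc hui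
  set p : E3 → ℝ := fun x => u x - 1 / π ^ 2 * logPot (fun y => exp (3 * u y)) x with hp
  set K := ∫ z, meanKer z with hK
  have hK0 : 0 < K := integral_meanKer_pos
  set α := 1 / π ^ 2 * ∫ y, exp (3 * u y) with hα
  have hα0 : 0 ≤ α := by positivity
  have hpc : Continuous p := by fun_prop
  have hpmean : ∀ x, p x * K = (∫ z, p (x + z) * meanKer z) + a / 6 * ∫ z, ‖z‖ ^ 2 * meanKer z :=
    fun x => by
    have h1 := hq.mean x 1 one_pos
    have h2 : ∫ z, (p (x + z) + a / 6 * ‖x + z‖ ^ 2) * meanKer z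
        = (∫ z, p (x + z) * meanKer z) + a / 6 * ∫ z, ‖x + z‖ ^ 2 * meanKer z := by
      rw [← integral_const_mul, ← integral_add (integrable_mul_meanKer (by fun_prop))
        ((integrable_mul_meanKer (by fun_prop)).const_mul _)]
      congr 1; ext z; ring
    simp only [one_smul] at h1
    rw [h2, integral_norm_add_sq_mul_meanKer] at h1
    linarith
  have hm2 : |∫ z, ‖z‖ ^ 2 * meanKer z| ≤ K := by
    rw [abs_of_nonneg (integral_nonneg fun z => mul_nonneg (by positivity) (meanKer_nonneg z))]
    refine integral_mono (integrable_mul_meanKer (by fun_prop)) integrable_meanKer fun z => ?_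
    rcases le_or_gt 1 ‖z‖ with hz | hz
    · simp [meanKer_of_le hz]
    · exact mul_le_of_le_one_left (meanKer_nonneg z) (pow_le_one₀ (norm_nonneg z) hz.le)
  set A' := A / K + |a| / 6 with hA'
  have hpb : ∀ x, p x ≤ A' + α * log (2 + ‖x‖) := fun x => by
    have h1 : a / 6 * ∫ z, ‖z‖ ^ 2 * meanKer z ≤ |a| / 6 * K := by
      refine (le_abs_self _).trans ?_
      rw [abs_mul, abs_div, abs_of_pos (show (0 : ℝ) < 6 by norm_num)]
      gcongr
    have h2 := hpmean x
    have h3 := hA x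
    have h4 : A / K * K = A := by field_simp
    refine le_of_mul_le_mul_right ?_ hK0
    rw [hA']
    linarith
  have hqb : ∀ x, p x + a / 6 * ‖x‖ ^ 2 ≤ (A' + α + |a| / 6) * (1 + ‖x‖) ^ 2 := fun x => by
    have hn := norm_nonneg x
    have h1 := hpb x
    have h2 : log (2 + ‖x‖) ≤ (1 + ‖x‖) ^ 2 := by
      have := log_le_sub_one_of_pos (show 0 < 2 + ‖x‖ by positivity)
      nlinarith
    have h3 : 1 ≤ (1 + ‖x‖) ^ 2 := by nlinarith
    have h4 : a / 6 * ‖x‖ ^ 2 ≤ |a| / 6 * (1 + ‖x‖) ^ 2 := by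
      gcongr
      · exact le_abs_self a
      · linarith
    have h5 := mul_le_mul_of_nonneg_left h2 hα0
    have h6 := mul_le_mul_of_nonneg_left h3 (show 0 ≤ A' by positivity)
    linarith
  obtain ⟨C, hC⟩ := hq.abs_le_of_le (by positivity) hqb
  obtain ⟨l, B, hB, hqB⟩ := hq.quadratic hC
  set G : E3 →ₗ[ℝ] E3 →ₗ[ℝ] ℝ := (a / 6) • innerₗ E3 - B with hG
  have hGe : ∀ x y, G x y = a / 6 * inner ℝ x y - B x y := fun x y => by simp [hG]
  have hpG : ∀ x, p x = p 0 + l x - G x x := fun x => by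
    have := hqB x
    simp only [norm_zero] at this
    rw [hGe, real_inner_self_eq_norm_sq]
    simp only [hp]
    linarith
  obtain ⟨hG0, z₀, hz₀⟩ := exists_center l G
    (fun x y => by rw [hGe, hGe, hB, real_inner_comm]) hα0 hpG hpb
  have hrep : PotRep u p := ⟨huc, hui, fun x => by simp only [hp, logPot]; ring, ⟨p z₀, fun x => by
    have := hz₀ (x - z₀)
    rw [add_sub_cancel] at this
    linarith [hG0 (x - z₀)]⟩, hV⟩
  refine hrep.isSpherical (hu.differentiable two_ne_zero) (Q := fun x => G x x) hG0
    (fun t x => by simp; ring) hz₀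

end

lemma one_add_pow_mul_exp_neg_sq_le {s : ℝ} (hs : 0 < s) (m : ℕ) {r : ℝ} (hr : 0 ≤ r) :
    (1 + r) ^ m * exp (-(s * r ^ 2)) ≤ m.factorial * exp (1 + 1 / (4 * s)) := by
  have h1 : (1 + r) ^ m ≤ m.factorial * exp (1 + r) := by
    have := Real.pow_div_factorial_le_exp (1 + r) (by positivity) m
    rwa [div_le_iff₀ (by positivity), mul_comm] at this
  have h2 : 1 + r - s * r ^ 2 ≤ 1 + 1 / (4 * s) := by
    have h3 : 1 / (4 * s) - r + s * r ^ 2 = s * (r - 1 / (2 * s)) ^ 2 := by field_simp; ring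
    have : 0 ≤ s * (r - 1 / (2 * s)) ^ 2 := by positivity
    linarith
  calc (1 + r) ^ m * exp (-(s * r ^ 2)) ≤ m.factorial * exp (1 + r) * exp (-(s * r ^ 2)) := by gcongr
    _ = m.factorial * exp (1 + r - s * r ^ 2) := by rw [mul_assoc, ← exp_add]; ring_nf
    _ ≤ _ := by gcongr

/-- Gaussians are Schwartz functions. -/
noncomputable def gaussianSchwartz (s : ℝ) (hs : 0 < s) : SchwartzMap E3 ℝ where
  toFun x := exp (-(s * ‖x‖ ^ 2))
  smooth' := (contDiff_const.mul (contDiff_norm_sq ℝ)).neg.exp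
  decay' k n := by
    have hf : Function.HasTemperateGrowth fun x : E3 => -(s * ‖x‖ ^ 2) := by fun_prop
    obtain ⟨j, C, hC, hb⟩ := hf.norm_iteratedFDeriv_le_uniform n
    refine ⟨n.factorial * (max C 1) ^ n * ((k + j * n).factorial * exp (1 + 1 / (4 * s))),
      fun x => ?_⟩
    have hx := norm_nonneg x
    have h1 : ‖iteratedFDeriv ℝ n (exp ∘ fun x : E3 => -(s * ‖x‖ ^ 2)) x‖
        ≤ n.factorial * exp (-(s * ‖x‖ ^ 2)) * (max C 1 * (1 + ‖x‖) ^ j) ^ n := by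
      refine norm_iteratedFDeriv_comp_le (N := n) contDiff_exp (hf.1.of_le (by exact_mod_cast le_top))
        le_rfl x (fun i _ => ?_) fun i hi hin => ?_
      · rw [norm_iteratedFDeriv_eq_norm_iteratedDeriv, iteratedDeriv_eq_iterate, iter_deriv_exp,
          norm_of_nonneg (exp_pos _).le]
      · refine (hb i hin x).trans ?_
        have h2 : 1 ≤ max C 1 * (1 + ‖x‖) ^ j :=
          one_le_mul_of_one_le_of_one_le (le_max_right _ _) (one_le_pow₀ (by linarith))
        refine le_trans ?_ (le_self_pow₀ h2 (by omega))
        gcongr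
        exact le_max_left _ _
    calc ‖x‖ ^ k * ‖iteratedFDeriv ℝ n (exp ∘ fun x : E3 => -(s * ‖x‖ ^ 2)) x‖
        ≤ (1 + ‖x‖) ^ k * (n.factorial * exp (-(s * ‖x‖ ^ 2)) * (max C 1 * (1 + ‖x‖) ^ j) ^ n) := by
          gcongr
          linarith
      _ = n.factorial * (max C 1) ^ n * ((1 + ‖x‖) ^ (k + j * n) * exp (-(s * ‖x‖ ^ 2))) := by
          rw [mul_pow, pow_add, pow_mul]; ring
      _ ≤ _ := by
          exact mul_le_mul_of_nonneg_left (one_add_pow_mul_exp_neg_sq_le hs _ hx) (by positivity)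

/-- The Gaussian centred at `c` as a Schwartz function. -/
noncomputable def gaussianAt (s : ℝ) (hs : 0 < s) (c : E3) : SchwartzMap E3 ℝ :=
  (gaussianSchwartz s hs).compSubConstCLM ℝ c

lemma gaussianAt_apply (s : ℝ) (hs : 0 < s) (c x : E3) :
    gaussianAt s hs c x = exp (-(s * ‖x - c‖ ^ 2)) := rfl

lemma integrable_gaussian_sub {b : ℝ} (hb : 0 < b) (c : E3) :
    Integrable fun y : E3 => exp (-(b * ‖y - c‖ ^ 2)) :=
  (gaussianAt b hb c).integrable

lemma integral_gaussian_sub {b : ℝ} (hb : 0 < b) (c : E3) :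
    ∫ y : E3, exp (-(b * ‖y - c‖ ^ 2)) = √(π / b) ^ 3 := by
  rw [integral_sub_right_eq_self (fun y : E3 => exp (-(b * ‖y‖ ^ 2)))]
  have := GaussianFourier.integral_rexp_neg_mul_sq_norm (V := E3) hb
  simp only [neg_mul] at this
  rw [this, finrank_euclideanSpace_fin, sqrt_eq_rpow, ← rpow_natCast, ← rpow_mul (by positivity)]
  norm_num

lemma integrable_one_add_norm_pow_four : Integrable fun h : E3 => ((1 + ‖h‖) ^ 4)⁻¹ := by
  have := integrable_one_add_norm (E := E3) (μ := volume) (r := 4)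
    (by rw [finrank_euclideanSpace_fin]; norm_num)
  refine this.congr (ae_of_all _ fun x => ?_)
  simp only
  rw [rpow_neg (by positivity)]
  norm_cast

/-- The symmetric second difference of a Gaussian. -/
noncomputable def gaussDiff (s : ℝ) (z h : E3) : ℝ :=
  exp (-(s * ‖z‖ ^ 2)) - (exp (-(s * ‖z + h‖ ^ 2)) + exp (-(s * ‖z - h‖ ^ 2))) / 2

lemma continuous_gaussDiff (s : ℝ) (z : E3) : Continuous (gaussDiff s z) := by
  unfold gaussDiff
  fun_prop

section

variable {s : ℝ}

lemma abs_gaussDiff_le_one (hs : 0 < s) (z h : E3) : |gaussDiff s z h| ≤ 1 := by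
  have h1 : ∀ y : E3, exp (-(s * ‖y‖ ^ 2)) ≤ 1 := fun y => exp_le_one_iff.2 (by
    have : 0 ≤ s * ‖y‖ ^ 2 := by positivity
    linarith)
  have h2 := exp_pos (-(s * ‖z‖ ^ 2))
  have h3 := exp_pos (-(s * ‖z + h‖ ^ 2))
  have h4 := exp_pos (-(s * ‖z - h‖ ^ 2))
  rw [gaussDiff, abs_le]
  constructor <;> linarith [h1 z, h1 (z + h), h1 (z - h)]

lemma abs_gaussDiff_le_sq (hs : 0 < s) (z h : E3) (hh : ‖h‖ ≤ 1) :
    |gaussDiff s z h| ≤ (s + 2 * s ^ 2 * ‖z‖ ^ 2 * exp (2 * s ^ 2 * ‖z‖ ^ 2)) * ‖h‖ ^ 2 := by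
  set b := 2 * s * inner ℝ z h with hb
  set c := 2 * s ^ 2 * ‖z‖ ^ 2 with hc
  have hc0 : 0 ≤ c := by positivity
  have h1 : gaussDiff s z h = exp (-(s * ‖z‖ ^ 2)) * (1 - exp (-(s * ‖h‖ ^ 2)) * cosh b) := by
    rw [gaussDiff, norm_add_sq_real, norm_sub_sq_real, cosh_eq]
    have e1 : exp (-(s * (‖z‖ ^ 2 + 2 * inner ℝ z h + ‖h‖ ^ 2)))
        = exp (-(s * ‖z‖ ^ 2)) * exp (-(s * ‖h‖ ^ 2)) * exp (-b) := by
      rw [← exp_add, ← exp_add]; congr 1; rw [hb]; ring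
    have e2 : exp (-(s * (‖z‖ ^ 2 - 2 * inner ℝ z h + ‖h‖ ^ 2)))
        = exp (-(s * ‖z‖ ^ 2)) * exp (-(s * ‖h‖ ^ 2)) * exp b := by
      rw [← exp_add, ← exp_add]; congr 1; rw [hb]; ring
    rw [e1, e2]
    ring
  have h2 : cosh b ≤ 1 + c * exp c * ‖h‖ ^ 2 := by
    have hb2 : b ^ 2 / 2 ≤ c * ‖h‖ ^ 2 := by
      have := real_inner_mul_inner_self_le z h
      have h3 : (inner ℝ z h) ^ 2 ≤ ‖z‖ ^ 2 * ‖h‖ ^ 2 := by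
        rw [real_inner_self_eq_norm_sq, real_inner_self_eq_norm_sq] at this
        rw [sq]; exact this
      have := mul_le_mul_of_nonneg_left h3 (show 0 ≤ 2 * s ^ 2 by positivity)
      rw [hb, hc]
      linarith
    have hx : c * ‖h‖ ^ 2 ≤ c := mul_le_of_le_one_right hc0 (pow_le_one₀ (norm_nonneg h) hh)
    have h4 : exp (c * ‖h‖ ^ 2) ≤ 1 + c * ‖h‖ ^ 2 * exp (c * ‖h‖ ^ 2) := by
      have h5 := one_sub_le_exp_neg (c * ‖h‖ ^ 2)
      have h6 : exp (-(c * ‖h‖ ^ 2)) * exp (c * ‖h‖ ^ 2) = 1 := by rw [← exp_add]; simp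
      nlinarith [exp_pos (c * ‖h‖ ^ 2)]
    calc cosh b ≤ exp (b ^ 2 / 2) := cosh_le_exp_half_sq b
      _ ≤ exp (c * ‖h‖ ^ 2) := exp_le_exp.2 hb2
      _ ≤ 1 + c * ‖h‖ ^ 2 * exp (c * ‖h‖ ^ 2) := h4
      _ ≤ 1 + c * ‖h‖ ^ 2 * exp c := by gcongr
      _ = _ := by ring
  have h3 : exp (-(s * ‖h‖ ^ 2)) ≤ 1 := exp_le_one_iff.2 (by
    have : 0 ≤ s * ‖h‖ ^ 2 := by positivity
    linarith)
  have h4 := one_sub_le_exp_neg (s * ‖h‖ ^ 2)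
  have h5 := one_le_cosh b
  have h6 : exp (-(s * ‖z‖ ^ 2)) ≤ 1 := exp_le_one_iff.2 (by
    have : 0 ≤ s * ‖z‖ ^ 2 := by positivity
    linarith)
  have h7 := exp_pos (-(s * ‖h‖ ^ 2))
  have h8 : 0 ≤ c * exp c * ‖h‖ ^ 2 := by positivity
  have h9 : 0 ≤ s * ‖h‖ ^ 2 := by positivity
  rw [h1, abs_mul, abs_of_pos (exp_pos _)]
  refine (mul_le_of_le_one_left (abs_nonneg _) h6).trans ?_
  rw [abs_le]
  constructor <;> nlinarith

lemma integrable_gaussDiff_div (hs : 0 < s) (z : E3) :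
    Integrable fun h => gaussDiff s z h / ‖h‖ ^ 4 := by
  set C := s + 2 * s ^ 2 * ‖z‖ ^ 2 * exp (2 * s ^ 2 * ‖z‖ ^ 2) with hC
  have hC0 : 0 ≤ C := by positivity
  refine ((integrable_ballKer.const_mul C).add (integrable_one_add_norm_pow_four.const_mul 16)).mono'
    ((continuous_gaussDiff s z).measurable.div (by fun_prop)).aestronglyMeasurable
    (ae_of_all _ fun h => ?_)
  rw [norm_div, norm_eq_abs, norm_of_nonneg (by positivity : 0 ≤ ‖h‖ ^ 4), Pi.add_apply]
  have hn := norm_nonneg h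
  rcases lt_or_ge ‖h‖ 1 with h1 | h1
  · rw [ballKer_of_lt h1]
    rcases hn.eq_or_lt with h0 | h0
    · rw [← h0]; simp
    have h2 : |gaussDiff s z h| / ‖h‖ ^ 4 ≤ C * (‖h‖ ^ 2)⁻¹ := by
      rw [← div_eq_mul_inv, div_le_div_iff₀ (by positivity) (by positivity)]
      have := mul_le_mul_of_nonneg_right (abs_gaussDiff_le_sq hs z h h1.le)
        (show 0 ≤ ‖h‖ ^ 2 by positivity)
      rw [← hC] at this
      linarith
    have : 0 ≤ 16 * ((1 + ‖h‖) ^ 4)⁻¹ := by positivity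
    linarith
  · rw [ballKer_of_le h1, mul_zero, zero_add, ← div_eq_mul_inv,
      div_le_div_iff₀ (by positivity) (by positivity)]
    have h2 : (1 + ‖h‖) ^ 4 ≤ (2 * ‖h‖) ^ 4 := by gcongr; linarith
    have h3 := abs_gaussDiff_le_one hs z h
    have : |gaussDiff s z h| * (1 + ‖h‖) ^ 4 ≤ 1 * (2 * ‖h‖) ^ 4 := by gcongr
    linarith

lemma setIntegral_gaussian_eq (hs : 0 < s) (c x : E3) {e : ℝ} (he : 0 < e) :
    ∫ y in {y : E3 | e < ‖x - y‖}, (gaussianAt s hs c x - gaussianAt s hs c y) / ‖x - y‖ ^ 4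
      = ∫ h, {h : E3 | e < ‖h‖}.indicator (fun h => gaussDiff s (x - c) h / ‖h‖ ^ 4) h := by
  have hm : MeasurableSet {h : E3 | e < ‖h‖} := measurableSet_lt measurable_const measurable_norm
  have hm' : MeasurableSet {y : E3 | e < ‖x - y‖} :=
    measurableSet_lt measurable_const (by fun_prop)
  set F : E3 → ℝ := {h : E3 | e < ‖h‖}.indicator fun h =>
    (exp (-(s * ‖x - c‖ ^ 2)) - exp (-(s * ‖x - c - h‖ ^ 2))) / ‖h‖ ^ 4 with hF
  have hFi : Integrable F := by
    refine (integrable_one_add_norm_pow_four.const_mul ((1 + 1 / e) ^ 4)).mono'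
      (Measurable.indicator (by fun_prop) hm).aestronglyMeasurable (ae_of_all _ fun h => ?_)
    by_cases hh : e < ‖h‖
    · have h0 : 0 < ‖h‖ := he.trans hh
      rw [hF, Set.indicator_of_mem (show h ∈ {h : E3 | e < ‖h‖} from hh), norm_div,
        norm_of_nonneg (by positivity : 0 ≤ ‖h‖ ^ 4), ← div_eq_mul_inv,
        div_le_div_iff₀ (by positivity) (by positivity), ← mul_pow]
      have h1 : ∀ y : E3, exp (-(s * ‖y‖ ^ 2)) ≤ 1 := fun y => exp_le_one_iff.2 (by
        have : 0 ≤ s * ‖y‖ ^ 2 := by positivity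
        linarith)
      have h2 : ‖exp (-(s * ‖x - c‖ ^ 2)) - exp (-(s * ‖x - c - h‖ ^ 2))‖ ≤ 1 := by
        rw [norm_eq_abs, abs_le]
        constructor <;> linarith [h1 (x - c), h1 (x - c - h), exp_pos (-(s * ‖x - c‖ ^ 2)),
          exp_pos (-(s * ‖x - c - h‖ ^ 2))]
      have h3 : 1 + ‖h‖ ≤ (1 + 1 / e) * ‖h‖ := by
        have : 1 ≤ 1 / e * ‖h‖ := by
          rw [one_div, inv_mul_eq_div, le_div_iff₀ he]; linarith
        linarith
      calc _ ≤ 1 * (1 + ‖h‖) ^ 4 := by gcongr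
        _ ≤ _ := by rw [one_mul]; gcongr
    · rw [hF, Set.indicator_of_notMem (show h ∉ {h : E3 | e < ‖h‖} from hh), norm_zero]
      positivity
  have h1 : ∫ y in {y : E3 | e < ‖x - y‖},
      (gaussianAt s hs c x - gaussianAt s hs c y) / ‖x - y‖ ^ 4 = ∫ h, F h := by
    rw [← integral_indicator hm', ← integral_sub_left_eq_self F volume x]
    refine integral_congr_ae (ae_of_all _ fun y => ?_)
    simp only [hF, Set.indicator_apply, Set.mem_ofPred_eq, gaussianAt_apply]
    have : x - c - (x - y) = y - c := by abel
    rw [this]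
  have h2 : ∫ h, F (-h) = ∫ h, F h := integral_neg_eq_self F volume
  have h3 : ∫ h, (F h + F (-h)) / 2 = ∫ h, F h := by
    rw [integral_div, integral_add hFi hFi.comp_neg, h2]
    ring
  rw [h1, ← h3]
  refine integral_congr_ae (ae_of_all _ fun h => ?_)
  simp only [hF, Set.indicator_apply, Set.mem_ofPred_eq, norm_neg, sub_neg_eq_add]
  split_ifs
  · rw [gaussDiff]; ring
  · simp

lemma halfLap_gaussianAt_eq_integral (hs : 0 < s) (c x : E3) :
    halfLap (gaussianAt s hs c) x
      = 1 / π ^ 2 * ∫ h, gaussDiff s (x - c) h / ‖h‖ ^ 4 := by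
  refine Tendsto.limUnder_eq (Tendsto.const_mul _ ?_)
  have hi := integrable_gaussDiff_div hs (x - c)
  have : Tendsto (fun e : ℝ => ∫ h, {h : E3 | e < ‖h‖}.indicator
      (fun h => gaussDiff s (x - c) h / ‖h‖ ^ 4) h) (nhdsWithin 0 (Set.Ioi 0))
      (nhds (∫ h, gaussDiff s (x - c) h / ‖h‖ ^ 4)) := by
    refine tendsto_integral_filter_of_dominated_convergence _ ?_ ?_ hi.norm ?_
    · exact Eventually.of_forall fun e => hi.aestronglyMeasurable.indicator
        (measurableSet_lt measurable_const measurable_norm)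
    · exact Eventually.of_forall fun e => ae_of_all _ fun h => norm_indicator_le_norm_self _ _
    · refine ae_of_all _ fun h => ?_
      rcases (norm_nonneg h).eq_or_lt with h0 | h0
      · refine tendsto_const_nhds.congr fun e => ?_
        rw [Set.indicator_apply]
        split_ifs
        · rfl
        · rw [← h0]; simp
      · refine tendsto_const_nhds.congr' ?_
        filter_upwards [Ioo_mem_nhdsGT h0] with e he
        rw [Set.indicator_of_mem (show h ∈ {h : E3 | e < ‖h‖} from he.2)]
  refine this.congr' ?_
  filter_upwards [self_mem_nhdsWithin] with e he
  exact (setIntegral_gaussian_eq hs c x he).symm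

/-- The subordination integrand of the half Laplacian of the unit Gaussian at squared radius `A`. -/
noncomputable def gaussKer (A t : ℝ) : ℝ :=
  exp (-A) / √t - t / √(1 + t) ^ 3 * exp (-(t / (1 + t) * A))

/-- The half Laplacian of the unit Gaussian at squared radius `A`, up to the factor `√π`. -/
noncomputable def gaussProfile (A : ℝ) : ℝ := ∫ t in Set.Ioi (0 : ℝ), gaussKer A t

lemma integral_mul_exp_neg {c : ℝ} (hc : 0 < c) :
    IntegrableOn (fun t => t * exp (-(c * t))) (Set.Ioi 0) ∧
      ∫ t in Set.Ioi (0 : ℝ), t * exp (-(c * t)) = 1 / c ^ 2 := by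
  have h := Real.integral_rpow_mul_exp_neg_mul_Ioi two_pos hc
  have e : ∀ t : ℝ, t ^ ((2 : ℝ) - 1) * exp (-(c * t)) = t * exp (-(c * t)) := fun t => by
    norm_num
  simp_rw [e] at h
  have h2 : ∫ t in Set.Ioi (0 : ℝ), t * exp (-(c * t)) = 1 / c ^ 2 := by
    rw [h, Gamma_two]
    norm_num
  refine ⟨?_, h2⟩
  by_contra hn
  rw [integral_undef hn] at h2
  have : 0 < 1 / c ^ 2 := by positivity
  linarith

lemma integral_exp_mul_gaussDiff (hs : 0 < s) (z : E3) {t : ℝ} (ht : 0 < t) :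
    ∫ h, exp (-(s * t * ‖h‖ ^ 2)) * gaussDiff s z h
      = √(π / (s * t)) ^ 3 * exp (-(s * ‖z‖ ^ 2))
        - √(π / (s * (1 + t))) ^ 3 * exp (-(t / (1 + t) * (s * ‖z‖ ^ 2))) := by
  have key : ∀ z : E3, Integrable (fun h => exp (-(s * t * ‖h‖ ^ 2)) * exp (-(s * ‖z + h‖ ^ 2))) ∧
      ∫ h, exp (-(s * t * ‖h‖ ^ 2)) * exp (-(s * ‖z + h‖ ^ 2))
        = √(π / (s * (1 + t))) ^ 3 * exp (-(t / (1 + t) * (s * ‖z‖ ^ 2))) := fun z => by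
    have e : ∀ h : E3, exp (-(s * t * ‖h‖ ^ 2)) * exp (-(s * ‖z + h‖ ^ 2))
        = exp (-(s * (1 + t) * ‖h - (-(1 + t)⁻¹) • z‖ ^ 2))
          * exp (-(t / (1 + t) * (s * ‖z‖ ^ 2))) := fun h => by
      rw [← exp_add, ← exp_add, norm_add_sq_real, norm_sub_sq_real, inner_smul_right, norm_smul,
        real_inner_comm z h, mul_pow, norm_eq_abs, sq_abs]
      congr 1
      field_simp
      ring
    simp_rw [e]
    have hst : 0 < s * (1 + t) := by positivity
    exact ⟨(integrable_gaussian_sub hst _).mul_const _, by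
      rw [integral_mul_const, integral_gaussian_sub hst]⟩
  have hst : 0 < s * t := by positivity
  have h0i := integrable_gaussian_sub hst 0
  have h0 := integral_gaussian_sub hst 0
  simp only [sub_zero] at h0i h0
  have k1 := key z
  have k2 := key (-z)
  have e2 : ∀ h : E3, ‖-z + h‖ = ‖z - h‖ := fun h => by rw [← norm_neg]; congr 1; abel
  simp only [e2, norm_neg] at k2
  have e : ∀ h : E3, exp (-(s * t * ‖h‖ ^ 2)) * gaussDiff s z h
      = exp (-(s * t * ‖h‖ ^ 2)) * exp (-(s * ‖z‖ ^ 2))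
        - (exp (-(s * t * ‖h‖ ^ 2)) * exp (-(s * ‖z + h‖ ^ 2))
          + exp (-(s * t * ‖h‖ ^ 2)) * exp (-(s * ‖z - h‖ ^ 2))) / 2 := fun h => by
    rw [gaussDiff]; ring
  simp_rw [e]
  rw [integral_sub (h0i.mul_const _) (by exact (k1.1.add k2.1).div_const 2), integral_mul_const,
    h0, integral_div, integral_add k1.1 k2.1, k1.2, k2.2]
  ring

/-- The half Laplacian of a Gaussian. -/
theorem halfLap_gaussianAt (hs : 0 < s) (c x : E3) :
    halfLap (gaussianAt s hs c) x = √s / √π * gaussProfile (s * ‖x - c‖ ^ 2) := by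
  set z := x - c with hz
  rw [halfLap_gaussianAt_eq_integral]
  set F : E3 → ℝ → ℝ := fun h t => s ^ 2 * t * exp (-(s * t * ‖h‖ ^ 2)) * gaussDiff s z h with hF
  have hne : ∀ᵐ h : E3, h ≠ 0 := ae_ne_point 0
  have hexp : ∀ h : E3, h ≠ 0 →
      IntegrableOn (fun t => s ^ 2 * t * exp (-(s * t * ‖h‖ ^ 2))) (Set.Ioi 0) ∧
      ∫ t in Set.Ioi (0 : ℝ), s ^ 2 * t * exp (-(s * t * ‖h‖ ^ 2)) = 1 / ‖h‖ ^ 4 := fun h hh => by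
    have hn : 0 < ‖h‖ := norm_pos_iff.2 hh
    obtain ⟨i1, i2⟩ := integral_mul_exp_neg (show 0 < s * ‖h‖ ^ 2 by positivity)
    have e : ∀ t, s ^ 2 * t * exp (-(s * t * ‖h‖ ^ 2))
        = s ^ 2 * (t * exp (-(s * ‖h‖ ^ 2 * t))) := fun t => by
      rw [show s * t * ‖h‖ ^ 2 = s * ‖h‖ ^ 2 * t by ring]; ring
    simp_rw [e]
    refine ⟨i1.const_mul _, ?_⟩
    rw [integral_const_mul, i2]
    field_simp
  have hD := integrable_gaussDiff_div hs z
  have hFm : Measurable (Function.uncurry F) := by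
    have := (continuous_gaussDiff s z).measurable
    simp only [hF, Function.uncurry_def]
    fun_prop
  have hFi : Integrable (Function.uncurry F)
      (volume.prod (volume.restrict (Set.Ioi (0 : ℝ)))) := by
    refine (integrable_prod_iff hFm.aestronglyMeasurable).2 ⟨?_, ?_⟩
    · filter_upwards [hne] with h hh
      exact (hexp h hh).1.mul_const (gaussDiff s z h)
    · refine hD.norm.congr ?_
      filter_upwards [hne] with h hh
      have e : ∀ t ∈ Set.Ioi (0 : ℝ), ‖Function.uncurry F (h, t)‖
          = s ^ 2 * t * exp (-(s * t * ‖h‖ ^ 2)) * |gaussDiff s z h| := fun t ht => by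
        have ht : 0 < t := ht
        simp only [Function.uncurry, hF]
        rw [norm_mul, norm_of_nonneg (by positivity), norm_eq_abs]
      rw [setIntegral_congr_fun measurableSet_Ioi e, integral_mul_const, (hexp h hh).2, norm_div,
        norm_eq_abs, norm_of_nonneg (by positivity)]
      ring
  have h1 : ∫ h, gaussDiff s z h / ‖h‖ ^ 4 = ∫ h, ∫ t in Set.Ioi (0 : ℝ), F h t := by
    refine integral_congr_ae ?_
    filter_upwards [hne] with h hh
    simp only [hF]
    rw [integral_mul_const, (hexp h hh).2]
    ring
  rw [h1, integral_integral_swap hFi, ← integral_const_mul, gaussProfile, ← integral_const_mul]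
  refine setIntegral_congr_fun measurableSet_Ioi fun t ht => ?_
  have ht : 0 < t := ht
  have h2 : ∫ h, F h t = s ^ 2 * t * ∫ h, exp (-(s * t * ‖h‖ ^ 2)) * gaussDiff s z h := by
    rw [← integral_const_mul]
    congr 1; ext h
    simp only [hF]; ring
  rw [h2, integral_exp_mul_gaussDiff hs z ht, gaussKer, sqrt_div pi_pos.le, sqrt_div pi_pos.le,
    sqrt_mul hs.le, sqrt_mul hs.le]
  have a1 : √s ≠ 0 := (sqrt_pos.2 hs).ne'
  have a2 : √π ≠ 0 := (sqrt_pos.2 pi_pos).ne'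
  have a3 : √t ≠ 0 := (sqrt_pos.2 ht).ne'
  have a4 : √(1 + t) ≠ 0 := (sqrt_pos.2 (by linarith)).ne'
  have b1 : √s ^ 2 = s := sq_sqrt hs.le
  have b2 : √π ^ 2 = π := sq_sqrt pi_pos.le
  have b3 : √t ^ 2 = t := sq_sqrt ht.le
  set σ := √s
  set p := √π
  set τ := √t
  set v := √(1 + t)
  set E1 := exp (-(s * ‖z‖ ^ 2))
  set E2 := exp (-(t / (1 + t) * (s * ‖z‖ ^ 2)))
  rw [← b1, ← b2, ← b3]
  field_simp

end

lemma gaussKer_bounds {t : ℝ} (ht : 0 < t) :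
    0 ≤ t / √(1 + t) ^ 3 ∧ t / √(1 + t) ^ 3 ≤ 1 / √t ∧
      1 / √t - t / √(1 + t) ^ 3 ≤ 2 * (√t * (1 + t))⁻¹ := by
  have hτ : 0 < √t := sqrt_pos.2 ht
  have hv : 0 < √(1 + t) := sqrt_pos.2 (by linarith)
  have b3 : √t ^ 2 = t := sq_sqrt ht.le
  have b4 : √(1 + t) ^ 2 = 1 + t := sq_sqrt (by linarith)
  have hle : √t ≤ √(1 + t) := sqrt_le_sqrt (by linarith)
  set τ := √t
  set v := √(1 + t)
  refine ⟨by positivity, ?_, ?_⟩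
  · rw [div_le_div_iff₀ (by positivity) hτ, one_mul, ← b3, ← pow_succ]
    gcongr
  · rw [← b4, ← b3, div_sub_div _ _ hτ.ne' (by positivity), ← div_eq_mul_inv,
      div_le_div_iff₀ (by positivity) (by positivity)]
    have h1 : v ^ 2 = 1 + τ ^ 2 := by rw [b4, b3]
    have h2 : τ ^ 4 ≤ τ ^ 3 * v := by
      have := mul_le_mul_of_nonneg_left hle (show 0 ≤ τ ^ 3 by positivity)
      linarith
    have h3 : v ^ 4 - τ ^ 4 ≤ 2 * v ^ 2 := by
      rw [show v ^ 4 = (v ^ 2) ^ 2 by ring, h1]; nlinarith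
    have h4 : v * (v ^ 3 - τ ^ 3) ≤ 2 * v ^ 2 := by linarith
    have h5 := mul_le_mul_of_nonneg_left h4 (show 0 ≤ τ * v by positivity)
    linarith

lemma gaussKer_eq (A t : ℝ) :
    gaussKer A t = exp (-A) * (1 / √t - t / √(1 + t) ^ 3)
      - t / √(1 + t) ^ 3 * (exp (-(t / (1 + t) * A)) - exp (-A)) := by
  rw [gaussKer]; ring

lemma exp_sub_exp_bounds {A t : ℝ} (hA : 0 ≤ A) (ht : 0 < t) :
    0 ≤ exp (-(t / (1 + t) * A)) - exp (-A) ∧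
      exp (-(t / (1 + t) * A)) - exp (-A) ≤ exp (-(t / (1 + t) * A)) * (A / (1 + t)) := by
  have e : exp (-A) = exp (-(t / (1 + t) * A)) * exp (-(A / (1 + t))) := by
    rw [← exp_add]; congr 1; field_simp; ring
  have h1 := one_sub_le_exp_neg (A / (1 + t))
  have h2 : exp (-(A / (1 + t))) ≤ 1 := exp_le_one_iff.2 (by
    have : 0 ≤ A / (1 + t) := by positivity
    linarith)
  have h3 := exp_pos (-(t / (1 + t) * A))
  rw [e]
  constructor <;> nlinarith

lemma abs_gaussKer_le_of_le {A t E : ℝ} (hA : 0 ≤ A) (ht : 0 < t)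
    (hE : exp (-(t / (1 + t) * A)) ≤ E) :
    |gaussKer A t| ≤ (2 + A) * E * (√t * (1 + t))⁻¹ := by
  obtain ⟨h1, h2, h3⟩ := gaussKer_bounds ht
  obtain ⟨h4, h5⟩ := exp_sub_exp_bounds hA ht
  have hτ : 0 < √t := sqrt_pos.2 ht
  have hE' : exp (-A) ≤ E := by linarith
  have hE0 : 0 ≤ E := (exp_pos _).le.trans hE
  have k1 : exp (-A) * (1 / √t - t / √(1 + t) ^ 3) ≤ E * (2 * (√t * (1 + t))⁻¹) :=
    mul_le_mul hE' h3 (by linarith) hE0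
  have k2 : t / √(1 + t) ^ 3 * (exp (-(t / (1 + t) * A)) - exp (-A))
      ≤ 1 / √t * (E * (A / (1 + t))) :=
    mul_le_mul h2 (h5.trans (by gcongr)) h4 (by positivity)
  have k3 : 1 / √t * (E * (A / (1 + t))) = E * A * (√t * (1 + t))⁻¹ := by field_simp
  have k4 : 0 ≤ exp (-A) * (1 / √t - t / √(1 + t) ^ 3) :=
    mul_nonneg (exp_pos _).le (by linarith)
  have k5 := mul_nonneg h1 h4
  rw [k3] at k2
  rw [gaussKer_eq, abs_le]
  have k6 : 0 ≤ E * A * (√t * (1 + t))⁻¹ := by positivity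
  have k7 : 0 ≤ E * (√t * (1 + t))⁻¹ := by positivity
  constructor <;> nlinarith

lemma abs_gaussKer_le {A t : ℝ} (hA : 0 ≤ A) (ht : 0 < t) :
    |gaussKer A t| ≤ (2 + A) * (√t * (1 + t))⁻¹ := by
  have := abs_gaussKer_le_of_le (E := 1) hA ht (exp_le_one_iff.2 (by
    have : 0 ≤ t / (1 + t) * A := by positivity
    linarith))
  linarith

lemma abs_gaussKer_le' {A t : ℝ} (hA : 0 ≤ A) (ht : 0 < t) :
    |gaussKer A t| ≤ (2 + A) * exp (-(A / 2)) * (√t * (1 + t))⁻¹ + t * exp (-(A / 2 * t)) := by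
  have hτ : 0 < √t := sqrt_pos.2 ht
  rcases le_or_gt 1 t with h1 | h1
  · have h2 : A / 2 ≤ t / (1 + t) * A := by
      have : 1 / 2 ≤ t / (1 + t) := by rw [div_le_div_iff₀ two_pos (by positivity)]; linarith
      nlinarith
    have := abs_gaussKer_le_of_le hA ht (exp_le_exp.2 (neg_le_neg h2))
    have : 0 ≤ t * exp (-(A / 2 * t)) := by positivity
    linarith
  · have h2 : A / 2 * t ≤ t / (1 + t) * A := by
      have : t / 2 ≤ t / (1 + t) := by gcongr; linarith
      nlinarith
    have h3 : t / √(1 + t) ^ 3 ≤ t :=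
      div_le_self ht.le (one_le_pow₀ (one_le_sqrt.2 (by linarith)))
    have h4 : t / √(1 + t) ^ 3 * exp (-(t / (1 + t) * A)) ≤ t * exp (-(A / 2 * t)) := by
      gcongr
    have h5 : exp (-A) / √t ≤ (2 + A) * exp (-(A / 2)) * (√t * (1 + t))⁻¹ := by
      rw [← div_eq_mul_inv, div_le_div_iff₀ hτ (by positivity)]
      have h6 : exp (-A) ≤ exp (-(A / 2)) := exp_le_exp.2 (by linarith)
      have h7 : exp (-A) * (1 + t) ≤ exp (-(A / 2)) * (2 + A) := by
        exact mul_le_mul h6 (by linarith) (by positivity) (exp_pos _).le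
      have := mul_le_mul_of_nonneg_left h7 hτ.le
      linarith
    have h8 : 0 ≤ exp (-A) / √t := by positivity
    have h9 : 0 ≤ t / √(1 + t) ^ 3 * exp (-(t / (1 + t) * A)) := by positivity
    rw [gaussKer, abs_le]
    constructor <;> linarith

lemma integrableOn_inv_sqrt_mul_one_add :
    IntegrableOn (fun t : ℝ => (√t * (1 + t))⁻¹) (Set.Ioi 0) := by
  refine integrableOn_Ioi_deriv_of_nonneg (g := fun t => 2 * arctan √t) (l := 2 * (π / 2))
    (by fun_prop) (fun t ht => ?_) (fun t ht => ?_) ?_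
  · have ht : 0 < t := ht
    have := ((hasDerivAt_sqrt ht.ne').arctan).const_mul 2
    refine this.congr_deriv ?_
    rw [sq_sqrt ht.le]
    have : 0 < √t := sqrt_pos.2 ht
    field_simp
  · have ht : 0 < t := ht
    positivity
  · exact ((tendsto_arctan_atTop.mono_right nhdsWithin_le_nhds).comp tendsto_sqrt_atTop).const_mul 2

lemma measurable_gaussKer : Measurable (Function.uncurry gaussKer) := by
  simp only [Function.uncurry_def, gaussKer]
  fun_prop

lemma integrableOn_gaussKer {A : ℝ} (hA : 0 ≤ A) : IntegrableOn (gaussKer A) (Set.Ioi 0) := by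
  refine (integrableOn_inv_sqrt_mul_one_add.const_mul (2 + A)).mono'
    (measurable_gaussKer.of_uncurry_left (x := A)).aestronglyMeasurable ?_
  exact (ae_restrict_mem measurableSet_Ioi).mono fun t ht => abs_gaussKer_le hA ht

lemma exists_abs_gaussProfile_le :
    ∃ C, 0 < C ∧ ∀ A, 0 ≤ A → |gaussProfile A| ≤ C / (1 + A ^ 2) := by
  set L := ∫ t in Set.Ioi (0 : ℝ), (√t * (1 + t))⁻¹ with hL
  have hL0 : 0 ≤ L := setIntegral_nonneg measurableSet_Ioi fun t ht => by
    have ht : 0 < t := ht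
    positivity
  refine ⟨256 * L + 8, by positivity, fun A hA => ?_⟩
  rw [le_div_iff₀ (by positivity)]
  rcases le_or_gt A 1 with h1 | h1
  · have h2 : |gaussProfile A| ≤ (2 + A) * L := by
      rw [gaussProfile, hL, ← integral_const_mul]
      refine abs_integral_le_integral_abs.trans ?_
      exact setIntegral_mono_on (integrableOn_gaussKer hA).norm
        (integrableOn_inv_sqrt_mul_one_add.const_mul _) measurableSet_Ioi
        fun t ht => abs_gaussKer_le hA ht
    have h3 : 1 + A ^ 2 ≤ 2 := by nlinarith
    have h4 : |gaussProfile A| ≤ 3 * L := h2.trans (by gcongr; linarith)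
    calc |gaussProfile A| * (1 + A ^ 2) ≤ 3 * L * 2 := by gcongr
      _ ≤ _ := by linarith
  · obtain ⟨i1, i2⟩ := integral_mul_exp_neg (show 0 < A / 2 by linarith)
    have h2 : |gaussProfile A| ≤ (2 + A) * exp (-(A / 2)) * L + 1 / (A / 2) ^ 2 := by
      rw [gaussProfile, hL, ← i2, ← integral_const_mul,
        ← integral_add (integrableOn_inv_sqrt_mul_one_add.const_mul _) i1]
      refine abs_integral_le_integral_abs.trans ?_
      exact setIntegral_mono_on (integrableOn_gaussKer hA).norm
        ((integrableOn_inv_sqrt_mul_one_add.const_mul _).add i1) measurableSet_Ioi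
        fun t ht => abs_gaussKer_le' hA ht
    have h3 : (2 + A) * exp (-(A / 2)) * A ^ 2 ≤ 128 := by
      have e1 := add_one_le_exp (A / 4)
      have e2 := Real.pow_div_factorial_le_exp (A / 4) (by positivity) 2
      norm_num at e2
      have e3 : exp (A / 4) * exp (A / 4) * exp (-(A / 2)) = 1 := by
        rw [← exp_add, ← exp_add]; ring_nf; simp
      have e4 : 2 + A ≤ 4 * exp (A / 4) := by linarith
      have e5 : A ^ 2 ≤ 32 * exp (A / 4) := by nlinarith
      calc (2 + A) * exp (-(A / 2)) * A ^ 2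
          ≤ 4 * exp (A / 4) * exp (-(A / 2)) * (32 * exp (A / 4)) := by gcongr
        _ = 128 * (exp (A / 4) * exp (A / 4) * exp (-(A / 2))) := by ring
        _ = 128 := by rw [e3, mul_one]
    have h4 : |gaussProfile A| * A ^ 2 ≤ 128 * L + 4 := by
      calc |gaussProfile A| * A ^ 2
          ≤ ((2 + A) * exp (-(A / 2)) * L + 1 / (A / 2) ^ 2) * A ^ 2 := by gcongr
        _ = (2 + A) * exp (-(A / 2)) * A ^ 2 * L + 4 := by field_simp; ring
        _ ≤ _ := by gcongr
    have h5 : |gaussProfile A| ≤ |gaussProfile A| * A ^ 2 :=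
      le_mul_of_one_le_right (abs_nonneg _) (one_le_pow₀ h1.le)
    linarith

lemma integral_sqrt_mul_exp_neg {c : ℝ} (hc : 0 < c) :
    IntegrableOn (fun s => √s * exp (-(c * s))) (Set.Ioi 0) ∧
      ∫ s in Set.Ioi (0 : ℝ), √s * exp (-(c * s)) = √π / 2 / √c ^ 3 := by
  have key : ∫ s in Set.Ioi (0 : ℝ), √s * exp (-(c * s)) = √π / 2 / √c ^ 3 := by
    have h := integral_rpow_mul_exp_neg_mul_Ioi (a := 3 / 2) (by norm_num) hc
    rw [show (3 / 2 - 1 : ℝ) = 1 / 2 by norm_num] at h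
    simp_rw [← sqrt_eq_rpow] at h
    rw [h, show (3 / 2 : ℝ) = 1 / 2 + 1 by norm_num, Gamma_add_one (by norm_num), Gamma_one_half_eq,
      rpow_add (by positivity), rpow_one, ← sqrt_eq_rpow, sqrt_div zero_le_one, sqrt_one]
    have h1 : √c ^ 2 = c := sq_sqrt hc.le
    have h2 : 0 < √c := sqrt_pos.2 hc
    rw [pow_succ, h1]
    field_simp
  refine ⟨.of_integral_ne_zero ?_, key⟩
  rw [key]
  have : 0 < √c := sqrt_pos.2 hc
  positivity

lemma integral_sqrt_sub_div {ε A : ℝ} (hε : 0 < ε) (hA : 0 ≤ A) :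
    ∫ t in Set.Ioi (0 : ℝ), (1 / (√t * √(ε ^ 2 + A) ^ 3) - t / √(ε ^ 2 + t * (ε ^ 2 + A)) ^ 3)
      = 4 * ε / (ε ^ 2 + A) ^ 2 := by
  set B := ε ^ 2 + A with hB
  have hB0 : 0 < B := by positivity
  set g : ℝ → ℝ := fun t => 2 / B ^ 2 * (√t * √B - √(ε ^ 2 + t * B) - ε ^ 2 / √(ε ^ 2 + t * B))
    with hg
  have hy : ∀ t, 0 ≤ t → 0 < ε ^ 2 + t * B := fun t ht => by positivity
  have hlim : Tendsto g atTop (nhds 0) := by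
    have h1 : Tendsto (fun t : ℝ => 4 * ε ^ 2 / B ^ 2 * (√(ε ^ 2 + t * B))⁻¹) atTop (nhds 0) := by
      rw [← mul_zero (4 * ε ^ 2 / B ^ 2)]
      refine (tendsto_inv_atTop_zero.comp (tendsto_sqrt_atTop.comp ?_)).const_mul _
      exact tendsto_atTop_add_const_left _ _ (tendsto_id.atTop_mul_const hB0)
    refine squeeze_zero_norm' ?_ h1
    filter_upwards [eventually_ge_atTop 0] with t ht
    have hs : 0 < √(ε ^ 2 + t * B) := sqrt_pos.2 (hy t ht)
    have hle : √t * √B ≤ √(ε ^ 2 + t * B) := by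
      rw [← sqrt_mul ht]; exact sqrt_le_sqrt (by nlinarith)
    have e1 : √(ε ^ 2 + t * B) ^ 2 = ε ^ 2 + t * B := sq_sqrt (hy t ht).le
    have e2 : (√t * √B) ^ 2 = t * B := by rw [mul_pow, sq_sqrt ht, sq_sqrt hB0.le]
    have hn : 0 ≤ √t * √B := by positivity
    set y := √(ε ^ 2 + t * B)
    set x := √t * √B
    have h2 : y - x ≤ ε ^ 2 / y := by
      rw [le_div_iff₀ hs]; nlinarith
    rw [norm_eq_abs, hg]
    simp only
    rw [abs_mul, abs_of_pos (show 0 < 2 / B ^ 2 by positivity)]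
    have h3 : |x - y - ε ^ 2 / y| ≤ 2 * (ε ^ 2 / y) := by
      have : 0 ≤ ε ^ 2 / y := by positivity
      rw [abs_le]; constructor <;> linarith
    calc _ ≤ 2 / B ^ 2 * (2 * (ε ^ 2 / y)) := by gcongr
      _ = _ := by field_simp; ring
  have hcont : ContinuousWithinAt g (Set.Ici 0) 0 := by
    have : ∀ t : ℝ, 0 ≤ t → √(ε ^ 2 + t * B) ≠ 0 := fun t ht => (sqrt_pos.2 (hy t ht)).ne'
    refine ContinuousAt.continuousWithinAt ?_
    refine continuousAt_const.mul (ContinuousAt.sub (by fun_prop) ?_)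
    exact continuousAt_const.div (by fun_prop) (this 0 le_rfl)
  have hder : ∀ t ∈ Set.Ioi (0 : ℝ), HasDerivAt g
      (1 / (√t * √B ^ 3) - t / √(ε ^ 2 + t * B) ^ 3) t := by
    intro t ht
    have ht : 0 < t := ht
    have hs : 0 < √(ε ^ 2 + t * B) := sqrt_pos.2 (hy t ht.le)
    have hτ : 0 < √t := sqrt_pos.2 ht
    have hβ : 0 < √B := sqrt_pos.2 hB0
    have d1 := (hasDerivAt_sqrt ht.ne').mul_const (√B)
    have d2 : HasDerivAt (fun t => √(ε ^ 2 + t * B)) (B / (2 * √(ε ^ 2 + t * B))) t :=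
      ((((hasDerivAt_id t).mul_const B).const_add (ε ^ 2)).sqrt (hy t ht.le).ne').congr_deriv
        (by simp)
    have d3 := (d2.inv hs.ne').const_mul (ε ^ 2)
    have d := ((d1.sub d2).sub d3).const_mul (2 / B ^ 2)
    refine d.congr_deriv ?_
    have e1 : √(ε ^ 2 + t * B) ^ 2 = ε ^ 2 + t * B := sq_sqrt (hy t ht.le).le
    have e2 : √B ^ 2 = B := sq_sqrt hB0.le
    set y := √(ε ^ 2 + t * B)
    set β := √B
    have e3 : ε ^ 2 = y ^ 2 - t * β ^ 2 := by rw [e1, e2]; ring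
    rw [e3, ← e2]
    field_simp
    ring
  have hpos : ∀ t ∈ Set.Ioi (0 : ℝ), 0 ≤ 1 / (√t * √B ^ 3) - t / √(ε ^ 2 + t * B) ^ 3 := by
    intro t ht
    have ht : 0 < t := ht
    have hτ : 0 < √t := sqrt_pos.2 ht
    have hβ : 0 < √B := sqrt_pos.2 hB0
    have hle : √t * √B ≤ √(ε ^ 2 + t * B) := by
      rw [← sqrt_mul ht.le]; exact sqrt_le_sqrt (by nlinarith)
    have : t / √(ε ^ 2 + t * B) ^ 3 ≤ t / (√t * √B) ^ 3 := by gcongr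
    have e : t / (√t * √B) ^ 3 = 1 / (√t * √B ^ 3) := by
      nth_rw 1 [← sq_sqrt ht.le]
      field_simp
    linarith
  rw [integral_Ioi_of_hasDerivAt_of_nonneg hcont hder hpos hlim, hg]
  simp only [zero_mul, add_zero, sqrt_zero, sqrt_sq hε.le]
  field_simp
  ring

lemma integral_exp_mul_gaussKer {ε A t : ℝ} (hε : 0 < ε) (hA : 0 ≤ A) (ht : 0 < t) :
    ∫ s in Set.Ioi (0 : ℝ), exp (-(s * ε ^ 2)) * √s * gaussKer (s * A) t
      = √π / 2 * (1 / (√t * √(ε ^ 2 + A) ^ 3) - t / √(ε ^ 2 + t * (ε ^ 2 + A)) ^ 3) := by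
  have hc : 0 < (ε ^ 2 + t * (ε ^ 2 + A)) / (1 + t) := by positivity
  obtain ⟨i1, e1⟩ := integral_sqrt_mul_exp_neg (show 0 < ε ^ 2 + A by positivity)
  obtain ⟨i2, e2⟩ := integral_sqrt_mul_exp_neg hc
  have h : ∀ s, exp (-(s * ε ^ 2)) * √s * gaussKer (s * A) t
      = 1 / √t * (√s * exp (-((ε ^ 2 + A) * s))) - t / √(1 + t) ^ 3 *
        (√s * exp (-((ε ^ 2 + t * (ε ^ 2 + A)) / (1 + t) * s))) := by
    intro s
    have a1 : exp (-((ε ^ 2 + A) * s)) = exp (-(s * ε ^ 2)) * exp (-(s * A)) := by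
      rw [← exp_add]; ring_nf
    have a2 : exp (-((ε ^ 2 + t * (ε ^ 2 + A)) / (1 + t) * s))
        = exp (-(s * ε ^ 2)) * exp (-(t / (1 + t) * (s * A))) := by
      rw [← exp_add]; congr 1; field_simp; ring
    rw [a1, a2, gaussKer]
    ring
  simp_rw [h]
  rw [integral_sub (i1.const_mul _) (i2.const_mul _), integral_const_mul, integral_const_mul, e1, e2,
    sqrt_div (by positivity)]
  have : 0 < √(1 + t) := sqrt_pos.2 (by linarith)
  have : 0 < √(ε ^ 2 + A) := sqrt_pos.2 (by positivity)
  have : 0 < √(ε ^ 2 + t * (ε ^ 2 + A)) := sqrt_pos.2 (by positivity)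
  field_simp

lemma integrable_exp_mul_gaussKer {ε A : ℝ} (hε : 0 < ε) (hA : 0 ≤ A) :
    Integrable (Function.uncurry fun s t => exp (-(s * ε ^ 2)) * √s * gaussKer (s * A) t)
      ((volume.restrict (Set.Ioi 0)).prod (volume.restrict (Set.Ioi 0))) := by
  obtain ⟨i1, -⟩ := integral_sqrt_mul_exp_neg (show 0 < ε ^ 2 / 2 by positivity)
  have hi := (i1.const_mul (2 + 2 * A / ε ^ 2)).mul_prod integrableOn_inv_sqrt_mul_one_add
  refine hi.mono' ?_ ?_
  · refine Measurable.aestronglyMeasurable ?_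
    have := measurable_gaussKer.comp
      (show Measurable fun p : ℝ × ℝ => (p.1 * A, p.2) by fun_prop)
    exact Measurable.mul (by fun_prop) this
  · rw [Measure.prod_restrict]
    filter_upwards [ae_restrict_mem (measurableSet_Ioi.prod measurableSet_Ioi)] with p hp
    have hs : 0 < p.1 := hp.1
    have ht : 0 < p.2 := hp.2
    have h1 := abs_gaussKer_le (A := p.1 * A) (by positivity) ht
    simp only [Function.uncurry_def]
    rw [norm_mul, norm_mul, norm_eq_abs, norm_eq_abs, norm_eq_abs, abs_exp, abs_of_nonneg (sqrt_nonneg _)]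
    have h2 : exp (-(p.1 * ε ^ 2)) = exp (-(ε ^ 2 / 2 * p.1)) * exp (-(ε ^ 2 / 2 * p.1)) := by
      rw [← exp_add]; ring_nf
    have h3 : exp (-(ε ^ 2 / 2 * p.1)) * (2 + p.1 * A) ≤ 2 + 2 * A / ε ^ 2 := by
      have a1 := add_one_le_exp (ε ^ 2 / 2 * p.1)
      rw [exp_neg, inv_mul_le_iff₀ (exp_pos _)]
      have a2 : (ε ^ 2 / 2 * p.1 + 1) * (2 + 2 * A / ε ^ 2) ≤
        exp (ε ^ 2 / 2 * p.1) * (2 + 2 * A / ε ^ 2) := by gcongr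
      refine le_trans ?_ a2
      have : (ε ^ 2 / 2 * p.1 + 1) * (2 + 2 * A / ε ^ 2)
        = ε ^ 2 * p.1 + 2 + 2 * A / ε ^ 2 + p.1 * A := by field_simp; ring
      rw [this]
      have : 0 ≤ ε ^ 2 * p.1 := by positivity
      have : 0 ≤ 2 * A / ε ^ 2 := by positivity
      linarith
    calc exp (-(p.1 * ε ^ 2)) * √p.1 * |gaussKer (p.1 * A) p.2|
        ≤ exp (-(p.1 * ε ^ 2)) * √p.1 * ((2 + p.1 * A) * (√p.2 * (1 + p.2))⁻¹) := by gcongr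
      _ = (exp (-(ε ^ 2 / 2 * p.1)) * (2 + p.1 * A)) * (√p.1 * exp (-(ε ^ 2 / 2 * p.1))) *
          (√p.2 * (1 + p.2))⁻¹ := by rw [h2]; ring
      _ ≤ _ := by gcongr

lemma integral_exp_mul_gaussProfile {ε A : ℝ} (hε : 0 < ε) (hA : 0 ≤ A) :
    IntegrableOn (fun s => exp (-(s * ε ^ 2)) * √s * gaussProfile (s * A)) (Set.Ioi 0) ∧
      ∫ s in Set.Ioi (0 : ℝ), exp (-(s * ε ^ 2)) * √s * gaussProfile (s * A)
        = 2 * √π * ε / (ε ^ 2 + A) ^ 2 := by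
  have h := integrable_exp_mul_gaussKer hε hA
  constructor
  · have := h.integral_prod_left
    simp only [Function.uncurry_def, integral_const_mul] at this
    exact this
  · have s1 : ∫ s in Set.Ioi (0 : ℝ), ∫ t in Set.Ioi (0 : ℝ),
        exp (-(s * ε ^ 2)) * √s * gaussKer (s * A) t = ∫ t in Set.Ioi (0 : ℝ),
        ∫ s in Set.Ioi (0 : ℝ), exp (-(s * ε ^ 2)) * √s * gaussKer (s * A) t :=
      integral_integral_swap h
    simp only [integral_const_mul] at s1
    simp only [gaussProfile]
    rw [s1, setIntegral_congr_fun measurableSet_Ioi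
      (fun t ht => integral_exp_mul_gaussKer hε hA ht), integral_const_mul,
      integral_sqrt_sub_div hε hA]
    ring

lemma one_add_norm_pow_four_le (x y : E3) :
    1 + ‖y‖ ^ 4 ≤ 8 * (1 + ‖x‖ ^ 4) * (1 + ‖y - x‖ ^ 4) := by
  have h1 : ‖y‖ ≤ ‖x‖ + ‖y - x‖ := by
    simpa using norm_add_le x (y - x)
  have h2 : ‖y‖ ^ 4 ≤ (‖x‖ + ‖y - x‖) ^ 4 := by gcongr
  have h3 : (‖x‖ + ‖y - x‖) ^ 4 ≤ 8 * (‖x‖ ^ 4 + ‖y - x‖ ^ 4) := by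
    have := add_pow_le (norm_nonneg x) (norm_nonneg (y - x)) 4
    norm_num at this
    linarith
  have h4 : 0 ≤ ‖x‖ ^ 4 * ‖y - x‖ ^ 4 := by positivity
  linarith

lemma integrable_div_one_add_norm_sub {w : E3 → ℝ} (hw : Continuous w)
    (hi : Integrable fun y => |w y| / (1 + ‖y‖ ^ 4)) (x : E3) :
    Integrable fun y => |w y| / (1 + ‖y - x‖ ^ 4) := by
  refine (hi.const_mul (8 * (1 + ‖x‖ ^ 4))).mono' ?_ (ae_of_all _ fun y => ?_)
  · exact (hw.abs.div (by fun_prop) fun y => by positivity).aestronglyMeasurable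
  · have := one_add_norm_pow_four_le x y
    rw [norm_of_nonneg (by positivity), ← mul_div_assoc, div_le_div_iff₀ (by positivity) (by positivity)]
    nlinarith [mul_le_mul_of_nonneg_left this (abs_nonneg (w y))]

lemma measurable_gaussProfile : Measurable gaussProfile :=
  measurable_gaussKer.stronglyMeasurable.integral_prod_right.measurable

lemma integrableOn_rpow_exp {c : ℝ} (hc : 0 < c) :
    IntegrableOn (fun s => (√s)⁻¹ * exp (-(c * s))) (Set.Ioi 0) := by
  have h := integral_rpow_mul_exp_neg_mul_Ioi (a := 1 / 2) (by norm_num) hc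
  have h2 : IntegrableOn (fun s : ℝ => s ^ ((1 / 2 : ℝ) - 1) * exp (-(c * s))) (Set.Ioi 0) := by
    refine .of_integral_ne_zero ?_
    rw [h, Gamma_one_half_eq]
    positivity
  refine h2.congr_fun (fun s hs => ?_) measurableSet_Ioi
  have hs : 0 < s := hs
  simp only
  rw [show (1 / 2 : ℝ) - 1 = -(1 / 2) by norm_num, rpow_neg hs.le, ← sqrt_eq_rpow]

/-- The weight used to superpose Gaussians. -/
noncomputable def gaussWeight (ε T s : ℝ) : ℝ := exp (-(s * ε ^ 2)) - exp (-(s * T ^ 2))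

lemma gaussWeight_bounds {ε T s : ℝ} (hT : ε ^ 2 ≤ T ^ 2) (hs : 0 ≤ s) :
    0 ≤ gaussWeight ε T s ∧ gaussWeight ε T s ≤ exp (-(s * ε ^ 2)) ∧
      gaussWeight ε T s ≤ T ^ 2 * s * exp (-(s * ε ^ 2)) := by
  have h1 := exp_pos (-(s * T ^ 2))
  have h2 : exp (-(s * T ^ 2)) ≤ exp (-(s * ε ^ 2)) := exp_le_exp.2 (by nlinarith)
  have h3 : exp (-(s * T ^ 2)) = exp (-(s * ε ^ 2)) * exp (-(s * (T ^ 2 - ε ^ 2))) := by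
    rw [← exp_add]; ring_nf
  have h4 := one_sub_le_exp_neg (s * (T ^ 2 - ε ^ 2))
  have h5 : 1 - s * T ^ 2 ≤ exp (-(s * (T ^ 2 - ε ^ 2))) := by nlinarith [sq_nonneg ε]
  have h6 := mul_le_mul_of_nonneg_left h5 (exp_pos (-(s * ε ^ 2))).le
  simp only [gaussWeight]
  refine ⟨by linarith, by linarith, ?_⟩
  rw [h3]
  linarith

lemma measurable_gaussWeight (ε T : ℝ) : Measurable (gaussWeight ε T) := by
  unfold gaussWeight; fun_prop

lemma integrableOn_gaussWeight_mul {ε T : ℝ} (hε : 0 < ε) (hT : ε ^ 2 ≤ T ^ 2) :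
    IntegrableOn (fun s => gaussWeight ε T s * √s * (1 + (s ^ 2)⁻¹)) (Set.Ioi 0) := by
  have i1 := (integral_sqrt_mul_exp_neg (show 0 < ε ^ 2 by positivity)).1
  have i2 := (integrableOn_rpow_exp (show 0 < ε ^ 2 by positivity)).const_mul (T ^ 2)
  refine (i1.add i2).mono' ?_ ?_
  · exact (((measurable_gaussWeight ε T).mul (by fun_prop)).mul (by fun_prop)).aestronglyMeasurable
  · refine (ae_restrict_mem measurableSet_Ioi).mono fun s hs => ?_
    have hs : 0 < s := hs
    obtain ⟨h1, h2, h3⟩ := gaussWeight_bounds hT hs.le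
    have hq : 0 < √s := sqrt_pos.2 hs
    rw [norm_of_nonneg (by positivity), Pi.add_apply]
    have e : exp (-(ε ^ 2 * s)) = exp (-(s * ε ^ 2)) := by ring_nf
    rw [e]
    have a1 : gaussWeight ε T s * √s ≤ √s * exp (-(s * ε ^ 2)) := by
      rw [mul_comm]; gcongr
    have a2 : gaussWeight ε T s * (√s * (s ^ 2)⁻¹)
      ≤ T ^ 2 * s * exp (-(s * ε ^ 2)) * (√s * (s ^ 2)⁻¹) := by gcongr
    have a3 : T ^ 2 * s * exp (-(s * ε ^ 2)) * (√s * (s ^ 2)⁻¹)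
        = T ^ 2 * ((√s)⁻¹ * exp (-(s * ε ^ 2))) := by
      have : √s ^ 2 = s := sq_sqrt hs.le
      field_simp
      rw [this]
    linarith

lemma integral_gaussWeight_mul_gaussProfile {ε T A : ℝ} (hε : 0 < ε) (hT : 0 < T) (hA : 0 ≤ A) :
    ∫ s in Set.Ioi (0 : ℝ), gaussWeight ε T s * (√s / √π * gaussProfile (s * A))
      = 2 * (ε / (ε ^ 2 + A) ^ 2 - T / (T ^ 2 + A) ^ 2) := by
  obtain ⟨i1, e1⟩ := integral_exp_mul_gaussProfile hε hA
  obtain ⟨i2, e2⟩ := integral_exp_mul_gaussProfile hT hA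
  have h : ∀ s, gaussWeight ε T s * (√s / √π * gaussProfile (s * A))
      = (√π)⁻¹ * (exp (-(s * ε ^ 2)) * √s * gaussProfile (s * A)
        - exp (-(s * T ^ 2)) * √s * gaussProfile (s * A)) := by
    intro s; rw [gaussWeight]; ring
  simp_rw [h]
  rw [integral_const_mul, integral_sub i1 i2, e1, e2]
  have : 0 < √π := sqrt_pos.2 pi_pos
  field_simp

lemma integrableOn_gaussWeight {ε T : ℝ} (hε : 0 < ε) (hT : ε ^ 2 ≤ T ^ 2) :
    IntegrableOn (gaussWeight ε T) (Set.Ioi 0) := by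
  refine (exp_neg_integrableOn_Ioi 0 (show 0 < ε ^ 2 by positivity)).mono'
    (measurable_gaussWeight ε T).aestronglyMeasurable ?_
  refine (ae_restrict_mem measurableSet_Ioi).mono fun s hs => ?_
  obtain ⟨h1, h2, -⟩ := gaussWeight_bounds hT (le_of_lt hs)
  rw [norm_of_nonneg h1, show -ε ^ 2 * s = -(s * ε ^ 2) by ring]
  exact h2

lemma integral_exp_neg_mul {b : ℝ} (hb : 0 < b) :
    IntegrableOn (fun s => exp (-(b * s))) (Set.Ioi 0) ∧
      ∫ s in Set.Ioi (0 : ℝ), exp (-(b * s)) = 1 / b := by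
  have h1 := exp_neg_integrableOn_Ioi 0 hb
  have h2 := integral_exp_mul_Ioi (a := -b) (by linarith) 0
  simp only [neg_mul] at h1 h2
  refine ⟨h1, ?_⟩
  rw [h2]
  simp

lemma integral_gaussWeight_mul_exp {ε T A : ℝ} (hε : 0 < ε) (hT : 0 < T) (hA : 0 ≤ A) :
    ∫ s in Set.Ioi (0 : ℝ), gaussWeight ε T s * exp (-(s * A))
      = 1 / (ε ^ 2 + A) - 1 / (T ^ 2 + A) := by
  obtain ⟨i1, e1⟩ := integral_exp_neg_mul (show 0 < ε ^ 2 + A by positivity)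
  obtain ⟨i2, e2⟩ := integral_exp_neg_mul (show 0 < T ^ 2 + A by positivity)
  have h : ∀ s, gaussWeight ε T s * exp (-(s * A))
      = exp (-((ε ^ 2 + A) * s)) - exp (-((T ^ 2 + A) * s)) := by
    intro s; rw [gaussWeight, sub_mul, ← exp_add, ← exp_add]; ring_nf
  simp_rw [h]
  rw [integral_sub i1 i2, e1, e2]

section

variable {w ρ : E3 → ℝ} {ε T : ℝ}

lemma integrable_prod_gaussProfile (hw : Continuous w)
    (hi : Integrable fun y => |w y| / (1 + ‖y‖ ^ 4)) (x : E3) (hε : 0 < ε) (hT : ε ^ 2 ≤ T ^ 2) :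
    Integrable (Function.uncurry fun (s : ℝ) (y : E3) =>
      gaussWeight ε T s * (w y * (√s / √π * gaussProfile (s * ‖y - x‖ ^ 2))))
      ((volume.restrict (Set.Ioi 0)).prod volume) := by
  obtain ⟨C, hC, hb⟩ := exists_abs_gaussProfile_le
  have hI := ((integrableOn_gaussWeight_mul hε hT).const_mul (C / √π)).mul_prod
    (integrable_div_one_add_norm_sub hw hi x)
  refine hI.mono' ?_ ?_
  · refine Measurable.aestronglyMeasurable ?_
    have h1 := measurable_gaussProfile.comp
      (show Measurable fun p : ℝ × E3 => p.1 * ‖p.2 - x‖ ^ 2 by fun_prop)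
    have h2 := (measurable_gaussWeight ε T).comp (show Measurable fun p : ℝ × E3 => p.1 by fun_prop)
    have h3 := hw.measurable.comp (show Measurable fun p : ℝ × E3 => p.2 by fun_prop)
    exact h2.mul (h3.mul (Measurable.mul (by fun_prop) h1))
  · have hmem : ∀ᵐ p : ℝ × E3 ∂((volume.restrict (Set.Ioi 0)).prod volume), 0 < p.1 :=
      Measure.quasiMeasurePreserving_fst.ae (ae_restrict_mem measurableSet_Ioi)
    filter_upwards [hmem] with p hs
    obtain ⟨h1, -, -⟩ := gaussWeight_bounds hT hs.le
    have h2 := hb (p.1 * ‖p.2 - x‖ ^ 2) (by positivity)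
    simp only [Function.uncurry_def, norm_mul, norm_eq_abs]
    rw [abs_of_nonneg h1, abs_of_nonneg (show 0 ≤ √p.1 / √π by positivity)]
    have h3 : C / (1 + (p.1 * ‖p.2 - x‖ ^ 2) ^ 2) ≤ C * (1 + (p.1 ^ 2)⁻¹) / (1 + ‖p.2 - x‖ ^ 4) := by
      rw [div_le_div_iff₀ (by positivity) (by positivity), mul_assoc]
      gcongr
      have : (1 + (p.1 ^ 2)⁻¹) * (1 + (p.1 * ‖p.2 - x‖ ^ 2) ^ 2)
        = 1 + ‖p.2 - x‖ ^ 4 + (p.1 ^ 2)⁻¹ + p.1 ^ 2 * ‖p.2 - x‖ ^ 4 := by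
        field_simp; ring
      rw [this]
      have : 0 ≤ (p.1 ^ 2)⁻¹ + p.1 ^ 2 * ‖p.2 - x‖ ^ 4 := by positivity
      linarith
    calc _ ≤ gaussWeight ε T p.1 * (|w p.2| * (√p.1 / √π *
          (C * (1 + (p.1 ^ 2)⁻¹) / (1 + ‖p.2 - x‖ ^ 4)))) := by
          gcongr; exact h2.trans h3
      _ = _ := by ring

lemma integrable_prod_gaussWeight (hρ : Continuous ρ) (hi : Integrable ρ) (x : E3)
    (hε : 0 < ε) (hT : ε ^ 2 ≤ T ^ 2) :
    Integrable (Function.uncurry fun (s : ℝ) (y : E3) =>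
      gaussWeight ε T s * (ρ y * exp (-(s * ‖y - x‖ ^ 2))))
      ((volume.restrict (Set.Ioi 0)).prod volume) := by
  refine ((integrableOn_gaussWeight hε hT).mul_prod hi).mono ?_ ?_
  · refine Measurable.aestronglyMeasurable ?_
    have h2 := (measurable_gaussWeight ε T).comp (show Measurable fun p : ℝ × E3 => p.1 by fun_prop)
    have h3 := hρ.measurable.comp (show Measurable fun p : ℝ × E3 => p.2 by fun_prop)
    exact h2.mul (h3.mul (by fun_prop))
  · have hmem : ∀ᵐ p : ℝ × E3 ∂((volume.restrict (Set.Ioi 0)).prod volume), 0 < p.1 :=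
      Measure.quasiMeasurePreserving_fst.ae (ae_restrict_mem measurableSet_Ioi)
    filter_upwards [hmem] with p hs
    simp only [Function.uncurry_def, norm_mul, norm_eq_abs, abs_exp]
    have : exp (-(p.1 * ‖p.2 - x‖ ^ 2)) ≤ 1 := exp_le_one_iff.2 (by
      have : 0 ≤ p.1 * ‖p.2 - x‖ ^ 2 := by positivity
      linarith)
    gcongr
    exact mul_le_of_le_one_right (abs_nonneg _) this

/-- Superposing the equation tested against Gaussians. -/
lemma integral_poisson_sub_eq (hw : Continuous w)
    (hwi : Integrable fun y => |w y| / (1 + ‖y‖ ^ 4)) (hρ : Continuous ρ) (hi : Integrable ρ)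
    (x : E3) (heq : ∀ s, 0 < s → ∫ y, w y * (√s / √π * gaussProfile (s * ‖y - x‖ ^ 2))
      = 2 * ∫ y, ρ y * exp (-(s * ‖y - x‖ ^ 2))) (hε : 0 < ε) (hT : ε ≤ T) :
    ∫ y, w y * (ε / (ε ^ 2 + ‖y - x‖ ^ 2) ^ 2 - T / (T ^ 2 + ‖y - x‖ ^ 2) ^ 2)
      = ∫ y, ρ y * (1 / (ε ^ 2 + ‖y - x‖ ^ 2) - 1 / (T ^ 2 + ‖y - x‖ ^ 2)) := by
  have hT0 : 0 < T := hε.trans_le hT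
  have hT2 : ε ^ 2 ≤ T ^ 2 := by gcongr
  have s1 : ∫ s in Set.Ioi (0 : ℝ), ∫ y, gaussWeight ε T s *
      (w y * (√s / √π * gaussProfile (s * ‖y - x‖ ^ 2))) = ∫ y, ∫ s in Set.Ioi (0 : ℝ),
      gaussWeight ε T s * (w y * (√s / √π * gaussProfile (s * ‖y - x‖ ^ 2))) :=
    integral_integral_swap (integrable_prod_gaussProfile hw hwi x hε hT2)
  have s2 : ∫ s in Set.Ioi (0 : ℝ), ∫ y, gaussWeight ε T s * (ρ y * exp (-(s * ‖y - x‖ ^ 2)))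
      = ∫ y, ∫ s in Set.Ioi (0 : ℝ), gaussWeight ε T s * (ρ y * exp (-(s * ‖y - x‖ ^ 2))) :=
    integral_integral_swap (integrable_prod_gaussWeight hρ hi x hε hT2)
  have e1 : ∀ y, ∫ s in Set.Ioi (0 : ℝ),
      gaussWeight ε T s * (w y * (√s / √π * gaussProfile (s * ‖y - x‖ ^ 2)))
      = 2 * (w y * (ε / (ε ^ 2 + ‖y - x‖ ^ 2) ^ 2 - T / (T ^ 2 + ‖y - x‖ ^ 2) ^ 2)) := by
    intro y
    simp_rw [mul_left_comm _ (w y)]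
    rw [integral_const_mul, integral_gaussWeight_mul_gaussProfile hε hT0 (by positivity)]
  have e2 : ∀ y, ∫ s in Set.Ioi (0 : ℝ), gaussWeight ε T s * (ρ y * exp (-(s * ‖y - x‖ ^ 2)))
      = ρ y * (1 / (ε ^ 2 + ‖y - x‖ ^ 2) - 1 / (T ^ 2 + ‖y - x‖ ^ 2)) := by
    intro y
    simp_rw [mul_left_comm _ (ρ y)]
    rw [integral_const_mul, integral_gaussWeight_mul_exp hε hT0 (by positivity)]
  have s3 : ∫ s in Set.Ioi (0 : ℝ), ∫ y, gaussWeight ε T s *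
      (w y * (√s / √π * gaussProfile (s * ‖y - x‖ ^ 2)))
      = 2 * ∫ s in Set.Ioi (0 : ℝ), ∫ y, gaussWeight ε T s * (ρ y * exp (-(s * ‖y - x‖ ^ 2))) := by
    rw [← integral_const_mul]
    refine setIntegral_congr_fun measurableSet_Ioi fun s hs => ?_
    simp only [integral_const_mul]
    rw [heq s hs]
    ring
  rw [s1, s2] at s3
  simp_rw [e1, e2, integral_const_mul] at s3
  linarith

end

lemma integral_one_add_sq_inv_sq : ∫ x : E3, ((1 + ‖x‖ ^ 2) ^ 2)⁻¹ = π ^ 2 := by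
  rw [integral_fun_norm_addHaar volume (fun r : ℝ => ((1 + r ^ 2) ^ 2)⁻¹)]
  have hd : ∀ r : ℝ, HasDerivAt (fun r : ℝ => (1 / 2) * (arctan r - r / (1 + r ^ 2)))
      (r ^ 2 * ((1 + r ^ 2) ^ 2)⁻¹) r := fun r => by
    have h0 : 1 + r ^ 2 ≠ 0 := by positivity
    have h2 : HasDerivAt (fun r : ℝ => 1 + r ^ 2) (2 * r) r :=
      ((hasDerivAt_pow 2 r).const_add 1).congr_deriv (by simp)
    have h3 := ((hasDerivAt_arctan r).sub ((hasDerivAt_id r).div h2 h0)).const_mul (1 / 2)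
    refine h3.congr_deriv ?_
    simp only [id]
    field_simp
    ring
  have ht : Tendsto (fun r : ℝ => (1 / 2) * (arctan r - r / (1 + r ^ 2))) atTop
      (nhds ((1 / 2) * (π / 2 - 0))) := by
    refine ((tendsto_arctan_atTop.mono_right nhdsWithin_le_nhds).sub ?_).const_mul _
    refine squeeze_zero_norm' (a := fun r : ℝ => r⁻¹) ?_ tendsto_inv_atTop_zero
    filter_upwards [eventually_gt_atTop 0] with r hr0
    rw [norm_of_nonneg (by positivity), div_le_iff₀ (by positivity), ← div_eq_inv_mul,
      le_div_iff₀ hr0]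
    nlinarith
  have hI := integral_Ioi_of_hasDerivAt_of_nonneg' (a := 0) (fun r _ => hd r)
    (fun r _ => by positivity) ht
  have hv : (volume : Measure E3).real (Metric.ball 0 1) = 4 / 3 * π := by
    have := EuclideanSpace.volume_ball_fin_three (0 : E3) 1
    rw [Measure.real, this, ENNReal.ofReal_one, one_pow, one_mul,
      ENNReal.toReal_ofReal (by positivity)]
    ring
  simp only [finrank_euclideanSpace, Fintype.card_fin, smul_eq_mul, nsmul_eq_mul, hv]
  norm_num at hI ⊢
  rw [hI]
  ring

/-- The unnormalised Poisson mean `∫ w(y) e (e² + |y - x|²)⁻² dy`. -/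
noncomputable def poissonMean (w : E3 → ℝ) (e : ℝ) (x : E3) : ℝ :=
  ∫ y, w y * (e / (e ^ 2 + ‖y - x‖ ^ 2) ^ 2)

/-- The regularised Riesz potential. -/
noncomputable def rieszReg (m : E3 → ℝ) (e : ℝ) (x : E3) : ℝ :=
  ∫ y, m y * (1 / (e ^ 2 + ‖y - x‖ ^ 2))

section

variable {w m : E3 → ℝ}

lemma integrable_mul_poisson (hw : Continuous w) (hi : Integrable fun y => |w y| / (1 + ‖y‖ ^ 4))
    {e : ℝ} (he : 0 < e) (x : E3) :
    Integrable fun y => w y * (e / (e ^ 2 + ‖y - x‖ ^ 2) ^ 2) := by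
  refine ((integrable_div_one_add_norm_sub hw hi x).const_mul (e * (1 + 1 / e ^ 4))).mono' ?_
    (ae_of_all _ fun y => ?_)
  · refine (hw.mul (continuous_const.div (by fun_prop) fun y => ?_)).aestronglyMeasurable
    positivity
  · rw [norm_mul, norm_eq_abs, norm_of_nonneg (by positivity)]
    have h : e / (e ^ 2 + ‖y - x‖ ^ 2) ^ 2 ≤ e * (1 + 1 / e ^ 4) / (1 + ‖y - x‖ ^ 4) := by
      rw [div_le_div_iff₀ (by positivity) (by positivity), mul_assoc]
      gcongr
      have e1 : (1 + 1 / e ^ 4) * (e ^ 2 + ‖y - x‖ ^ 2) ^ 2 = 1 + ‖y - x‖ ^ 4 + (e ^ 4 +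
        2 * e ^ 2 * ‖y - x‖ ^ 2 + 2 * ‖y - x‖ ^ 2 / e ^ 2 + ‖y - x‖ ^ 4 / e ^ 4) := by
        field_simp; ring
      rw [e1]
      exact le_add_of_nonneg_right (by positivity)
    calc _ ≤ |w y| * (e * (1 + 1 / e ^ 4) / (1 + ‖y - x‖ ^ 4)) := by gcongr
      _ = _ := by ring

lemma integrable_mul_rieszReg (hm : Continuous m) (hi : Integrable m) {e : ℝ} (he : 0 < e)
    (x : E3) : Integrable fun y => m y * (1 / (e ^ 2 + ‖y - x‖ ^ 2)) := by
  refine (hi.norm.mul_const (1 / e ^ 2)).mono' ?_ (ae_of_all _ fun y => ?_)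
  · refine (hm.mul (continuous_const.div (by fun_prop) fun y => ?_)).aestronglyMeasurable
    positivity
  · rw [norm_mul, norm_of_nonneg (by positivity : 0 ≤ 1 / (e ^ 2 + ‖y - x‖ ^ 2))]
    gcongr
    nlinarith [sq_nonneg ‖y - x‖]

lemma tendsto_rieszReg_atTop (hm : Continuous m) (hi : Integrable m) (x : E3) :
    Tendsto (fun T => rieszReg m T x) atTop (nhds 0) := by
  have h := tendsto_integral_filter_of_dominated_convergence (μ := volume)
    (F := fun T y => m y * (1 / (T ^ 2 + ‖y - x‖ ^ 2))) (l := atTop) (f := fun _ => 0)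
    (fun y => ‖m y‖) ?_ ?_ hi.norm ?_
  · simpa [rieszReg] using h
  · filter_upwards [eventually_gt_atTop 0] with T hT
    exact (integrable_mul_rieszReg hm hi hT x).aestronglyMeasurable
  · filter_upwards [eventually_ge_atTop 1] with T hT
    refine ae_of_all _ fun y => ?_
    rw [norm_mul]
    refine mul_le_of_le_one_right (norm_nonneg _) ?_
    rw [norm_of_nonneg (by positivity), div_le_one (by positivity)]
    nlinarith [sq_nonneg ‖y - x‖]
  · refine ae_of_all _ fun y => ?_
    rw [← mul_zero (m y)]
    refine Tendsto.const_mul _ (tendsto_const_nhds.div_atTop ?_)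
    exact tendsto_atTop_add_const_right _ _ (tendsto_pow_atTop two_ne_zero)

lemma abs_poisson_sub_le {T : ℝ} (hT : 1 ≤ T) (x y : E3) :
    |T / (T ^ 2 + ‖y - x‖ ^ 2) ^ 2 - T / (T ^ 2 + ‖y - 0‖ ^ 2) ^ 2|
      ≤ ‖x‖ * (1 / (1 ^ 2 + ‖y - x‖ ^ 2) ^ 2 + 1 / (1 ^ 2 + ‖y - 0‖ ^ 2) ^ 2) := by
  rw [sub_zero]
  have hd : |‖y - x‖ - ‖y‖| ≤ ‖x‖ := by
    have := abs_norm_sub_norm_le (y - x) y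
    simpa using this
  have hT0 : 0 < T := by linarith
  set q := ‖y - x‖ with hq
  set p := ‖y‖ with hp
  have hq0 : 0 ≤ q := norm_nonneg _
  have hp0 : 0 ≤ p := norm_nonneg _
  set a := T ^ 2 + q ^ 2 with ha
  set b := T ^ 2 + p ^ 2 with hb
  have ha0 : 0 < a := by positivity
  have hb0 : 0 < b := by positivity
  have h1 : T * (p + q) ≤ (a + b) / 2 := by nlinarith [sq_nonneg (T - p), sq_nonneg (T - q)]
  have h2 : T / a ^ 2 - T / b ^ 2 = -((q - p) * (T * (p + q) * (a + b))) / (a ^ 2 * b ^ 2) := by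
    rw [div_sub_div _ _ (by positivity) (by positivity)]
    congr 1
    rw [ha, hb]; ring
  have h3 : |T / a ^ 2 - T / b ^ 2| ≤ ‖x‖ * (1 / a ^ 2 + 1 / b ^ 2) := by
    rw [h2, abs_div, abs_neg, abs_mul, abs_of_pos (show 0 < a ^ 2 * b ^ 2 by positivity),
      abs_of_nonneg (show 0 ≤ T * (p + q) * (a + b) by positivity), div_le_iff₀ (by positivity)]
    have h4 : ‖x‖ * (1 / a ^ 2 + 1 / b ^ 2) * (a ^ 2 * b ^ 2) = ‖x‖ * (a ^ 2 + b ^ 2) := by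
      field_simp; ring
    rw [h4]
    refine mul_le_mul hd ?_ (by positivity) (norm_nonneg x)
    nlinarith [sq_nonneg (a - b)]
  refine h3.trans ?_
  have hT2 : 1 ^ 2 ≤ T ^ 2 := by gcongr
  have ha1 : 1 ^ 2 + q ^ 2 ≤ a := by linarith
  have hb1 : 1 ^ 2 + p ^ 2 ≤ b := by linarith
  gcongr

lemma tendsto_poissonMean_sub (hw : Continuous w)
    (hi : Integrable fun y => |w y| / (1 + ‖y‖ ^ 4)) (x : E3) :
    Tendsto (fun T => poissonMean w T x - poissonMean w T 0) atTop (nhds 0) := by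
  have hsub : ∀ T, 0 < T → poissonMean w T x - poissonMean w T 0 = ∫ y,
      w y * (T / (T ^ 2 + ‖y - x‖ ^ 2) ^ 2 - T / (T ^ 2 + ‖y - 0‖ ^ 2) ^ 2) := fun T hT => by
    rw [poissonMean, poissonMean, ← integral_sub (integrable_mul_poisson hw hi hT x)
      (integrable_mul_poisson hw hi hT 0)]
    simp_rw [mul_sub]
  have hd := ((integrable_mul_poisson hw hi one_pos x).norm.add
    (integrable_mul_poisson hw hi one_pos 0).norm).const_mul ‖x‖
  have h := tendsto_integral_filter_of_dominated_convergence (μ := volume)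
    (F := fun T y => w y * (T / (T ^ 2 + ‖y - x‖ ^ 2) ^ 2 - T / (T ^ 2 + ‖y - 0‖ ^ 2) ^ 2))
    (l := atTop) (f := fun _ => 0) _ ?_ ?_ hd ?_
  · rw [integral_zero] at h
    refine h.congr' ?_
    filter_upwards [eventually_gt_atTop 0] with T hT
    exact (hsub T hT).symm
  · filter_upwards [eventually_gt_atTop 0] with T hT
    simp_rw [mul_sub]
    exact ((integrable_mul_poisson hw hi hT x).sub
      (integrable_mul_poisson hw hi hT 0)).aestronglyMeasurable
  · filter_upwards [eventually_ge_atTop 1] with T hT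
    refine ae_of_all _ fun y => ?_
    have h1 := mul_le_mul_of_nonneg_left (abs_poisson_sub_le hT x y) (abs_nonneg (w y))
    simp only [Pi.add_apply]
    rw [norm_mul, norm_mul, norm_mul, norm_of_nonneg (show 0 ≤ 1 / (1 ^ 2 + ‖y - x‖ ^ 2) ^ 2 by
      positivity), norm_of_nonneg (show 0 ≤ 1 / (1 ^ 2 + ‖y - 0‖ ^ 2) ^ 2 by positivity)]
    simp only [norm_eq_abs] at h1 ⊢
    linarith
  · refine ae_of_all _ fun y => ?_
    rw [← mul_zero (w y), ← sub_zero (0 : ℝ)]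
    have hz : ∀ z : E3, Tendsto (fun T : ℝ => T / (T ^ 2 + ‖y - z‖ ^ 2) ^ 2) atTop (nhds 0) := by
      intro z
      refine squeeze_zero_norm' (a := fun T : ℝ => T⁻¹) ?_ tendsto_inv_atTop_zero
      filter_upwards [eventually_ge_atTop 1] with T hT
      rw [norm_of_nonneg (by positivity), div_le_iff₀ (by positivity), ← div_eq_inv_mul,
        le_div_iff₀ (by positivity)]
      have h1 : T * T ≤ T ^ 2 + ‖y - z‖ ^ 2 := by nlinarith [sq_nonneg ‖y - z‖]
      have h2 : 1 ≤ T ^ 2 + ‖y - z‖ ^ 2 := by nlinarith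
      nlinarith
    exact ((hz x).sub (hz 0)).const_mul _

lemma tendsto_rieszReg_zero (hm : Continuous m) (hi : Integrable m) (x : E3) :
    Tendsto (fun c : ℝ => rieszReg m c⁻¹ x) atTop (nhds (rieszPot m x)) := by
  have hint : Integrable fun y => (‖x - y‖ ^ 2)⁻¹ * m y :=
    integrable_kernel_mul (k := fun z => (‖z‖ ^ 2)⁻¹) (A := 1) (B := 1) hm hi (by fun_prop)
      (fun z => by
        rw [abs_of_nonneg (by positivity), one_mul]
        exact inv_sq_le_ballKer z) x
  refine tendsto_integral_filter_of_dominated_convergence (fun y => ‖(‖x - y‖ ^ 2)⁻¹ * m y‖)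
    ?_ ?_ hint.norm ?_
  · filter_upwards [eventually_gt_atTop 0] with c hc
    exact (integrable_mul_rieszReg hm hi (inv_pos.2 hc) x).aestronglyMeasurable
  · filter_upwards [eventually_gt_atTop 0] with c hc
    filter_upwards [ae_ne_point x] with y hy
    have : 0 < ‖y - x‖ := norm_pos_iff.2 (sub_ne_zero.2 hy)
    rw [norm_mul, norm_mul, mul_comm, norm_sub_rev x y]
    refine mul_le_mul_of_nonneg_right ?_ (norm_nonneg _)
    rw [norm_of_nonneg (by positivity), norm_of_nonneg (by positivity), one_div]
    gcongr
    have : 0 ≤ c⁻¹ ^ 2 := by positivity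
    linarith
  · filter_upwards [ae_ne_point x] with y hy
    have h0 : ‖y - x‖ ^ 2 ≠ 0 := pow_ne_zero _ (norm_ne_zero_iff.2 (sub_ne_zero.2 hy))
    have h1 : Tendsto (fun c : ℝ => c⁻¹ ^ 2 + ‖y - x‖ ^ 2) atTop (nhds (0 ^ 2 + ‖y - x‖ ^ 2)) :=
      (tendsto_inv_atTop_zero.pow 2).add_const _
    rw [zero_pow two_ne_zero, zero_add] at h1
    have h2 := (h1.inv₀ h0).const_mul (m y)
    rw [norm_sub_rev x y, mul_comm]
    simpa [one_div] using h2

lemma tendsto_norm_pow_three_mul_poisson :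
    Tendsto (fun z : E3 => ‖z‖ ^ 3 * ((π ^ 2)⁻¹ * ((1 + ‖z‖ ^ 2) ^ 2)⁻¹))
      (Bornology.cobounded E3) (nhds 0) := by
  have h : Tendsto (fun z : E3 => (π ^ 2)⁻¹ * ‖z‖⁻¹) (Bornology.cobounded E3) (nhds 0) := by
    rw [← mul_zero (π ^ 2)⁻¹]
    exact (tendsto_inv_atTop_zero.comp tendsto_norm_cobounded_atTop).const_mul _
  refine squeeze_zero_norm' ?_ h
  filter_upwards [tendsto_norm_cobounded_atTop.eventually_gt_atTop 0] with z hz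
  rw [norm_of_nonneg (by positivity), mul_left_comm]
  gcongr
  rw [← div_eq_mul_inv, div_le_iff₀ (by positivity), ← div_eq_inv_mul, le_div_iff₀ hz]
  nlinarith [sq_nonneg ‖z‖]

lemma tendsto_poissonMean_zero (hw : Continuous w)
    (hi : Integrable fun y => |w y| / (1 + ‖y‖ ^ 4)) (x : E3) :
    Tendsto (fun c : ℝ => poissonMean w c⁻¹ x) atTop (nhds (π ^ 2 * w x)) := by
  set B := Metric.closedBall x 1
  have hB : MeasurableSet B := Metric.isClosed_closedBall.measurableSet
  have hin : Tendsto (fun c : ℝ => ∫ y, B.indicator w y * (c⁻¹ / (c⁻¹ ^ 2 + ‖y - x‖ ^ 2) ^ 2)) atTop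
      (nhds (π ^ 2 * w x)) := by
    have hφ : ∫ z : E3, (π ^ 2)⁻¹ * ((1 + ‖z‖ ^ 2) ^ 2)⁻¹ = 1 := by
      rw [integral_const_mul, integral_one_add_sq_inv_sq, inv_mul_cancel₀ (by positivity)]
    have hg : Integrable (B.indicator w) :=
      (hw.continuousOn.integrableOn_compact (isCompact_closedBall x 1)).integrable_indicator hB
    have hgc : ContinuousAt (B.indicator w) x := by
      refine hw.continuousAt.congr ?_
      filter_upwards [Metric.closedBall_mem_nhds x one_pos] with y hy
      exact (Set.indicator_of_mem hy w).symm
    have h := tendsto_integral_comp_smul_smul_of_integrable' (μ := volume)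
      (φ := fun z : E3 => (π ^ 2)⁻¹ * ((1 + ‖z‖ ^ 2) ^ 2)⁻¹) (fun z => by positivity) hφ
      (by simpa using tendsto_norm_pow_three_mul_poisson) hg hgc
    rw [Set.indicator_of_mem (Metric.mem_closedBall_self zero_le_one)] at h
    refine (h.const_mul (π ^ 2)).congr' ?_
    filter_upwards [eventually_gt_atTop 0] with c hc
    rw [← integral_const_mul]
    refine integral_congr_ae (ae_of_all _ fun y => ?_)
    simp only [finrank_euclideanSpace, Fintype.card_fin, smul_eq_mul]
    rw [norm_smul, norm_of_nonneg hc.le, norm_sub_rev x y]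
    have : 0 < π := pi_pos
    field_simp
  have hout : Tendsto (fun c : ℝ => ∫ y, Bᶜ.indicator w y * (c⁻¹ / (c⁻¹ ^ 2 + ‖y - x‖ ^ 2) ^ 2))
      atTop (nhds 0) := by
    have h := tendsto_integral_filter_of_dominated_convergence (μ := volume)
      (F := fun (c : ℝ) y => Bᶜ.indicator w y * (c⁻¹ / (c⁻¹ ^ 2 + ‖y - x‖ ^ 2) ^ 2))
      (l := atTop) (f := fun _ => 0) _ ?_ ?_
      ((integrable_div_one_add_norm_sub hw hi x).const_mul 2) ?_
    · simpa using h
    · filter_upwards [eventually_gt_atTop 0] with c hc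
      refine ((hw.aestronglyMeasurable).indicator hB.compl).mul ?_
      refine (continuous_const.div (by fun_prop) fun y => ?_).aestronglyMeasurable
      have := inv_pos.2 hc
      positivity
    · filter_upwards [eventually_ge_atTop 1] with c hc
      refine ae_of_all _ fun y => ?_
      by_cases hy : y ∈ B
      · rw [Set.indicator_of_notMem (by simpa using hy)]
        simp only [zero_mul, norm_zero]
        positivity
      · rw [Set.indicator_of_mem (show y ∈ Bᶜ from hy), norm_mul, norm_of_nonneg
          (show 0 ≤ c⁻¹ / (c⁻¹ ^ 2 + ‖y - x‖ ^ 2) ^ 2 by positivity), norm_eq_abs]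
        have hr : 1 < ‖y - x‖ := by
          simpa [B, Metric.mem_closedBall, dist_eq_norm] using hy
        have hc1 : c⁻¹ ≤ 1 := inv_le_one_of_one_le₀ hc
        have hr4 : 1 ≤ ‖y - x‖ ^ 4 := one_le_pow₀ hr.le
        have hle : ‖y - x‖ ^ 4 ≤ (c⁻¹ ^ 2 + ‖y - x‖ ^ 2) ^ 2 := by
          rw [show ‖y - x‖ ^ 4 = (‖y - x‖ ^ 2) ^ 2 by ring]
          gcongr
          have : 0 ≤ c⁻¹ ^ 2 := by positivity
          linarith
        have : c⁻¹ / (c⁻¹ ^ 2 + ‖y - x‖ ^ 2) ^ 2 ≤ 2 / (1 + ‖y - x‖ ^ 4) := by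
          rw [div_le_div_iff₀ (by positivity) (by positivity)]
          nlinarith
        calc _ ≤ |w y| * (2 / (1 + ‖y - x‖ ^ 4)) := by gcongr
          _ = _ := by ring
    · refine ae_of_all _ fun y => ?_
      by_cases hy : y ∈ B
      · rw [Set.indicator_of_notMem (by simpa using hy)]
        simp
      · have hr : 1 < ‖y - x‖ := by
          simpa [B, Metric.mem_closedBall, dist_eq_norm] using hy
        have h1 : Tendsto (fun c : ℝ => c⁻¹ / (c⁻¹ ^ 2 + ‖y - x‖ ^ 2) ^ 2) atTop
            (nhds (0 / (0 ^ 2 + ‖y - x‖ ^ 2) ^ 2)) :=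
          tendsto_inv_atTop_zero.div (((tendsto_inv_atTop_zero.pow 2).add_const _).pow 2)
            (by positivity)
        rw [zero_div] at h1
        rw [← mul_zero (Bᶜ.indicator w y)]
        exact h1.const_mul _
  have hsum := hin.add hout
  rw [add_zero] at hsum
  refine hsum.congr' ?_
  filter_upwards [eventually_gt_atTop 0] with c hc
  have hc' := inv_pos.2 hc
  have hI := integrable_mul_poisson hw hi hc' x
  have hI1 : ∀ S : Set E3, MeasurableSet S →
      Integrable fun y => S.indicator w y * (c⁻¹ / (c⁻¹ ^ 2 + ‖y - x‖ ^ 2) ^ 2) := fun S hS => by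
    refine (hI.indicator hS).congr (ae_of_all _ fun y => ?_)
    by_cases hy : y ∈ S <;> simp [hy]
  rw [← integral_add (hI1 B hB) (hI1 Bᶜ hB.compl), poissonMean]
  refine integral_congr_ae (ae_of_all _ fun y => ?_)
  by_cases hy : y ∈ B <;> simp [hy]

/-- Inverting the half-Laplacian tested against Gaussians. -/
theorem eq_const_add_rieszPot (hw : Continuous w)
    (hwi : Integrable fun y => |w y| / (1 + ‖y‖ ^ 4)) (hm : Continuous m) (hi : Integrable m)
    (heq : ∀ x s, 0 < s → ∫ y, w y * (√s / √π * gaussProfile (s * ‖y - x‖ ^ 2))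
      = 2 * ∫ y, m y * exp (-(s * ‖y - x‖ ^ 2))) :
    ∃ a, ∀ x, w x = a + 1 / π ^ 2 * rieszPot m x := by
  have hE : ∀ x e T, 0 < e → e ≤ T →
      poissonMean w e x - rieszReg m e x = poissonMean w T x - rieszReg m T x := by
    intro x e T he hT
    have hT0 := he.trans_le hT
    have h := integral_poisson_sub_eq hw hwi hm hi x (heq x) he hT
    simp_rw [mul_sub] at h
    rw [integral_sub (integrable_mul_poisson hw hwi he x) (integrable_mul_poisson hw hwi hT0 x),
      integral_sub (integrable_mul_rieszReg hm hi he x) (integrable_mul_rieszReg hm hi hT0 x)] at h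
    simp only [poissonMean, rieszReg]
    linarith
  have hconst : ∀ x e, 0 < e → poissonMean w e x - rieszReg m e x
      = poissonMean w e 0 - rieszReg m e 0 := by
    intro x e he
    have h1 := ((tendsto_poissonMean_sub hw hwi x).sub (tendsto_rieszReg_atTop hm hi x)).add
      (tendsto_rieszReg_atTop hm hi 0)
    have h2 : Tendsto (fun T : ℝ => poissonMean w T x - poissonMean w T 0 - rieszReg m T x
        + rieszReg m T 0) atTop (nhds (poissonMean w e x - rieszReg m e x
        - (poissonMean w e 0 - rieszReg m e 0))) := by
      refine tendsto_const_nhds.congr' ?_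
      filter_upwards [eventually_ge_atTop e] with T hT
      linarith [hE x e T he hT, hE 0 e T he hT]
    have h3 := tendsto_nhds_unique h1 h2
    linarith
  have hlim : ∀ x, Tendsto (fun c : ℝ => poissonMean w c⁻¹ x - rieszReg m c⁻¹ x) atTop
      (nhds (π ^ 2 * w x - rieszPot m x)) := fun x =>
    (tendsto_poissonMean_zero hw hwi x).sub (tendsto_rieszReg_zero hm hi x)
  refine ⟨w 0 - 1 / π ^ 2 * rieszPot m 0, fun x => ?_⟩
  have h := tendsto_nhds_unique ((hlim x).congr' (by
    filter_upwards [eventually_gt_atTop 0] with c hc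
    exact hconst x c⁻¹ (inv_pos.2 hc))) (hlim 0)
  have : 0 < π := pi_pos
  field_simp
  linarith

end

/-- Theorem 6: a non-spherical smooth finite-volume solution of `(−Δ)^{3/2}u = 2e^{3u}`
has volume `V = ∫ e^{3u} < 2π²`. -/
theorem volume_lt_of_nonspherical (u : E3 → ℝ) (hu : IsSolution u)
    (hns : ¬ IsSpherical u) :
    ∫ x, Real.exp (3 * u x) < 2 * Real.pi ^ 2 := by
  obtain ⟨hsm, ⟨-, hw⟩, hi, heq⟩ := hu
  have hu2 : ContDiff ℝ 2 u := hsm.of_le (WithTop.coe_le_coe.2 le_top)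
  obtain ⟨a, ha⟩ := eq_const_add_rieszPot (w := fun x => -lap u x)
    (m := fun x => exp (3 * u x)) (continuous_lap hu2).neg (by simpa using hw)
    (by have := hu2.continuous; fun_prop) hi (fun x s hs => by
      have h := heq (gaussianAt s hs x)
      simpa only [halfLap_gaussianAt, gaussianAt_apply] using h)
  by_contra! hV
  exact hns (isSpherical_of_lap_eq hu2 hi ha hV)
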